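/- (Cubic large sieve with decaying coefficients.) Let Q₁, Q₂ ≥ 1/2, Q* := min{Q₁, Q₂}, R ≥ 1/2, and let a(𝔟), defined on nonzero ideals of ℤ[ω], satisfy a(𝔟) ≪_ε N(𝔟)^ε for every ε > 0. For q ∈ F₃ set ℛ(q) := ∑_{0 ≠ 𝔟 ⊴ ℤ[ω], N(𝔟) ≤ R} a(𝔟) χ_q(𝔟) N(𝔟)^{−1/2}. Then for every ε > 0: ∑_{q ∈ F₃(Q₁, Q₂)} |ℛ(q)|² ≪_ε (R Q₁ Q₂)^ε ( Q₁Q₂ + Q* R + (Q*)^{1/3} (Q₁Q₂R)^{2/3} ), the implied constant depending also on the implied constants in the hypothesis on a. -/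

import Mathlib

noncomputable section

open Complex

namespace CubicPaper

/-- `ω = e^{2πi/3}`. -/
def ωc : ℂ := Complex.exp (2 * Real.pi * Complex.I / 3)

/-- The ring of Eisenstein integers `ℤ[ω]`, realized as a subring of `ℂ`. -/
def Eis : Subring ℂ := Subring.closure {ωc}

/-- `ω` as an Eisenstein integer. -/
def ωE : Eis := ⟨ωc, Subring.subset_closure (Set.mem_singleton _)⟩

/-- The ramified prime `λ = 1 + 2ω`. -/
def lam : Eis := 1 + 2 * ωE

/-- The norm `N(x) = |x|²`. -/
def Nm (x : Eis) : ℝ := Complex.normSq (x : ℂ)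

/-- The norm as a natural number. -/
def NmN (x : Eis) : ℕ := ⌊Nm x⌋₊

/-- `Rep x` : `x` is the canonical generator `λ^k c`, `c ≡ 1 (mod 3)`, of a nonzero ideal;
nonzero ideals of `ℤ[ω]` are in bijection with elements satisfying `Rep`. -/
def Rep (x : Eis) : Prop := ∃ (k : ℕ) (c : Eis), (3 : Eis) ∣ (c - 1) ∧ x = lam ^ k * c

/-- `ě(z) = e^{2πi(z + z̄)}`. -/
def eE (z : ℂ) : ℂ := Complex.exp (2 * Real.pi * Complex.I * (z + (starRingEnd ℂ) z))

/-- Characterizing axioms of the cubic residue symbol; `χ b a` denotes `(a/b)₃`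
(the lower entry `b ≡ 1 (mod 3)` comes first). -/
structure IsCubicSymbol (χ : Eis → Eis → Eis) : Prop where
  one_bot : ∀ a, χ 1 a = 1
  mul_bot : ∀ b₁ b₂ a, (3 : Eis) ∣ (b₁ - 1) → (3 : Eis) ∣ (b₂ - 1) →
    χ (b₁ * b₂) a = χ b₁ a * χ b₂ a
  prime_vals : ∀ π a, Prime π → (3 : Eis) ∣ (π - 1) →
    χ π a = 0 ∨ χ π a = 1 ∨ χ π a = ωE ∨ χ π a = ωE ^ 2
  prime_congr : ∀ π a, Prime π → (3 : Eis) ∣ (π - 1) →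
    π ∣ (a ^ ((NmN π - 1) / 3) - χ π a)
  prime_eq_zero : ∀ π a, Prime π → (3 : Eis) ∣ (π - 1) → (χ π a = 0 ↔ π ∣ a)

/-- Characterizing axioms of the Möbius function on `ℤ[ω]`. -/
structure IsMoebius (μ : Eis → ℤ) : Prop where
  isUnit : ∀ u : Eis, IsUnit u → μ u = 1
  prime_mul : ∀ p x, Prime p → ¬ p ∣ x → μ (p * x) = - μ x
  eq_zero : ∀ x : Eis, ¬ Squarefree x → μ x = 0

/-- The cubic Gauss sum `g₃(m, c) = ∑_{d mod c} χ_c(d) ě(md/c)`. -/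
def g₃ (χ : Eis → Eis → Eis) (m c : Eis) : ℂ :=
  ∑ᶠ d : Eis ⧸ Ideal.span {c}, ((χ c d.out : Eis) : ℂ) * eE (((m * d.out : Eis) : ℂ) / (c : ℂ))

/-- The normalized cubic Gauss sum `g̃₃(m, c) = N(c)^{-1/2} g₃(m, c)`. -/
def g₃n (χ : Eis → Eis → Eis) (m c : Eis) : ℂ :=
  ((Real.sqrt (Nm c) : ℂ))⁻¹ * g₃ χ m c

/-- Euler's totient on `ℤ[ω]`. -/
def phiE (b : Eis) : ℕ := Nat.card {x : Eis ⧸ Ideal.span {b} // IsUnit x}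

/-- The kernel `Φ_j(y) = (1/2πi)∫_{(2)} (2π)^{-jw} y^{-w} (Γ(1/2+w)/Γ(1/2))^j dw/w`. -/
def Φ (j : ℕ) (y : ℝ) : ℂ :=
  (1 / (2 * Real.pi)) * ∫ t : ℝ,
    (2 * Real.pi : ℂ) ^ (-((j : ℂ) * (2 + t * Complex.I))) *
    (y : ℂ) ^ (-(2 + t * Complex.I)) *
    (Complex.Gamma (1 / 2 + (2 + t * Complex.I)) / Complex.Gamma (1 / 2)) ^ j /
    (2 + t * Complex.I)

/-- `A₁(q)`, the sum appearing in the approximate functional equation for `L(1/2, χ_q)`. -/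
def A₁ (χ : Eis → Eis → Eis) (q : Eis) : ℂ :=
  ∑' n : {x : Eis // Rep x},
    ((χ q n.1 : Eis) : ℂ) * (Nm n.1 : ℂ) ^ (-(1/2 : ℂ)) *
      Φ 1 (Nm n.1 / Real.sqrt (3 * Nm q))

/-- `A₂(q)`, the double sum appearing in the approximate functional equation for
`|L(1/2, χ_q)|²`. -/
def A₂ (χ : Eis → Eis → Eis) (q : Eis) : ℂ :=
  ∑' p : {x : Eis // Rep x} × {x : Eis // Rep x},
    ((χ q p.1.1 : Eis) : ℂ) * (starRingEnd ℂ) ((χ q p.2.1 : Eis) : ℂ) *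
      ((Nm p.1.1 * Nm p.2.1 : ℝ) : ℂ) ^ (-(1/2 : ℂ)) *
      Φ 2 (Nm p.1.1 * Nm p.2.1 / (3 * Nm q))

/-- `M_Y(q) = ∑_{𝔩² ∣ q, N(𝔩) ≤ Y} μ(𝔩)` (sum over nonzero ideals `𝔩`, i.e. over
canonical generators). -/
def MY (μ : Eis → ℤ) (Y : ℝ) (q : Eis) : ℤ :=
  ∑ᶠ l ∈ {l : Eis | Rep l ∧ l ^ 2 ∣ q ∧ Nm l ≤ Y}, μ l

/-- `R_Y(q) = ∑_{𝔩² ∣ q, N(𝔩) > Y} μ(𝔩)`. -/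
def RY (μ : Eis → ℤ) (Y : ℝ) (q : Eis) : ℤ :=
  ∑ᶠ l ∈ {l : Eis | Rep l ∧ l ^ 2 ∣ q ∧ Y < Nm l}, μ l

/-- The mollifier `𝓜(q) = ∑_𝔟 λ(𝔟) √N(𝔟) χ_q(𝔟)` attached to coefficients `lm`
(supported on canonical generators of squarefree ideals coprime to 3). -/
def Moll (χ : Eis → Eis → Eis) (lm : Eis → ℂ) (q : Eis) : ℂ :=
  ∑ᶠ b : Eis, lm b * (Real.sqrt (Nm b) : ℂ) * ((χ q b : Eis) : ℂ)

/-- `𝒮_M(β; F) = ∑_{q ≡ 1 (9)} M_Y(q) β_q F(N(q)/X)`. -/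
def SM (μ : Eis → ℤ) (Y X : ℝ) (F : ℝ → ℝ) (β : Eis → ℂ) : ℂ :=
  ∑ᶠ q ∈ {q : Eis | (9 : Eis) ∣ (q - 1)}, (MY μ Y q : ℂ) * β q * (F (Nm q / X) : ℂ)

/-- `𝒮_R(|β|; F) = ∑_{q ≡ 1 (9)} |R_Y(q)| ‖β_q‖ F(N(q)/X)`. -/
def SR (μ : Eis → ℤ) (Y X : ℝ) (F : ℝ → ℝ) (β : Eis → ℂ) : ℝ :=
  ∑ᶠ q ∈ {q : Eis | (9 : Eis) ∣ (q - 1)}, |(RY μ Y q : ℝ)| * ‖β q‖ * F (Nm q / X)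

/-- A test function: Schwartz (here: smooth), compactly supported in `(1,2)`,
with `0 ≤ F ≤ 1`. -/
structure IsTestFn (F : ℝ → ℝ) : Prop where
  smooth : ContDiff ℝ (⊤ : ℕ∞) F
  supp : ∀ t, F t ≠ 0 → 1 < t ∧ t < 2
  nonneg : ∀ t, 0 ≤ F t
  le_one : ∀ t, F t ≤ 1

/-- `F̌(0) = ∫₀^∞ F(t) dt`. -/
def Fcheck0 (F : ℝ → ℝ) : ℝ := ∫ t in Set.Ioi (0:ℝ), F t

/-- `F̌'(0) = ∫₀^∞ F(t) log t dt`. -/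
def Fcheck'0 (F : ℝ → ℝ) : ℝ := ∫ t in Set.Ioi (0:ℝ), F t * Real.log t

/-- The Dedekind zeta function of `ℚ(ω)` (at real `s > 1`). -/
def zetaK (s : ℝ) : ℝ := ∑' n : {x : Eis // Rep x}, (Nm n.1) ^ (-s)

/-- Product of `f(N(𝔭))` over the prime ideals `𝔭 ∤ 3` of `ℤ[ω]`, i.e. over primes
`π ≡ 1 (mod 3)` (one in each associate class). -/
def primeProd (f : ℝ → ℝ) : ℝ :=
  ∏' π : {p : Eis // Prime p ∧ (3 : Eis) ∣ (p - 1)}, f (Nm π.1)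

/-- Product of `f(N(𝔭))` over the prime ideals `𝔭 ∤ 3` dividing `x` (a finite product). -/
def primeDivProd (f : ℝ → ℝ) (x : Eis) : ℝ :=
  ∏ᶠ π ∈ {p : Eis | Prime p ∧ (3 : Eis) ∣ (p - 1) ∧ p ∣ x}, f (Nm π)

/-- The Hecke `L`-series `∑_𝔫 χ_q(𝔫) N(𝔫)^{-s}` (convergent for `Re(s) > 1`). -/
def heckeSeries (χ : Eis → Eis → Eis) (q : Eis) (s : ℂ) : ℂ :=
  ∑' n : {x : Eis // Rep x}, ((χ q n.1 : Eis) : ℂ) * (Nm n.1 : ℂ) ^ (-s)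

/-- `L` is the (unique) entire continuation of the Hecke `L`-series of `χ_q`. -/
def IsHeckeL (χ : Eis → Eis → Eis) (q : Eis) (L : ℂ → ℂ) : Prop :=
  Differentiable ℂ L ∧ ∀ s : ℂ, 1 < s.re → L s = heckeSeries χ q s

/-- Membership in the family `F₃` of conductors of primitive cubic Hecke characters
congruent to `1 (mod 9)`. -/
def memF₃ (q : Eis) : Prop :=
  ∃ q₁ q₂ : Eis, (3 : Eis) ∣ (q₁ - 1) ∧ (3 : Eis) ∣ (q₂ - 1) ∧ Squarefree (q₁ * q₂) ∧
    NmN (q₁ * q₂ ^ 2) % 9 = 1 ∧ q = q₁ * q₂ ^ 2 ∧ (9 : Eis) ∣ (q - 1) ∧ q ≠ 1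

/-- `ψ_α(r, s) = ∑_{c ≡ 1 (3), (c, α) = 1} g₃(r, c) N(c)^{-s}`. -/
def ψa (χ : Eis → Eis → Eis) (α r : Eis) (s : ℂ) : ℂ :=
  ∑' c : {c : Eis // (3 : Eis) ∣ (c - 1) ∧ IsCoprime c α},
    g₃ χ r c.1 * (Nm c.1 : ℂ) ^ (-s)

/-- `ψ(r, s) = ∑_{c ≡ 1 (3)} g₃(r, c) N(c)^{-s}`. -/
def ψ₀ (χ : Eis → Eis → Eis) (r : Eis) (s : ℂ) : ℂ :=
  ∑' c : {c : Eis // (3 : Eis) ∣ (c - 1)}, g₃ χ r c.1 * (Nm c.1 : ℂ) ^ (-s)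

/-- `Δ_α(s) = ∏_{π ≡ 1 (3) prime, π ∣ α} (1 - N(π)^{2-3s})`. -/
def Δprod (α : Eis) (s : ℂ) : ℂ :=
  ∏ᶠ π ∈ {p : Eis | Prime p ∧ (3 : Eis) ∣ (p - 1) ∧ p ∣ α},
    (1 - (Nm π : ℂ) ^ ((2 : ℂ) - 3 * s))

/-- `Ψ` is the (unique) continuation of `ψ(r, ·)` to the strip `1 < Re(s) < 2`,
holomorphic away from `s = 4/3`. -/
def IsPsiContinuation (χ : Eis → Eis → Eis) (r : Eis) (Ψ : ℂ → ℂ) : Prop :=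
  (∀ s : ℂ, 1 < s.re → s.re < 2 → s ≠ 4/3 → DifferentiableAt ℂ Ψ s) ∧
  (∀ s : ℂ, 3/2 < s.re → s.re < 2 → Ψ s = ψ₀ χ r s)


/-- Membership in `F₃(Q₁, Q₂)`, with explicit `≍`-constants `c₁ ≤ c₂`:
`q = q₁q₂² ∈ F₃` with `N(q₁) ≍ Q₁` and `N(q₂) ≍ Q₂`. -/
def memF₃Q (c₁ c₂ Q₁ Q₂ : ℝ) (q : Eis) : Prop :=
  ∃ q₁ q₂ : Eis, (3 : Eis) ∣ (q₁ - 1) ∧ (3 : Eis) ∣ (q₂ - 1) ∧ Squarefree (q₁ * q₂) ∧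
    NmN (q₁ * q₂ ^ 2) % 9 = 1 ∧ q = q₁ * q₂ ^ 2 ∧ (9 : Eis) ∣ (q - 1) ∧ q ≠ 1 ∧
    c₁ * Q₁ ≤ Nm q₁ ∧ Nm q₁ ≤ c₂ * Q₁ ∧ c₁ * Q₂ ≤ Nm q₂ ∧ Nm q₂ ≤ c₂ * Q₂

/-- The cubic Dirichlet polynomial `ℛ(q) = ∑_{N(𝔟) ≤ R} a(𝔟) χ_q(𝔟) N(𝔟)^{-1/2}`. -/
def Rpoly (χ : Eis → Eis → Eis) (a : Eis → ℂ) (R : ℝ) (q : Eis) : ℂ :=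
  ∑ᶠ b ∈ {b : Eis | Rep b ∧ Nm b ≤ R},
    a b * ((χ q b : Eis) : ℂ) * ((Real.sqrt (Nm b) : ℂ))⁻¹

/-! ### Part 1: arithmetic of the Eisenstein integers -/

lemma ωc_eq : ωc = ⟨-1/2, Real.sqrt 3 / 2⟩ := by
  unfold ωc
  have : (2 * Real.pi * Complex.I / 3 : ℂ) = ((2 * Real.pi / 3 : ℝ) : ℂ) * I := by
    push_cast; ring
  rw [this, Complex.exp_mul_I, ← Complex.ofReal_cos, ← Complex.ofReal_sin]
  have h1 : Real.cos (2 * Real.pi / 3) = -1/2 := by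
    have : 2 * Real.pi / 3 = Real.pi - Real.pi / 3 := by ring
    rw [this, Real.cos_pi_sub, Real.cos_pi_div_three]; norm_num
  have h2 : Real.sin (2 * Real.pi / 3) = Real.sqrt 3 / 2 := by
    have : 2 * Real.pi / 3 = Real.pi - Real.pi / 3 := by ring
    rw [this, Real.sin_pi_sub, Real.sin_pi_div_three]
  rw [h1, h2]
  apply Complex.ext <;> simp

lemma ωc_sq : ωc ^ 2 = -1 - ωc := by
  rw [ωc_eq]
  have h : Real.sqrt 3 * Real.sqrt 3 = 3 := Real.mul_self_sqrt (by norm_num)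
  apply Complex.ext
  · simp [pow_two]; nlinarith
  · simp [pow_two]; ring

lemma conj_ωc : (starRingEnd ℂ) ωc = -1 - ωc := by
  rw [ωc_eq]
  apply Complex.ext
  · simp; norm_num
  · simp

lemma ωE_sq : ωE ^ 2 = -1 - ωE := by
  apply Subtype.ext
  simpa [ωE] using ωc_sq

lemma ωE_cube : ωE ^ 3 = 1 := by
  have : ωE ^ 3 = ωE ^ 2 * ωE := by ring
  rw [this, ωE_sq]
  have := ωE_sq
  linear_combination -this

@[simp] lemma coe_ωE : ((ωE : Eis) : ℂ) = ωc := rfl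

/-- The Eisenstein integer `a + bω`. -/
def mk (a b : ℤ) : Eis := a + b * ωE

lemma coe_mk (a b : ℤ) : ((mk a b : Eis) : ℂ) = a + b * ωc := by
  simp [mk]

lemma exists_mk (x : Eis) : ∃ a b : ℤ, x = mk a b := by
  obtain ⟨x, hx⟩ := x
  have : ∃ a b : ℤ, x = a + b * ωc := by
    unfold Eis at hx
    induction hx using Subring.closure_induction with
    | mem x hx => exact ⟨0, 1, by simpa using hx⟩
    | zero => exact ⟨0, 0, by simp⟩
    | one => exact ⟨1, 0, by simp⟩
    | add x y _ _ hx hy =>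
      obtain ⟨a, b, rfl⟩ := hx
      obtain ⟨c, d, rfl⟩ := hy
      exact ⟨a + c, b + d, by push_cast; ring⟩
    | neg x _ hx =>
      obtain ⟨a, b, rfl⟩ := hx
      exact ⟨-a, -b, by push_cast; ring⟩
    | mul x y _ _ hx hy =>
      obtain ⟨a, b, rfl⟩ := hx
      obtain ⟨c, d, rfl⟩ := hy
      refine ⟨a * c - b * d, a * d + b * c - b * d, ?_⟩
      push_cast
      linear_combination (b * d : ℂ) * ωc_sq
  obtain ⟨a, b, h⟩ := this
  exact ⟨a, b, Subtype.ext (by rw [coe_mk]; exact h)⟩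

lemma coe_mk_re (a b : ℤ) : ((mk a b : Eis) : ℂ).re = a - b / 2 := by
  rw [coe_mk, ωc_eq]; simp; ring

lemma coe_mk_im (a b : ℤ) : ((mk a b : Eis) : ℂ).im = b * (Real.sqrt 3 / 2) := by
  rw [coe_mk, ωc_eq]; simp

lemma mk_inj {a b c d : ℤ} : mk a b = mk c d ↔ a = c ∧ b = d := by
  constructor
  · intro h
    have him := congrArg (fun x : Eis => (x : ℂ).im) h
    have hre := congrArg (fun x : Eis => (x : ℂ).re) h
    simp only [coe_mk_im, coe_mk_re] at him hre
    have h3 : (0:ℝ) < Real.sqrt 3 / 2 := by positivity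
    have hb : (b : ℝ) = d := mul_right_cancel₀ h3.ne' him
    have ha : (a : ℝ) = c := by rw [hb] at hre; linarith
    exact ⟨by exact_mod_cast ha, by exact_mod_cast hb⟩
  · rintro ⟨rfl, rfl⟩; rfl

lemma mk_mul (a b c d : ℤ) : mk a b * mk c d = mk (a * c - b * d) (a * d + b * c - b * d) := by
  simp only [mk]; push_cast
  linear_combination (b * d : Eis) * ωE_sq

lemma mk_add (a b c d : ℤ) : mk a b + mk c d = mk (a + c) (b + d) := by
  simp only [mk]; push_cast; ring

lemma mk_sub (a b c d : ℤ) : mk a b - mk c d = mk (a - c) (b - d) := by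
  simp only [mk]; push_cast; ring

lemma mk_neg (a b : ℤ) : - mk a b = mk (-a) (-b) := by
  simp only [mk]; push_cast; ring

lemma one_eq_mk : (1 : Eis) = mk 1 0 := by simp [mk]
lemma zero_eq_mk : (0 : Eis) = mk 0 0 := by simp [mk]
lemma int_eq_mk (n : ℤ) : (n : Eis) = mk n 0 := by simp [mk]
lemma ωE_eq_mk : ωE = mk 0 1 := by simp [mk]
lemma lam_eq_mk : lam = mk 1 2 := by simp [mk, lam]
lemma three_eq_mk : (3 : Eis) = mk 3 0 := by simp [mk]

/-- Equivalence of the Eisenstein integers with pairs of integers. -/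
def eqv : ℤ × ℤ ≃ Eis :=
  Equiv.ofBijective (fun p => mk p.1 p.2) ⟨by
    rintro ⟨a, b⟩ ⟨c, d⟩ h
    simpa using mk_inj.1 h, by
    intro x
    obtain ⟨a, b, rfl⟩ := exists_mk x
    exact ⟨(a, b), rfl⟩⟩

lemma eqv_apply (p : ℤ × ℤ) : eqv p = mk p.1 p.2 := rfl

lemma Nm_mk (a b : ℤ) : Nm (mk a b) = (a:ℝ) ^ 2 - a * b + b ^ 2 := by
  unfold Nm
  rw [Complex.normSq_apply, coe_mk_re, coe_mk_im]
  have h : Real.sqrt 3 * Real.sqrt 3 = 3 := Real.mul_self_sqrt (by norm_num)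
  nlinarith

lemma Nm_nonneg (x : Eis) : 0 ≤ Nm x := Complex.normSq_nonneg _

lemma Nm_eq_sq (x : Eis) : Nm x = ‖(x : ℂ)‖ ^ 2 := Complex.normSq_eq_norm_sq _

@[simp] lemma Nm_zero : Nm 0 = 0 := by simp [Nm]
@[simp] lemma Nm_one : Nm 1 = 1 := by simp [Nm]
@[simp] lemma Nm_mul (x y : Eis) : Nm (x * y) = Nm x * Nm y := by simp [Nm]
@[simp] lemma Nm_neg (x : Eis) : Nm (-x) = Nm x := by simp [Nm]
@[simp] lemma Nm_pow (x : Eis) (k : ℕ) : Nm (x ^ k) = Nm x ^ k := by simp [Nm]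

lemma Nm_eq_zero {x : Eis} : Nm x = 0 ↔ x = 0 := by
  unfold Nm; rw [Complex.normSq_eq_zero]; simp

lemma Nm_int (x : Eis) : ∃ n : ℤ, Nm x = n ∧ 0 ≤ n := by
  obtain ⟨a, b, rfl⟩ := exists_mk x
  have h := Nm_nonneg (mk a b)
  refine ⟨a ^ 2 - a * b + b ^ 2, by rw [Nm_mk]; push_cast; ring, ?_⟩
  rw [Nm_mk] at h
  exact_mod_cast h

lemma NmN_cast (x : Eis) : (NmN x : ℝ) = Nm x := by
  obtain ⟨n, hn, hn0⟩ := Nm_int x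
  lift n to ℕ using hn0
  unfold NmN
  rw [hn]; simp

@[simp] lemma NmN_mul (x y : Eis) : NmN (x * y) = NmN x * NmN y := by
  have : ((NmN (x * y) : ℕ) : ℝ) = (NmN x * NmN y : ℕ) := by
    push_cast; simp only [NmN_cast, Nm_mul]
  exact_mod_cast this

lemma NmN_eq_zero {x : Eis} : NmN x = 0 ↔ x = 0 := by
  rw [← Nm_eq_zero, ← NmN_cast]; simp

lemma one_le_NmN {x : Eis} (hx : x ≠ 0) : 1 ≤ NmN x :=
  Nat.one_le_iff_ne_zero.2 (fun h => hx (NmN_eq_zero.1 h))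

lemma one_le_Nm {x : Eis} (hx : x ≠ 0) : 1 ≤ Nm x := by
  rw [← NmN_cast]; exact_mod_cast one_le_NmN hx

lemma Nm_pos {x : Eis} (hx : x ≠ 0) : 0 < Nm x := lt_of_lt_of_le one_pos (one_le_Nm hx)

/-- Complex conjugation on the Eisenstein integers. -/
def cj : Eis →+* Eis where
  toFun x := ⟨(starRingEnd ℂ) (x : ℂ), by
    obtain ⟨a, b, rfl⟩ := exists_mk x
    have : (starRingEnd ℂ) ((mk a b : Eis) : ℂ) = ((mk (a - b) (-b) : Eis) : ℂ) := by
      rw [coe_mk, coe_mk]; simp [conj_ωc]; ring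
    rw [this]; exact Subtype.property _⟩
  map_one' := by ext; simp
  map_mul' x y := by ext; simp
  map_zero' := by ext; simp
  map_add' x y := by ext; simp

@[simp] lemma coe_cj (x : Eis) : ((cj x : Eis) : ℂ) = (starRingEnd ℂ) (x : ℂ) := rfl
@[simp] lemma cj_cj (x : Eis) : cj (cj x) = x := by ext; simp
@[simp] lemma Nm_cj (x : Eis) : Nm (cj x) = Nm x := by simp [Nm]
lemma cj_mk (a b : ℤ) : cj (mk a b) = mk (a - b) (-b) := by
  apply Subtype.ext
  rw [coe_cj, coe_mk, coe_mk]; simp [conj_ωc]; ring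
lemma mul_cj (x : Eis) : x * cj x = (NmN x : Eis) := by
  apply Subtype.ext
  have h := NmN_cast x
  simp only [Subring.coe_mul, coe_cj, Complex.mul_conj]
  change ((Nm x : ℝ) : ℂ) = _
  rw [← h]; simp

lemma exists_div (x y : Eis) (hy : y ≠ 0) : ∃ q : Eis, Nm (x - y * q) < Nm y := by
  have hy' : ((y : Eis) : ℂ) ≠ 0 := by simpa using hy
  set z : ℂ := (x : ℂ) / y with hz
  set t : ℝ := z.im / (Real.sqrt 3 / 2) with ht
  set s : ℝ := z.re + t / 2 with hs
  refine ⟨mk (round s) (round t), ?_⟩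
  have h3 : (0:ℝ) < Real.sqrt 3 / 2 := by positivity
  have him : z.im = t * (Real.sqrt 3 / 2) := by rw [ht]; field_simp
  have hre : z.re = s - t / 2 := by rw [hs]; ring
  have e : ((x - y * mk (round s) (round t) : Eis) : ℂ) = y * (z - (mk (round s) (round t) : Eis)) := by
    rw [hz, mul_sub, mul_div_cancel₀ _ hy']; simp
  unfold Nm
  rw [e, Complex.normSq_mul]
  have hpos : 0 < Complex.normSq (y : ℂ) := Complex.normSq_pos.2 hy'
  have hlt : Complex.normSq (z - (mk (round s) (round t) : Eis)) < 1 := by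
    rw [Complex.normSq_apply, Complex.sub_re, Complex.sub_im, coe_mk_re, coe_mk_im, him, hre]
    have h1 := abs_le.1 (abs_sub_round s)
    have h2 := abs_le.1 (abs_sub_round t)
    have h : Real.sqrt 3 * Real.sqrt 3 = 3 := Real.mul_self_sqrt (by norm_num)
    set p := s - round s
    set r := t - round t
    have : (s - t / 2 - (round s - round t / 2)) * (s - t / 2 - (round s - round t / 2)) +
      (t * (Real.sqrt 3 / 2) - round t * (Real.sqrt 3 / 2)) * (t * (Real.sqrt 3 / 2) - round t * (Real.sqrt 3 / 2))
      = p ^ 2 - p * r + r ^ 2 := by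
      linear_combination ((t - round t) ^ 2 / 4) * h
    rw [this]
    nlinarith [h1.1, h1.2, h2.1, h2.2, sq_nonneg (p - r), sq_nonneg (p + r)]
  nlinarith

/-- The Euclidean structure. -/
@[reducible] def euclid : EuclideanDomain Eis :=
  { (inferInstance : CommRing Eis), (inferInstance : Nontrivial Eis) with
    quotient := fun x y => if h : y = 0 then 0 else (exists_div x y h).choose
    quotient_zero := fun x => by simp
    remainder := fun x y => x - y * (if h : y = 0 then 0 else (exists_div x y h).choose)
    quotient_mul_add_remainder_eq := fun x y => by ring
    r := fun x y => NmN x < NmN y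
    r_wellFounded := (measure NmN).wf
    remainder_lt := fun x y hy => by
      rw [dif_neg hy]
      have : ((NmN (x - y * (exists_div x y hy).choose) : ℕ) : ℝ) < (NmN y : ℕ) := by
        rw [NmN_cast, NmN_cast]; exact (exists_div x y hy).choose_spec
      exact_mod_cast this
    mul_left_not_lt := fun x y hy => by
      simp only [NmN_mul, not_lt]
      exact Nat.le_mul_of_pos_right _ (one_le_NmN hy) }

instance : IsPrincipalIdealRing Eis := @EuclideanDomain.to_principal_ideal_domain Eis euclid


lemma isUnit_iff_Nm {x : Eis} : IsUnit x ↔ Nm x = 1 := by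
  constructor
  · rintro ⟨u, rfl⟩
    have h : Nm (u : Eis) * Nm ((u⁻¹ : Eisˣ) : Eis) = 1 := by
      rw [← Nm_mul]; simp
    have h1 := one_le_Nm u.ne_zero
    have h2 := one_le_Nm (u⁻¹).ne_zero
    nlinarith
  · intro h
    refine IsUnit.of_mul_eq_one (cj x) ?_
    rw [mul_cj]
    have : (NmN x : ℝ) = 1 := by rw [NmN_cast, h]
    have : NmN x = 1 := by exact_mod_cast this
    simp [this]

lemma isUnit_cases {x : Eis} (hx : IsUnit x) :
    x = 1 ∨ x = -1 ∨ x = ωE ∨ x = -ωE ∨ x = ωE ^ 2 ∨ x = - ωE ^ 2 := by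
  rw [isUnit_iff_Nm] at hx
  obtain ⟨a, b, rfl⟩ := exists_mk x
  rw [Nm_mk] at hx
  have h : a ^ 2 - a * b + b ^ 2 = 1 := by exact_mod_cast hx
  have ha : -1 ≤ a ∧ a ≤ 1 := by constructor <;> nlinarith [sq_nonneg (2 * b - a)]
  have hb : -1 ≤ b ∧ b ≤ 1 := by constructor <;> nlinarith [sq_nonneg (2 * a - b)]
  have e : ωE ^ 2 = mk (-1) (-1) := by rw [ωE_sq]; simp [mk]; ring
  rw [e, one_eq_mk, ωE_eq_mk]
  simp only [mk_neg, mk_inj]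
  obtain ⟨ha1, ha2⟩ := ha
  obtain ⟨hb1, hb2⟩ := hb
  interval_cases a <;> interval_cases b <;> simp_all

lemma finite_ball (Y : ℝ) : {x : Eis | Nm x ≤ Y}.Finite := by
  set n : ℕ := ⌈2 * Y + 2⌉₊ with hn
  have hn' : 2 * Y + 2 ≤ n := Nat.le_ceil _
  apply Set.Finite.subset (Set.Finite.image (fun p : ℤ × ℤ => mk p.1 p.2)
    (Set.toFinite ((Finset.Icc (-n:ℤ) n ×ˢ Finset.Icc (-n:ℤ) n : Finset (ℤ × ℤ)) : Set (ℤ × ℤ))))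
  intro x hx
  obtain ⟨a, b, rfl⟩ := exists_mk x
  simp only [Set.mem_ofPred_eq, Nm_mk] at hx
  refine ⟨(a, b), ?_, rfl⟩
  have ha1 : (-n:ℝ) ≤ a := by nlinarith [sq_nonneg (2 * (b:ℝ) - a), sq_nonneg ((a:ℝ) + 1)]
  have ha2 : (a:ℝ) ≤ n := by nlinarith [sq_nonneg (2 * (b:ℝ) - a), sq_nonneg ((a:ℝ) - 1)]
  have hb1 : (-n:ℝ) ≤ b := by nlinarith [sq_nonneg (2 * (a:ℝ) - b), sq_nonneg ((b:ℝ) + 1)]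
  have hb2 : (b:ℝ) ≤ n := by nlinarith [sq_nonneg (2 * (a:ℝ) - b), sq_nonneg ((b:ℝ) - 1)]
  simp only [Finset.coe_product, Finset.coe_Icc, Set.mem_prod, Set.mem_Icc]
  exact ⟨⟨by exact_mod_cast ha1, by exact_mod_cast ha2⟩, ⟨by exact_mod_cast hb1, by exact_mod_cast hb2⟩⟩

lemma summable_Nm {s : ℝ} (hs : 1 < s) : Summable (fun x : Eis => Nm x ^ (-s)) := by
  have h := EisensteinSeries.summable_one_div_norm_rpow (k := 2 * s) (by linarith)
  have h2 : Summable (fun p : ℤ × ℤ => ‖![p.1, p.2]‖ ^ (-(2 * s))) :=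
    ((finTwoArrowEquiv ℤ).symm.summable_iff (f := fun x : Fin 2 → ℤ => ‖x‖ ^ (-(2*s)))).2 h
  rw [← eqv.summable_iff]
  refine Summable.of_nonneg_of_le (fun p => Real.rpow_nonneg (Nm_nonneg _) _) (fun p => ?_)
    (h2.mul_left ((3/4 : ℝ) ^ (-s)))
  obtain ⟨a, b⟩ := p
  simp only [Function.comp, eqv_apply]
  set r : ℝ := ‖![a, b]‖ with hr
  have hr0 : 0 ≤ r := norm_nonneg _
  by_cases h0 : mk a b = 0
  · rw [h0, Nm_zero, Real.zero_rpow (by linarith)]; positivity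
  have hrr : r = max |(a:ℝ)| |(b:ℝ)| := by
    rw [hr]
    simp [Pi.norm_def, Fin.univ_succ, Int.norm_eq_abs]
  have key : 3/4 * r ^ 2 ≤ Nm (mk a b) := by
    rw [Nm_mk, hrr]
    rcases max_choice |(a:ℝ)| |(b:ℝ)| with h | h <;> rw [h, sq_abs] <;>
      nlinarith [sq_nonneg (2 * (b:ℝ) - a), sq_nonneg (2 * (a:ℝ) - b)]
  have hrpos : 0 < r := by
    rcases hr0.lt_or_eq with h | h
    · exact h
    · exfalso
      apply h0
      rw [hrr] at h
      have ha : |(a:ℝ)| ≤ 0 := h ▸ le_max_left _ _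
      have hb : |(b:ℝ)| ≤ 0 := h ▸ le_max_right _ _
      have ha : a = 0 := by simpa using ha
      have hb : b = 0 := by simpa using hb
      rw [ha, hb, zero_eq_mk]
  have e : r ^ (-(2 * s)) = (r ^ 2) ^ (-s) := by
    rw [← Real.rpow_natCast, ← Real.rpow_mul hr0]; congr 1; push_cast; ring
  rw [e, ← Real.mul_rpow (by norm_num) (by positivity)]
  exact Real.rpow_le_rpow_of_nonpos (by positivity) key (by linarith)

/-! ### Part 2: primary elements -/

/-- Primary elements: `x ≡ 1 (mod 3)`. -/
def Pr (x : Eis) : Prop := (3 : Eis) ∣ (x - 1)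

lemma three_dvd_mk {a b : ℤ} : (3 : Eis) ∣ mk a b ↔ (3 ∣ a ∧ 3 ∣ b) := by
  constructor
  · rintro ⟨y, hy⟩
    obtain ⟨c, d, rfl⟩ := exists_mk y
    rw [three_eq_mk, mk_mul, mk_inj] at hy
    exact ⟨⟨c, by rw [hy.1]; ring⟩, ⟨d, by rw [hy.2]; ring⟩⟩
  · rintro ⟨⟨c, rfl⟩, ⟨d, rfl⟩⟩
    exact ⟨mk c d, by rw [three_eq_mk, mk_mul, mk_inj]; constructor <;> ring⟩

lemma Pr_mk {a b : ℤ} : Pr (mk a b) ↔ (a % 3 = 1 ∧ b % 3 = 0) := by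
  unfold Pr
  rw [one_eq_mk, mk_sub, three_dvd_mk]; omega

lemma Pr_one : Pr 1 := by simp [Pr]

lemma Pr.mul {x y : Eis} (hx : Pr x) (hy : Pr y) : Pr (x * y) := by
  unfold Pr at *
  have : x * y - 1 = (x - 1) * y + (y - 1) := by ring
  rw [this]; exact dvd_add (hx.mul_right _) hy

lemma Pr.pow {x : Eis} (hx : Pr x) (k : ℕ) : Pr (x ^ k) := by
  induction k with
  | zero => simpa using Pr_one
  | succ k ih => rw [pow_succ]; exact ih.mul hx

lemma Pr.of_mul {x y : Eis} (hxy : Pr (x * y)) (hy : Pr y) : Pr x := by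
  unfold Pr at *
  have : x - 1 = (x * y - 1) - x * (y - 1) := by ring
  rw [this]; exact dvd_sub hxy (hy.mul_left _)

lemma Pr.ne_zero {x : Eis} (hx : Pr x) : x ≠ 0 := by
  rintro rfl
  rw [zero_eq_mk, Pr_mk] at hx; omega

lemma Pr.cj {x : Eis} (hx : Pr x) : Pr (cj x) := by
  obtain ⟨a, b, rfl⟩ := exists_mk x
  rw [cj_mk, Pr_mk]; rw [Pr_mk] at hx; omega

lemma Nm_lam : Nm lam = 3 := by rw [lam_eq_mk, Nm_mk]; norm_num

lemma lam_sq : lam ^ 2 = -3 := by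
  unfold lam
  linear_combination (4:Eis) * ωE_sq

lemma lam_ne_zero : lam ≠ 0 := by
  intro h; have := Nm_lam; rw [h] at this; simp at this

lemma lam_dvd_mk {a b : ℤ} : lam ∣ mk a b ↔ (3:ℤ) ∣ a + b := by
  constructor
  · rintro ⟨y, hy⟩
    obtain ⟨c, d, rfl⟩ := exists_mk y
    rw [lam_eq_mk, mk_mul, mk_inj] at hy
    omega
  · rintro ⟨c, hc⟩
    -- a + bω = lam * (x + yω) = (x - 2y) + (y+2x-2y)ω
    refine ⟨mk (-a + 2 * c) (-a + c), ?_⟩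
    rw [lam_eq_mk, mk_mul, mk_inj]
    constructor <;> linarith

lemma lam_dvd_three : lam ∣ 3 := by
  rw [three_eq_mk, lam_dvd_mk]; norm_num

lemma lam_prime : Prime lam := by
  refine ⟨lam_ne_zero, ?_, ?_⟩
  · rw [isUnit_iff_Nm, Nm_lam]; norm_num
  · intro x y h
    obtain ⟨a, b, rfl⟩ := exists_mk x
    obtain ⟨c, d, rfl⟩ := exists_mk y
    rw [mk_mul, lam_dvd_mk] at h
    rw [lam_dvd_mk, lam_dvd_mk]
    have h2 : (3:ℤ) ∣ (a + b) * (c + d) := by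
      have : (a + b) * (c + d) = (a * c - b * d + (a * d + b * c - b * d)) + 3 * (b * d) := by ring
      rw [this]; exact dvd_add h (dvd_mul_right _ _)
    exact Int.prime_three.dvd_or_dvd h2

lemma Pr.not_lam_dvd {x : Eis} (hx : Pr x) : ¬ lam ∣ x := by
  obtain ⟨a, b, rfl⟩ := exists_mk x
  rw [Pr_mk] at hx
  rw [lam_dvd_mk]; omega

lemma exists_unit_Pr {x : Eis} (hx : ¬ lam ∣ x) : ∃ u : Eisˣ, Pr (u * x) := by
  obtain ⟨a, b, rfl⟩ := exists_mk x
  rw [lam_dvd_mk] at hx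
  have hω : IsUnit ωE := IsUnit.of_mul_eq_one (ωE ^ 2) (by rw [← ωE_cube]; ring)
  obtain ⟨w, hw⟩ := hω
  have e1 : ωE * mk a b = mk (-b) (a - b) := by rw [ωE_eq_mk, mk_mul, mk_inj]; constructor <;> ring
  have e2 : ωE ^ 2 * mk a b = mk (b - a) (-a) := by
    rw [pow_two, mul_assoc, e1, ωE_eq_mk, mk_mul, mk_inj]; constructor <;> ring
  have h1 : Pr ((1 : Eisˣ) * mk a b) ↔ (a % 3 = 1 ∧ b % 3 = 0) := by
    simp [Pr_mk]
  have h2 : Pr ((-1 : Eisˣ) * mk a b) ↔ ((-a) % 3 = 1 ∧ (-b) % 3 = 0) := by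
    simp [mk_neg, Pr_mk]
  have h3 : Pr ((w : Eisˣ) * mk a b) ↔ ((-b) % 3 = 1 ∧ (a - b) % 3 = 0) := by
    rw [hw, e1, Pr_mk]
  have h4 : Pr ((-w : Eisˣ) * mk a b) ↔ ((b) % 3 = 1 ∧ (b - a) % 3 = 0) := by
    simp only [Units.val_neg, neg_mul]; rw [hw, e1, mk_neg, Pr_mk]; simp
  have h5 : Pr ((w^2 : Eisˣ) * mk a b) ↔ ((b - a) % 3 = 1 ∧ (-a) % 3 = 0) := by
    simp only [Units.val_pow_eq_pow_val]; rw [hw, e2, Pr_mk]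
  have h6 : Pr ((-w^2 : Eisˣ) * mk a b) ↔ ((a - b) % 3 = 1 ∧ (a) % 3 = 0) := by
    simp only [Units.val_neg, Units.val_pow_eq_pow_val, neg_mul]; rw [hw, e2, mk_neg, Pr_mk]; simp
  by_contra hcon
  push Not at hcon
  have g1 : ¬ (a % 3 = 1 ∧ b % 3 = 0) := fun h => hcon _ (h1.2 h)
  have g2 : ¬ ((-a) % 3 = 1 ∧ (-b) % 3 = 0) := fun h => hcon _ (h2.2 h)
  have g3 : ¬ ((-b) % 3 = 1 ∧ (a - b) % 3 = 0) := fun h => hcon _ (h3.2 h)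
  have g4 : ¬ ((b) % 3 = 1 ∧ (b - a) % 3 = 0) := fun h => hcon _ (h4.2 h)
  have g5 : ¬ ((b - a) % 3 = 1 ∧ (-a) % 3 = 0) := fun h => hcon _ (h5.2 h)
  have g6 : ¬ ((a - b) % 3 = 1 ∧ (a) % 3 = 0) := fun h => hcon _ (h6.2 h)
  have ha : a % 3 = 0 ∨ a % 3 = 1 ∨ a % 3 = 2 := by omega
  have hb : b % 3 = 0 ∨ b % 3 = 1 ∨ b % 3 = 2 := by omega
  clear h1 h2 h3 h4 h5 h6 e1 e2 hcon
  rcases ha with ha | ha | ha <;> rcases hb with hb | hb | hb <;> omega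

lemma Pr.unit_eq_one {x : Eis} (hx : Pr x) (hu : IsUnit x) : x = 1 := by
  have e : ωE ^ 2 = mk (-1) (-1) := by rw [ωE_sq]; simp [mk]; ring
  rcases isUnit_cases hu with rfl | rfl | rfl | rfl | rfl | rfl
  · rfl
  all_goals
    exfalso
    first
      | rw [e, mk_neg, Pr_mk] at hx
      | rw [e, Pr_mk] at hx
      | rw [ωE_eq_mk, mk_neg, Pr_mk] at hx
      | rw [ωE_eq_mk, Pr_mk] at hx
      | rw [one_eq_mk, mk_neg, Pr_mk] at hx
    omega

lemma Pr.eq_of_assoc {x y : Eis} (hx : Pr x) (hy : Pr y) (h : Associated x y) : x = y := by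
  obtain ⟨u, rfl⟩ := h
  have : Pr (u : Eis) := by rw [mul_comm] at hy; exact hy.of_mul hx
  rw [this.unit_eq_one u.isUnit, mul_one]

/-- Every divisor of a primary element has a primary associate (dividing). -/
lemma exists_Pr_assoc {x : Eis} (hx : ¬ lam ∣ x) : ∃ y, Pr y ∧ Associated x y := by
  obtain ⟨u, hu⟩ := exists_unit_Pr hx
  exact ⟨u * x, hu, ⟨u, by ring⟩⟩

/-- Cofactor is primary. -/
lemma Pr.cofactor {x y : Eis} (hx : Pr x) (hxy : Pr (x * y)) : Pr y := by
  rw [mul_comm] at hxy; exact hxy.of_mul hx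

/-- Induction for primary elements. -/
lemma Pr.induction {P : (x : Eis) → Pr x → Prop} (h1 : P 1 Pr_one)
    (hmul : ∀ p x, Prime p → (hp : Pr p) → (hx : Pr x) → P x hx → P (p * x) (hp.mul hx))
    {x : Eis} (hx : Pr x) : P x hx := by
  have key : ∀ n : ℕ, ∀ x : Eis, NmN x ≤ n → (hx : Pr x) → P x hx := by
    intro n
    induction n with
    | zero =>
      intro x hn hx
      exact absurd (NmN_eq_zero.1 (Nat.le_zero.1 hn)) hx.ne_zero
    | succ n ih =>
      intro x hn hx
      by_cases hu : IsUnit x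
      · obtain rfl := hx.unit_eq_one hu
        exact h1
      · obtain ⟨p, hp, hpx⟩ := WfDvdMonoid.exists_irreducible_factor hu hx.ne_zero
        have hp := hp.prime
        have hl : ¬ lam ∣ p := fun h => hx.not_lam_dvd (h.trans hpx)
        obtain ⟨q, hq, hpq⟩ := exists_Pr_assoc hl
        have hq' : Prime q := hpq.prime hp
        obtain ⟨y, rfl⟩ := (hpq.symm.dvd.trans hpx : q ∣ x)
        have hy : Pr y := hq.cofactor hx
        refine hmul q y hq' hq hy (ih y ?_ hy)
        rw [NmN_mul] at hn
        have h2 : 2 ≤ NmN q := by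
          by_contra hcon
          have h1 := one_le_NmN hq'.ne_zero
          have : NmN q = 1 := by omega
          apply hq'.not_isUnit
          rw [isUnit_iff_Nm, ← NmN_cast, this]; simp
        have h3 := one_le_NmN hy.ne_zero
        nlinarith
  exact key _ x le_rfl hx

/-- Greatest common divisor with primary normalisation. -/
lemma exists_Pr_gcd {x y : Eis} (hx : Pr x) (hy : Pr y) :
    ∃ g a b, Pr g ∧ Pr a ∧ Pr b ∧ x = g * a ∧ y = g * b ∧ IsCoprime a b := by
  obtain ⟨g, hg⟩ := IsPrincipalIdealRing.principal (Ideal.span {x, y})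
  have hg' : Ideal.span {x, y} = Ideal.span {g} := hg
  have hgx : g ∣ x := by
    rw [← Ideal.mem_span_singleton, ← hg']; exact Ideal.subset_span (by simp)
  have hgy : g ∣ y := by
    rw [← Ideal.mem_span_singleton, ← hg']; exact Ideal.subset_span (by simp)
  obtain ⟨g', hp, hass⟩ := exists_Pr_assoc (fun h => hx.not_lam_dvd (h.trans hgx) : ¬ lam ∣ g)
  have hg'' : Ideal.span {x, y} = Ideal.span {g'} := by
    rw [hg']; exact Ideal.span_singleton_eq_span_singleton.2 hass
  obtain ⟨a, ha⟩ := (hass.symm.dvd.trans hgx)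
  obtain ⟨b, hb⟩ := (hass.symm.dvd.trans hgy)
  refine ⟨g', a, b, hp, hp.cofactor (ha ▸ hx), hp.cofactor (hb ▸ hy), ha, hb, ?_⟩
  have : g' ∈ Ideal.span {x, y} := by rw [hg'']; exact Ideal.mem_span_singleton_self _
  obtain ⟨u, v, huv⟩ := Ideal.mem_span_pair.1 this
  refine ⟨u, v, ?_⟩
  have : g' * (u * a + v * b) = g' * 1 := by
    rw [mul_one]; conv_rhs => rw [← huv, ha, hb]
    ring
  exact mul_left_cancel₀ hp.ne_zero this

lemma prime_coprime {p x : Eis} (hp : Prime p) (h : ¬ p ∣ x) : IsCoprime p x :=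
  (hp.irreducible.coprime_iff_not_dvd).2 h

lemma Nm_prime_dvd {p x : Eis} (h : p ∣ x) (hx : x ≠ 0) : Nm p ≤ Nm x := by
  obtain ⟨y, rfl⟩ := h
  rw [Nm_mul]
  exact le_mul_of_one_le_right (Nm_nonneg _) (one_le_Nm (right_ne_zero_of_mul hx))

/-! ### Part 3: basic properties of the cubic symbol -/

/-- Values of cubic characters. -/
def IsVal (z : Eis) : Prop := z = 0 ∨ z = 1 ∨ z = ωE ∨ z = ωE ^ 2

lemma IsVal.mul {x y : Eis} (hx : IsVal x) (hy : IsVal y) : IsVal (x * y) := by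
  have h4 : ωE * ωE ^ 2 = 1 := by rw [← ωE_cube]; ring
  have h5 : ωE ^ 2 * ωE = 1 := by rw [← ωE_cube]; ring
  have h6 : ωE ^ 2 * ωE ^ 2 = ωE := by
    have : ωE ^ 2 * ωE ^ 2 = ωE ^ 3 * ωE := by ring
    rw [this, ωE_cube, one_mul]
  have h7 : ωE * ωE = ωE ^ 2 := by ring
  rcases hx with rfl | rfl | rfl | rfl <;> rcases hy with rfl | rfl | rfl | rfl <;>
    simp [IsVal, h4, h5, h6, h7]

lemma IsVal.cube {x : Eis} (hx : IsVal x) (h0 : x ≠ 0) : x ^ 3 = 1 := by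
  rcases hx with rfl | rfl | rfl | rfl
  · exact absurd rfl h0
  · simp
  · exact ωE_cube
  · rw [← pow_mul, mul_comm, pow_mul, ωE_cube, one_pow]

lemma norm_ωc : ‖ωc‖ = 1 := by
  have h : ωc ^ 3 = 1 := by
    have := congrArg (fun x : Eis => (x : ℂ)) ωE_cube
    simpa using this
  exact norm_eq_one_of_pow_eq_one h (by norm_num)

lemma IsVal.norm_le {x : Eis} (hx : IsVal x) : ‖(x : ℂ)‖ ≤ 1 := by
  rcases hx with rfl | rfl | rfl | rfl <;> simp [norm_ωc]

lemma IsVal.norm_eq {x : Eis} (hx : IsVal x) (h0 : x ≠ 0) : ‖(x : ℂ)‖ = 1 := by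
  rcases hx with rfl | rfl | rfl | rfl
  · exact absurd rfl h0
  all_goals simp [norm_ωc]

lemma IsVal.cj_eq_sq {x : Eis} (hx : IsVal x) : cj x = x ^ 2 := by
  have hω : cj ωE = ωE ^ 2 := by
    rw [ωE_sq]; apply Subtype.ext; simp [conj_ωc]
  rcases hx with rfl | rfl | rfl | rfl <;> simp [hω]

lemma IsVal.cj {x : Eis} (hx : IsVal x) : IsVal (cj x) := by
  rw [hx.cj_eq_sq, pow_two]; exact hx.mul hx

lemma IsVal.sub_dvd {x y : Eis} (hx : IsVal x) (hy : IsVal y) (hne : x ≠ y) : (x - y) ∣ lam := by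
  have e : ωE ^ 2 = mk (-1) (-1) := by rw [ωE_sq]; simp [mk]; ring
  rw [IsVal, e, zero_eq_mk, one_eq_mk, ωE_eq_mk] at hx hy
  rw [lam_eq_mk]
  rcases hx with rfl | rfl | rfl | rfl <;> rcases hy with rfl | rfl | rfl | rfl <;>
    first
    | exact absurd rfl hne
    | (rw [mk_sub]; refine ⟨mk 1 2, ?_⟩; rw [mk_mul, mk_inj]; norm_num; done)
    | (rw [mk_sub]; refine ⟨mk (-1) (-2), ?_⟩; rw [mk_mul, mk_inj]; norm_num; done)
    | (rw [mk_sub]; refine ⟨mk 2 1, ?_⟩; rw [mk_mul, mk_inj]; norm_num; done)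
    | (rw [mk_sub]; refine ⟨mk (-2) (-1), ?_⟩; rw [mk_mul, mk_inj]; norm_num; done)
    | (rw [mk_sub]; refine ⟨mk 1 (-1), ?_⟩; rw [mk_mul, mk_inj]; norm_num; done)
    | (rw [mk_sub]; refine ⟨mk (-1) 1, ?_⟩; rw [mk_mul, mk_inj]; norm_num; done)
    | (rw [mk_sub]; refine ⟨mk 1 0, ?_⟩; rw [mk_mul, mk_inj]; norm_num; done)
    | (rw [mk_sub]; refine ⟨mk (-1) 0, ?_⟩; rw [mk_mul, mk_inj]; norm_num; done)
    | (rw [mk_sub]; refine ⟨mk 0 1, ?_⟩; rw [mk_mul, mk_inj]; norm_num; done)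
    | (rw [mk_sub]; refine ⟨mk 0 (-1), ?_⟩; rw [mk_mul, mk_inj]; norm_num; done)
    | (rw [mk_sub]; refine ⟨mk 1 1, ?_⟩; rw [mk_mul, mk_inj]; norm_num; done)
    | (rw [mk_sub]; refine ⟨mk (-1) (-1), ?_⟩; rw [mk_mul, mk_inj]; norm_num; done)

lemma IsVal.eq_of_dvd {x y p : Eis} (hx : IsVal x) (hy : IsVal y) (hp : Prime p) (hpr : Pr p)
    (h : p ∣ x - y) : x = y := by
  by_contra hne
  have h1 : p ∣ lam := h.trans (hx.sub_dvd hy hne)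
  have h2 : Associated p lam := (hp.irreducible.associated_of_dvd lam_prime.irreducible h1)
  exact hpr.not_lam_dvd h2.symm.dvd


lemma IsCubicSymbol.isVal {χ : Eis → Eis → Eis} (hχ : IsCubicSymbol χ) {b : Eis} (hb : Pr b)
    (a : Eis) : IsVal (χ b a) := by
  induction hb using Pr.induction with
  | h1 => rw [hχ.one_bot]; simp [IsVal]
  | hmul p x hp hpr hx ih =>
    rw [hχ.mul_bot _ _ _ hpr hx]
    exact IsVal.mul (hχ.prime_vals p a hp hpr) ih

lemma IsCubicSymbol.mul_top {χ : Eis → Eis → Eis} (hχ : IsCubicSymbol χ) {b : Eis} (hb : Pr b)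
    (a a' : Eis) : χ b (a * a') = χ b a * χ b a' := by
  induction hb using Pr.induction with
  | h1 => simp [hχ.one_bot]
  | hmul p x hp hpr hx ih =>
    rw [hχ.mul_bot _ _ _ hpr hx, hχ.mul_bot _ _ _ hpr hx, hχ.mul_bot _ _ _ hpr hx, ih]
    have : χ p (a * a') = χ p a * χ p a' := by
      apply IsVal.eq_of_dvd (hχ.prime_vals p _ hp hpr)
        (IsVal.mul (hχ.prime_vals p a hp hpr) (hχ.prime_vals p a' hp hpr)) hp hpr
      have h1 := hχ.prime_congr p (a * a') hp hpr
      have h2 := hχ.prime_congr p a hp hpr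
      have h3 := hχ.prime_congr p a' hp hpr
      set k := (NmN p - 1) / 3
      have : χ p (a * a') - χ p a * χ p a' = -((a * a') ^ k - χ p (a * a'))
        + (a ^ k - χ p a) * a' ^ k + χ p a * (a' ^ k - χ p a') := by ring
      rw [this]
      exact dvd_add (dvd_add (dvd_neg.2 h1) (h2.mul_right _)) (h3.mul_left _)
    rw [this]; ring

lemma IsCubicSymbol.congr_top {χ : Eis → Eis → Eis} (hχ : IsCubicSymbol χ) {b : Eis} (hb : Pr b)
    {a a' : Eis} (h : b ∣ a - a') : χ b a = χ b a' := by
  induction hb using Pr.induction with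
  | h1 => simp [hχ.one_bot]
  | hmul p x hp hpr hx ih =>
    rw [hχ.mul_bot _ _ _ hpr hx, hχ.mul_bot _ _ _ hpr hx, ih ((dvd_mul_left _ _).trans h)]
    congr 1
    apply IsVal.eq_of_dvd (hχ.prime_vals p _ hp hpr) (hχ.prime_vals p a' hp hpr) hp hpr
    have h1 := hχ.prime_congr p a hp hpr
    have h2 := hχ.prime_congr p a' hp hpr
    set k := (NmN p - 1) / 3
    have h3 : a - a' ∣ a ^ k - a' ^ k := sub_dvd_pow_sub_pow _ _ _
    have : χ p a - χ p a' = -(a ^ k - χ p a) + (a' ^ k - χ p a') + (a ^ k - a' ^ k) := by ring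
    rw [this]
    exact dvd_add (dvd_add (dvd_neg.2 h1) h2) (((dvd_mul_right _ _).trans h).trans h3)

lemma IsCubicSymbol.ne_zero_iff {χ : Eis → Eis → Eis} (hχ : IsCubicSymbol χ) {b : Eis} (hb : Pr b)
    (a : Eis) : χ b a ≠ 0 ↔ IsCoprime b a := by
  induction hb using Pr.induction with
  | h1 => simp [hχ.one_bot, isCoprime_one_left]
  | hmul p x hp hpr hx ih =>
    rw [hχ.mul_bot _ _ _ hpr hx, mul_ne_zero_iff, ih, IsCoprime.mul_left_iff,
      Ne, hχ.prime_eq_zero p a hp hpr, hp.irreducible.coprime_iff_not_dvd]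

lemma IsCubicSymbol.top_one {χ : Eis → Eis → Eis} (hχ : IsCubicSymbol χ) {b : Eis} (hb : Pr b) :
    χ b 1 = 1 := by
  have h := hχ.mul_top hb 1 1
  have h0 : χ b 1 ≠ 0 := (hχ.ne_zero_iff hb 1).2 isCoprime_one_right
  rw [one_mul] at h
  exact (mul_left_cancel₀ h0 (by rw [← h, mul_one])).symm

lemma IsCubicSymbol.top_pow {χ : Eis → Eis → Eis} (hχ : IsCubicSymbol χ) {b : Eis} (hb : Pr b)
    (a : Eis) (k : ℕ) : χ b (a ^ k) = χ b a ^ k := by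
  induction k with
  | zero => simp [hχ.top_one hb]
  | succ k ih => rw [pow_succ, hχ.mul_top hb, ih, pow_succ]

lemma IsCubicSymbol.top_neg_one {χ : Eis → Eis → Eis} (hχ : IsCubicSymbol χ) {b : Eis}
    (hb : Pr b) : χ b (-1) = 1 := by
  have h : χ b (-1) = χ b ((-1) ^ 3) := by norm_num
  rw [h, hχ.top_pow hb]
  exact (hχ.isVal hb _).cube ((hχ.ne_zero_iff hb _).2 (isCoprime_one_right.neg_right))

lemma IsCubicSymbol.cube_eq {χ : Eis → Eis → Eis} (hχ : IsCubicSymbol χ) {b : Eis} (hb : Pr b)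
    {a : Eis} (h : IsCoprime b a) : χ b a ^ 3 = 1 :=
  (hχ.isVal hb _).cube ((hχ.ne_zero_iff hb _).2 h)

lemma cj_dvd {x y : Eis} (h : x ∣ y) : cj x ∣ cj y := map_dvd cj h

lemma cj_prime {p : Eis} (hp : Prime p) : Prime (cj p) := by
  refine ⟨?_, ?_, ?_⟩
  · intro h; apply hp.ne_zero; rw [← cj_cj p, h, map_zero]
  · intro h; apply hp.not_isUnit; rw [← cj_cj p]; exact h.map cj
  · intro a b h
    have := cj_dvd h
    rw [cj_cj, map_mul] at this
    rcases hp.dvd_or_dvd this with h | h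
    · left; have := cj_dvd h; rwa [cj_cj] at this
    · right; have := cj_dvd h; rwa [cj_cj] at this

lemma IsCubicSymbol.cj {χ : Eis → Eis → Eis} (hχ : IsCubicSymbol χ) {b : Eis} (hb : Pr b)
    (a : Eis) : CubicPaper.cj (χ b a) = χ (CubicPaper.cj b) (CubicPaper.cj a) := by
  induction hb using Pr.induction with
  | h1 => simp [hχ.one_bot]
  | hmul p x hp hpr hx ih =>
    rw [hχ.mul_bot _ _ _ hpr hx, map_mul, map_mul, hχ.mul_bot _ _ _ hpr.cj hx.cj, ih]
    congr 1
    apply IsVal.eq_of_dvd (IsVal.cj (hχ.prime_vals p _ hp hpr))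
      (hχ.prime_vals _ _ (cj_prime hp) hpr.cj) (cj_prime hp) hpr.cj
    have h1 := cj_dvd (hχ.prime_congr p a hp hpr)
    have h2 := hχ.prime_congr _ (CubicPaper.cj a) (cj_prime hp) hpr.cj
    have e : NmN (CubicPaper.cj p) = NmN p := by unfold NmN; rw [Nm_cj]
    rw [e] at h2
    rw [map_sub, map_pow] at h1
    have := dvd_sub h2 h1
    rwa [sub_sub_sub_cancel_left] at this

/-! ### Part 4: quotient rings, characters on them -/

/-- linear version of `eqv`. -/
def eqvL : Eis ≃ₗ[ℤ] (Fin 2 → ℤ) :=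
  LinearEquiv.symm <| LinearEquiv.ofBijective
    ({ toFun := fun v => mk (v 0) (v 1)
       map_add' := fun v w => by simp [mk_add]
       map_smul' := fun c v => by
        simp only [mk, Pi.smul_apply, smul_eq_mul, zsmul_eq_mul, RingHom.id_apply]; push_cast; ring }
      : (Fin 2 → ℤ) →ₗ[ℤ] Eis)
    ⟨by
      intro v w h
      have h' : mk (v 0) (v 1) = mk (w 0) (w 1) := h
      rw [mk_inj] at h'
      funext i; fin_cases i
      · exact h'.1
      · exact h'.2, by
      intro x
      obtain ⟨a, b, rfl⟩ := exists_mk x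
      exact ⟨![a, b], by simp⟩⟩

/-- The basis `1, ω`. -/
def bas : Module.Basis (Fin 2) ℤ Eis := Module.Basis.ofEquivFun eqvL

lemma eqvL_mk (a b : ℤ) : eqvL (mk a b) = ![a, b] := by
  rw [← LinearEquiv.eq_symm_apply]
  rfl

lemma bas_repr_mk (a b : ℤ) (i : Fin 2) : bas.repr (mk a b) i = ![a, b] i := by
  rw [← eqvL_mk]; rfl

lemma bas_zero : bas 0 = mk 1 0 := by
  apply eqvL.injective
  rw [eqvL_mk]; simp [bas]; funext i; fin_cases i <;> simp

lemma bas_one : bas 1 = mk 0 1 := by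
  apply eqvL.injective
  rw [eqvL_mk]; simp [bas]; funext i; fin_cases i <;> simp

instance : Module.Finite ℤ Eis := Module.Finite.of_basis bas
instance : Module.Free ℤ Eis := Module.Free.of_basis bas

lemma algNorm (x : Eis) : (Algebra.norm ℤ x).natAbs = NmN x := by
  obtain ⟨a, b, rfl⟩ := exists_mk x
  have h : Algebra.norm ℤ (mk a b) = a ^ 2 - a * b + b ^ 2 := by
    rw [Algebra.norm_eq_matrix_det bas, Matrix.det_fin_two]
    simp only [Algebra.leftMulMatrix_eq_repr_mul, bas_zero, bas_one, mk_mul, bas_repr_mk]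
    simp; ring
  have h2 : ((NmN (mk a b) : ℕ) : ℤ) = a ^ 2 - a * b + b ^ 2 := by
    have := NmN_cast (mk a b)
    rw [Nm_mk] at this
    exact_mod_cast this
  rw [h, ← h2]; rfl

lemma card_quot (n : Eis) : Nat.card (Eis ⧸ Ideal.span {n}) = NmN n := by
  have := Ideal.absNorm_span_singleton n
  rw [algNorm] at this
  rw [← this]; rfl

lemma finite_quot {n : Eis} (hn : n ≠ 0) : Finite (Eis ⧸ Ideal.span {n}) := by
  apply Nat.finite_of_card_ne_zero
  rw [card_quot]
  exact fun h => hn (NmN_eq_zero.1 h)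

lemma isUnit_quot {n a : Eis} : IsUnit (Ideal.Quotient.mk (Ideal.span {n}) a) ↔ IsCoprime n a := by
  constructor
  · rintro h
    obtain ⟨b, hb⟩ := isUnit_iff_exists_inv.1 h
    obtain ⟨b, rfl⟩ := Ideal.Quotient.mk_surjective b
    rw [← map_mul, ← map_one (Ideal.Quotient.mk (Ideal.span {n})), Ideal.Quotient.mk_eq_mk_iff_sub_mem,
      Ideal.mem_span_singleton] at hb
    obtain ⟨c, hc⟩ := hb
    exact ⟨-c, b, by linear_combination hc⟩
  · rintro ⟨x, y, h⟩
    refine IsUnit.of_mul_eq_one (Ideal.Quotient.mk _ y) ?_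
    rw [← map_mul, ← map_one (Ideal.Quotient.mk (Ideal.span {n})), Ideal.Quotient.mk_eq_mk_iff_sub_mem,
      Ideal.mem_span_singleton]
    exact ⟨-x, by linear_combination h⟩

/-- The cubic symbol as a multiplicative character on the quotient. -/
def qchar {χ : Eis → Eis → Eis} (hχ : IsCubicSymbol χ) {n : Eis} (hn : Pr n) :
    MulChar (Eis ⧸ Ideal.span {n}) Eis where
  toFun d := χ n d.out
  map_one' := by
    have : χ n (Quotient.out (1 : Eis ⧸ Ideal.span {n})) = χ n 1 := by
      apply hχ.congr_top hn
      rw [← Ideal.mem_span_singleton, ← Ideal.Quotient.mk_eq_mk_iff_sub_mem, Ideal.Quotient.mk_out,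
        map_one]
    rw [this, hχ.top_one hn]
  map_mul' x y := by
    rw [← hχ.mul_top hn]
    apply hχ.congr_top hn
    rw [← Ideal.mem_span_singleton, ← Ideal.Quotient.mk_eq_mk_iff_sub_mem, map_mul,
      Ideal.Quotient.mk_out, Ideal.Quotient.mk_out, Ideal.Quotient.mk_out]
  map_nonunit' x hx := by
    by_contra h
    apply hx
    have := (hχ.ne_zero_iff hn _).1 h
    rwa [← isUnit_quot, Ideal.Quotient.mk_out] at this

lemma qchar_mk {χ : Eis → Eis → Eis} (hχ : IsCubicSymbol χ) {n : Eis} (hn : Pr n) (a : Eis) :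
    qchar hχ hn (Ideal.Quotient.mk _ a) = χ n a := by
  change χ n _ = χ n a
  apply hχ.congr_top hn
  rw [← Ideal.mem_span_singleton, ← Ideal.Quotient.mk_eq_mk_iff_sub_mem, Ideal.Quotient.mk_out]

/-- Additive character on `ℂ`, trivial on the Eisenstein integers: `x+yω ↦ e(y)`. -/
def eψ (z : ℂ) : ℂ := Complex.exp (((2 * Real.pi * (2 * z.im / Real.sqrt 3) : ℝ) : ℂ) * I)

lemma eψ_add (z w : ℂ) : eψ (z + w) = eψ z * eψ w := by
  unfold eψ
  rw [← Complex.exp_add, ← add_mul, ← Complex.ofReal_add]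
  congr 3; simp; ring

lemma norm_eψ (z : ℂ) : ‖eψ z‖ = 1 := Complex.norm_exp_ofReal_mul_I _

lemma eψ_zero : eψ 0 = 1 := by simp [eψ]

lemma eψ_neg (z : ℂ) : eψ (-z) = (starRingEnd ℂ) (eψ z) := by
  unfold eψ
  rw [← Complex.exp_conj, map_mul, Complex.conj_ofReal, Complex.conj_I]
  congr 1; push_cast; simp; ring

lemma sqrt3_ne : Real.sqrt 3 ≠ 0 := by positivity

lemma eψ_xy (x y : ℝ) : eψ (x + y * ωc) = Complex.exp (((2 * Real.pi * y : ℝ) : ℂ) * I) := by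
  unfold eψ
  congr 3
  have : ((x : ℂ) + y * ωc).im = y * (Real.sqrt 3 / 2) := by rw [ωc_eq]; simp
  rw [this]
  have := sqrt3_ne
  field_simp

lemma eψ_xy_eq_one {x y : ℝ} (h : eψ (x + y * ωc) = 1) : ∃ k : ℤ, y = k := by
  rw [eψ_xy, Complex.exp_eq_one_iff] at h
  obtain ⟨k, hk⟩ := h
  refine ⟨k, ?_⟩
  have hI : (I : ℂ) ≠ 0 := I_ne_zero
  have hpi : (Real.pi : ℂ) ≠ 0 := by exact_mod_cast Real.pi_ne_zero
  push_cast at hk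
  have : (y : ℂ) = k := by
    have h3 : (2 * Real.pi * I : ℂ) * y = (2 * Real.pi * I) * k := by linear_combination hk
    exact mul_left_cancel₀ (by simp [hI]) h3
  exact_mod_cast this

lemma eψ_eis (x : Eis) : eψ (x : ℂ) = 1 := by
  obtain ⟨a, b, rfl⟩ := exists_mk x
  have h := eψ_xy a b
  push_cast at h
  rw [coe_mk]
  rw [h, Complex.exp_eq_one_iff]
  exact ⟨b, by ring⟩

lemma exists_xy (z : ℂ) : ∃ x y : ℝ, z = x + y * ωc := by
  refine ⟨z.re + z.im / Real.sqrt 3, 2 * z.im / Real.sqrt 3, ?_⟩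
  have := sqrt3_ne
  rw [ωc_eq]
  apply Complex.ext
  · simp; field_simp; ring
  · simp; field_simp

lemma eψ_nondeg {z : ℂ} (h : ∀ d : Eis, eψ (z * d) = 1) : ∃ x : Eis, z = x := by
  obtain ⟨x, y, rfl⟩ := exists_xy z
  have h1 := h 1
  simp only [OneMemClass.coe_one, mul_one] at h1
  obtain ⟨k, hk⟩ := eψ_xy_eq_one h1
  have h2 := h ωE
  have e : ((x : ℂ) + y * ωc) * ((ωE : Eis) : ℂ) = ((-y : ℝ) : ℂ) + ((x - y : ℝ) : ℂ) * ωc := by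
    rw [coe_ωE]; push_cast; linear_combination (y:ℂ) * ωc_sq
  rw [e] at h2
  obtain ⟨l, hl⟩ := eψ_xy_eq_one h2
  refine ⟨mk (k + l) k, ?_⟩
  rw [coe_mk, hk]
  have : x = k + l := by rw [← hl, ← hk]; ring
  rw [this]; push_cast; ring

/-- The additive character `d ↦ ψ(h d / n)` on the quotient. -/
def qadd {n : Eis} (hn : n ≠ 0) (h : Eis) : AddChar (Eis ⧸ Ideal.span {n}) ℂ where
  toFun d := eψ ((h * d.out : ℂ) / n)
  map_zero_eq_one' := by
    have h0 : ((n : Eis) : ℂ) ≠ 0 := by simpa using hn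
    have : n ∣ Quotient.out (0 : Eis ⧸ Ideal.span {n}) := by
      rw [← Ideal.mem_span_singleton, ← Ideal.Quotient.eq_zero_iff_mem, Ideal.Quotient.mk_out]
    obtain ⟨c, hc⟩ := this
    rw [hc]
    have : ((h : ℂ) * ((n * c : Eis) : ℂ)) / n = ((h * c : Eis) : ℂ) := by
      push_cast; field_simp
    rw [this, eψ_eis]
  map_add_eq_mul' a b := by
    have h0 : ((n : Eis) : ℂ) ≠ 0 := by simpa using hn
    have : n ∣ Quotient.out (a + b) - (Quotient.out a + Quotient.out b) := by
      rw [← Ideal.mem_span_singleton, ← Ideal.Quotient.mk_eq_mk_iff_sub_mem, map_add,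
        Ideal.Quotient.mk_out, Ideal.Quotient.mk_out, Ideal.Quotient.mk_out]
    obtain ⟨c, hc⟩ := this
    rw [sub_eq_iff_eq_add] at hc
    rw [← eψ_add, hc]
    have : ((h : ℂ) * ((n * c + (Quotient.out a + Quotient.out b) : Eis) : ℂ)) / n
      = ((h * c : Eis) : ℂ) + (((h * Quotient.out a : ℂ) / n) + (h * Quotient.out b : ℂ) / n) := by
      push_cast; field_simp
    rw [this, eψ_add, eψ_eis, one_mul]

lemma eψ_congr {n : Eis} (hn : n ≠ 0) (h : Eis) {a b : Eis} (hab : n ∣ a - b) :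
    eψ ((h * a : ℂ) / n) = eψ ((h * b : ℂ) / n) := by
  have h0 : ((n : Eis) : ℂ) ≠ 0 := by simpa using hn
  obtain ⟨c, hc⟩ := hab
  rw [sub_eq_iff_eq_add] at hc
  rw [hc]
  have : ((h : ℂ) * ((n * c + b : Eis) : ℂ)) / n = ((h * c : Eis) : ℂ) + (h * b : ℂ) / n := by
    push_cast; field_simp
  rw [this, eψ_add, eψ_eis, one_mul]

lemma qadd_mk {n : Eis} (hn : n ≠ 0) (h a : Eis) :
    qadd hn h (Ideal.Quotient.mk _ a) = eψ ((h * a : ℂ) / n) := by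
  change eψ _ = _
  apply eψ_congr hn
  rw [← Ideal.mem_span_singleton, ← Ideal.Quotient.mk_eq_mk_iff_sub_mem, Ideal.Quotient.mk_out]

lemma qadd_eq_one_iff {n : Eis} (hn : n ≠ 0) (h : Eis) : qadd hn h = 1 ↔ n ∣ h := by
  have h0 : ((n : Eis) : ℂ) ≠ 0 := by simpa using hn
  constructor
  · intro H
    have : ∀ d : Eis, eψ (((h : ℂ) / n) * d) = 1 := by
      intro d
      have h2 := qadd_mk hn h d
      rw [H, AddChar.one_apply] at h2
      rw [h2]; congr 1; ring
    obtain ⟨x, hx⟩ := eψ_nondeg this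
    refine ⟨x, ?_⟩
    apply Subtype.ext
    push_cast
    rw [← hx]; field_simp
  · rintro ⟨c, rfl⟩
    ext d
    obtain ⟨d, rfl⟩ := Ideal.Quotient.mk_surjective d
    rw [qadd_mk, AddChar.one_apply]
    have : (((n * c : Eis) : ℂ) * d) / n = ((c * d : Eis) : ℂ) := by push_cast; field_simp
    rw [this, eψ_eis]

/-! ### Part 5: cubic reciprocity -/

lemma Pr.NmN_mod {x : Eis} (hx : Pr x) : NmN x % 3 = 1 := by
  obtain ⟨a, b, rfl⟩ := exists_mk x
  rw [Pr_mk] at hx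
  have h2 : ((NmN (mk a b) : ℕ) : ℤ) = a ^ 2 - a * b + b ^ 2 := by
    have := NmN_cast (mk a b)
    rw [Nm_mk] at this
    exact_mod_cast this
  obtain ⟨c, hc⟩ : ∃ c, a = 3 * c + 1 := ⟨a / 3, by omega⟩
  obtain ⟨d, hd⟩ : ∃ d, b = 3 * d := ⟨b / 3, by omega⟩
  have h3 : a ^ 2 - a * b + b ^ 2 = 3 * (3 * c ^ 2 + 2 * c - 3 * c * d - d + 3 * d ^ 2) + 1 := by
    rw [hc, hd]; ring
  rw [h3] at h2
  omega

lemma int_of_isIntegral_div {m : ℤ} {q : ℕ} (hq : q ≠ 0) (h : IsIntegral ℤ ((m : ℂ) / q)) :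
    (q : ℤ) ∣ m := by
  have h1 : IsIntegral ℤ ((m : ℚ) / q) := by
    have : ((m : ℂ) / q) = algebraMap ℚ ℂ ((m : ℚ) / q) := by simp
    rw [this] at h
    exact (isIntegral_algebraMap_iff (algebraMap ℚ ℂ).injective).1 h
  obtain ⟨k, hk⟩ := IsIntegrallyClosed.isIntegral_iff.1 h1
  refine ⟨k, ?_⟩
  have hq' : (q : ℚ) ≠ 0 := by exact_mod_cast hq
  have : (m : ℚ) = q * k := by
    rw [eq_div_iff hq'] at hk
    rw [← hk]; simp; ring
  exact_mod_cast this

lemma isIntegral_eis (x : Eis) : IsIntegral ℤ (x : ℂ) := by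
  have : IsIntegral ℤ x := Algebra.IsIntegral.isIntegral x
  exact this.map (Eis.subtype.toIntAlgHom)

lemma isIntegral_conj {z : ℂ} (h : IsIntegral ℤ z) : IsIntegral ℤ ((starRingEnd ℂ) z) :=
  h.map ((starRingEnd ℂ).toIntAlgHom)

lemma int_desc {x : Eis} {q : ℕ} (hq : Nat.Coprime q 3) (h : IsIntegral ℤ ((x : ℂ) / q)) :
    (q : Eis) ∣ x := by
  have hq0 : q ≠ 0 := by rintro rfl; simp at hq
  obtain ⟨a, b, rfl⟩ := exists_mk x
  have tr : ∀ z : ℂ, IsIntegral ℤ z → IsIntegral ℤ (z + (starRingEnd ℂ) z) := fun z hz =>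
    hz.add (isIntegral_conj hz)
  have h1 := tr _ h
  have h2 := tr _ (h.mul (isIntegral_eis ωE))
  have e1 : ((mk a b : Eis) : ℂ) / q + (starRingEnd ℂ) (((mk a b : Eis) : ℂ) / q)
      = ((2 * a - b : ℤ) : ℂ) / q := by
    rw [coe_mk]; simp [conj_ωc]; ring
  have e2 : ((mk a b : Eis) : ℂ) / q * ωE + (starRingEnd ℂ) (((mk a b : Eis) : ℂ) / q * ωE)
      = ((- a - b : ℤ) : ℂ) / q := by
    rw [coe_mk]; simp [conj_ωc]
    have : (-1 - ωc) * (-1 - ωc) = ωc := by linear_combination ωc_sq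
    linear_combination (b / q : ℂ) * ωc_sq + (b / q : ℂ) * this
  rw [e1] at h1
  rw [e2] at h2
  have h1 := int_of_isIntegral_div hq0 h1
  have h2 := int_of_isIntegral_div hq0 h2
  have c3 : IsCoprime (q : ℤ) 3 := by
    have := Nat.isCoprime_iff_coprime.2 hq; simpa using this
  have ha : (q : ℤ) ∣ a := by
    apply c3.dvd_of_dvd_mul_left
    have : 3 * a = (2 * a - b) - (-a - b) := by ring
    rw [this]; exact dvd_sub h1 h2
  have hb : (q : ℤ) ∣ b := by
    have : b = 2 * a - (2 * a - b) := by ring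
    rw [this]; exact dvd_sub (ha.mul_left _) h1
  obtain ⟨c, rfl⟩ := ha
  obtain ⟨d, rfl⟩ := hb
  refine ⟨mk c d, ?_⟩
  simp only [mk]; push_cast; ring

lemma gauss_frob {F : Type*} [Field F] [Fintype F] (χ : MulChar F ℂ) (hχ : χ ^ 3 = 1)
    (ψ : AddChar F ℂ) {ℓ : ℕ} (hℓ : ℓ.Prime) (hℓ3 : ℓ ≠ 3) (n : ℕ) (hq : ℓ ^ n % 3 = 1)
    (hu : ((ℓ ^ n : ℕ) : F) ≠ 0) :
    IsIntegral ℤ (gaussSum χ ψ) ∧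
    IsIntegral ℤ ((gaussSum χ ψ ^ (ℓ ^ n) - χ⁻¹ ((ℓ ^ n : ℕ) : F) * gaussSum χ ψ) / ℓ) := by
  haveI : Fact ℓ.Prime := ⟨hℓ⟩
  have hχi : ∀ x, IsIntegral ℤ (χ x) := by
    intro x
    by_cases hx : x = 0
    · rw [hx, MulChar.map_zero]; exact isIntegral_zero
    · refine IsIntegral.of_pow (n := 3) (by norm_num) ?_
      rw [← MulChar.pow_apply' _ (by norm_num), hχ, MulChar.one_apply (isUnit_iff_ne_zero.2 hx)]
      exact isIntegral_one
  have hψi : ∀ x, IsIntegral ℤ (ψ x) := by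
    intro x
    refine IsIntegral.of_pow (n := Fintype.card F) Fintype.card_pos ?_
    rw [← AddChar.map_nsmul_eq_pow]
    rw [nsmul_eq_mul, FiniteField.cast_card_eq_zero, zero_mul, AddChar.map_zero_eq_one]
    exact isIntegral_one
  let R := integralClosure ℤ ℂ
  let a : F → R := fun x => ⟨χ x, hχi x⟩
  let b : F → R := fun x => ⟨ψ x, hψi x⟩
  let I : Ideal R := Ideal.span {(ℓ : R)}
  have hnu : (ℓ : R) ∈ nonunits R := by
    intro h
    obtain ⟨y, hy⟩ := isUnit_iff_exists_inv.1 h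
    have h2 : (ℓ : ℂ) * (y : ℂ) = 1 := by
      have := congrArg (fun z : R => (z : ℂ)) hy
      simpa using this
    have h3 : IsIntegral ℤ (((1 : Eis) : ℂ) / ℓ) := by
      have : (((1 : Eis) : ℂ) / ℓ) = (y : ℂ) := by
        have : (ℓ : ℂ) ≠ 0 := by exact_mod_cast hℓ.ne_zero
        field_simp
        rw [mul_comm] at h2
        simp; rw [mul_comm]; exact h2.symm
      rw [this]; exact y.2
    have := int_desc ((Nat.coprime_primes hℓ Nat.prime_three).2 hℓ3) h3
    have h4 := isUnit_of_dvd_one this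
    rw [isUnit_iff_Nm] at h4
    have h5 : Nm (ℓ : Eis) = (ℓ : ℝ) ^ 2 := by simp [Nm]; ring
    rw [h5] at h4
    have := hℓ.one_lt
    have : (1:ℝ) < ℓ := by exact_mod_cast this
    nlinarith
  haveI : CharP (R ⧸ I) ℓ := CharP.quotient R ℓ hnu
  let f := Ideal.Quotient.mk I
  have key : f ((∑ x, a x * b x) ^ (ℓ ^ n)) = f (∑ x, a x * b (((ℓ ^ n : ℕ) : F) * x)) := by
    rw [map_pow, map_sum, sum_pow_char_pow, map_sum]
    refine Finset.sum_congr rfl fun x _ => ?_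
    rw [← map_pow]
    congr 1
    rw [mul_pow]
    congr 1
    · apply Subtype.ext
      change (χ x) ^ (ℓ ^ n) = χ x
      by_cases hx : x = 0
      · rw [hx, MulChar.map_zero, zero_pow]
        exact pow_ne_zero _ hℓ.ne_zero
      have h3 : (χ x) ^ 3 = 1 := by
        rw [← MulChar.pow_apply' _ (by norm_num), hχ, MulChar.one_apply (isUnit_iff_ne_zero.2 hx)]
      conv_lhs => rw [← Nat.div_add_mod (ℓ ^ n) 3, pow_add, pow_mul, h3, one_pow, hq, pow_one,
        one_mul]
    · apply Subtype.ext
      change (ψ x) ^ (ℓ ^ n) = ψ _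
      rw [← AddChar.map_nsmul_eq_pow, nsmul_eq_mul]
  rw [Ideal.Quotient.mk_eq_mk_iff_sub_mem, Ideal.mem_span_singleton] at key
  obtain ⟨c, hc⟩ := key
  have hg : ((∑ x, a x * b x : R) : ℂ) = gaussSum χ ψ := by
    simp [gaussSum, a, b]
  have hg2 : ((∑ x, a x * b (((ℓ ^ n : ℕ) : F) * x) : R) : ℂ)
      = χ⁻¹ ((ℓ ^ n : ℕ) : F) * gaussSum χ ψ := by
    have := gaussSum_mulShift_eq χ ψ (Units.mk0 _ hu)
    rw [Units.val_mk0] at this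
    rw [← this]
    simp [gaussSum, a, b, AddChar.mulShift_apply]
  refine ⟨?_, ?_⟩
  · rw [← hg]; exact (∑ x, a x * b x : R).2
  · have h := congrArg (fun z : R => (z : ℂ)) hc
    simp only [AddSubgroupClass.coe_sub, SubmonoidClass.coe_pow, MulMemClass.coe_mul] at h
    rw [hg, hg2] at h
    rw [h]
    have : (ℓ : ℂ) ≠ 0 := by exact_mod_cast hℓ.ne_zero
    have : ((ℓ : R) : ℂ) * (c : ℂ) / ℓ = c := by
      simp; field_simp
    rw [this]; exact c.2

/-! ### Part 6: the Jacobi sum and cubic reciprocity -/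

lemma span_prime_max {p : Eis} (hp : Prime p) : (Ideal.span {p}).IsMaximal :=
  PrincipalIdealRing.isMaximal_of_irreducible hp.irreducible

lemma primitive_ωE : IsPrimitiveRoot ωE 3 := by
  refine IsPrimitiveRoot.mk_of_lt ωE (by norm_num) ωE_cube ?_
  intro l hl hl3 h
  interval_cases l
  · rw [pow_one, ωE_eq_mk, one_eq_mk, mk_inj] at h; omega
  · rw [ωE_sq, ωE_eq_mk, one_eq_mk, mk_neg, mk_sub, mk_inj] at h; omega

section
variable {F : Type*} [Field F] [Fintype F]

lemma jacobi_zero (k : ℕ) (hk : 0 < k) (hq : Fintype.card F = 3 * k + 1) :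
    ∑ x : F, x ^ k * (1 - x) ^ k = 0 := by
  have h1 : ∀ x : F, x ^ k * (1 - x) ^ k
      = ∑ m ∈ Finset.range (k + 1), ((-1) ^ m * (k.choose m : F)) * x ^ (k + m) := by
    intro x
    have : (1 - x) = (-x) + 1 := by ring
    rw [this, add_pow, Finset.mul_sum]
    refine Finset.sum_congr rfl fun m _ => ?_
    rw [one_pow, neg_pow, pow_add]; ring
  simp_rw [h1]
  rw [Finset.sum_comm]
  refine Finset.sum_eq_zero fun m hm => ?_
  rw [← Finset.mul_sum, FiniteField.sum_pow_lt_card_sub_one, mul_zero]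
  rw [Finset.mem_range] at hm
  omega

lemma exists_pow_ne_one (k : ℕ) (hk : 0 < k) (hq : Fintype.card F = 3 * k + 1) :
    ∃ x : F, x ≠ 0 ∧ x ^ k ≠ 1 := by
  classical
  obtain ⟨g, hg⟩ := IsCyclic.exists_generator (α := Fˣ)
  have h1 := orderOf_eq_card_of_forall_mem_zpowers hg
  rw [Nat.card_eq_fintype_card, Fintype.card_units, hq] at h1
  refine ⟨g, g.ne_zero, fun h => ?_⟩
  have h2 : g ^ k = 1 := by ext; simpa using h
  have h3 := orderOf_dvd_of_pow_eq_one h2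
  rw [h1] at h3
  have := Nat.le_of_dvd hk h3
  omega

lemma jacobi_eval {p : Eis} (hp : Prime p) (hpr : Pr p) (f : Eis →+* F)
    (hf : ∀ x, f x = 0 ↔ p ∣ x) (k : ℕ) (hk : 0 < k)
    (hq : Fintype.card F = 3 * k + 1) (hN : NmN p = 3 * k + 1)
    (η : MulChar F Eis) (hη : ∀ x, f (η x) = x ^ k) (hη3 : η ^ 3 = 1) :
    η ≠ 1 ∧ jacobiSum η η = -p := by
  have hne : η ≠ 1 := by
    rintro rfl
    obtain ⟨x, hx, hx'⟩ := exists_pow_ne_one (F := F) k hk hq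
    apply hx'
    rw [← hη, MulChar.one_apply (isUnit_iff_ne_zero.2 hx), map_one]
  refine ⟨hne, ?_⟩
  have hdvd : p ∣ jacobiSum η η := by
    rw [← hf, jacobiSum, map_sum]
    simp_rw [map_mul, hη]
    exact jacobi_zero k hk hq
  obtain ⟨z, -, hz⟩ := exists_jacobiSum_eq_neg_one_add (n := 3) (by norm_num) hη3 hη3
    (by rw [hq]; simp) primitive_ωE
  have hprim : Pr (-jacobiSum η η) := by
    rw [hz]
    refine ⟨z * ωE, ?_⟩
    linear_combination (-z) * ωE_sq
  have hηne : η * η ≠ 1 := by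
    intro h
    apply hne
    have : η ^ 3 = η * (η * η) := by rw [pow_succ, pow_two]; exact mul_comm _ _
    rw [← hη3, this, h, mul_one]
  have hNm : Nm (jacobiSum η η) = NmN p := by
    let ι : Eis →+* ℂ := Eis.subtype
    have hι : Function.Injective ι := Subtype.val_injective
    have hc : ringChar ℂ ≠ ringChar F := by
      have h0 : ringChar ℂ = 0 := ringChar.eq ℂ 0
      rw [h0]
      intro h
      have := CharP.ringChar_ne_zero_of_finite F
      exact this h.symm
    have h1 := jacobiSum_mul_jacobiSum_inv hc (χ := η.ringHomComp ι) (φ := η.ringHomComp ι)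
      ((MulChar.ringHomComp_ne_one_iff hι).2 hne) ((MulChar.ringHomComp_ne_one_iff hι).2 hne)
      (by rw [← MulChar.ringHomComp_mul]; exact (MulChar.ringHomComp_ne_one_iff hι).2 hηne)
    have h2 : (η.ringHomComp ι)⁻¹ = (η.ringHomComp ι).ringHomComp (starRingEnd ℂ) := by
      rw [← MulChar.star_eq_inv]; rfl
    rw [h2, jacobiSum_ringHomComp _ _ (starRingEnd ℂ), jacobiSum_ringHomComp, Complex.mul_conj] at h1
    have h3 : Complex.normSq (ι (jacobiSum η η)) = Nm (jacobiSum η η) := rfl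
    rw [h3, hq, ← hN] at h1
    exact_mod_cast h1
  obtain ⟨u, hu⟩ := hdvd
  rw [hu, Nm_mul, NmN_cast] at hNm
  have hu1 : Nm u = 1 := by
    have := Nm_pos hp.ne_zero
    exact mul_left_cancel₀ this.ne' (by rw [hNm, mul_one])
  have huu : IsUnit (-u) := (isUnit_iff_Nm.2 hu1).neg
  rw [hu, ← mul_neg] at hprim
  have := (hpr.cofactor hprim).unit_eq_one huu
  rw [hu, ← neg_inj, ← mul_neg, this]; simp

end

/-- Main congruence. -/
lemma recip_aux {χ : Eis → Eis → Eis} (hχ : IsCubicSymbol χ) {p p' : Eis} (hp : Prime p)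
    (hpr : Pr p) (hp' : Prime p') (hpr' : Pr p') (h1 : ¬ p' ∣ p) (h2 : ¬ p' ∣ cj p) :
    χ p' (p * (p * cj p)) * χ p (p' * cj p') = 1 := by
  have := span_prime_max hp
  have := span_prime_max hp'
  letI : Field (Eis ⧸ Ideal.span {p}) := Ideal.Quotient.field _
  letI : Field (Eis ⧸ Ideal.span {p'}) := Ideal.Quotient.field _
  have := finite_quot hp.ne_zero
  have := finite_quot hp'.ne_zero
  letI : Fintype (Eis ⧸ Ideal.span {p}) := Fintype.ofFinite _
  letI : Fintype (Eis ⧸ Ideal.span {p'}) := Fintype.ofFinite _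
  have hcard : Fintype.card (Eis ⧸ Ideal.span {p}) = NmN p := by
    rw [← card_quot, Nat.card_eq_fintype_card]
  have hcard' : Fintype.card (Eis ⧸ Ideal.span {p'}) = NmN p' := by
    rw [← card_quot, Nat.card_eq_fintype_card]
  -- p
  set k := (NmN p - 1) / 3 with hk
  have hN : NmN p = 3 * k + 1 := by have := hpr.NmN_mod; omega
  have hk0 : 0 < k := by
    rcases Nat.eq_zero_or_pos k with h | h
    · exfalso; apply hp.not_isUnit
      rw [isUnit_iff_Nm, ← NmN_cast, hN, h]; simp
    · exact h
  let η := qchar hχ hpr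
  have hη : ∀ x, Ideal.Quotient.mk (Ideal.span {p}) (η x) = x ^ k := by
    intro x
    obtain ⟨a, rfl⟩ := Ideal.Quotient.mk_surjective x
    rw [qchar_mk, ← map_pow]
    symm
    rw [Ideal.Quotient.mk_eq_mk_iff_sub_mem, Ideal.mem_span_singleton]
    exact hχ.prime_congr p a hp hpr
  have hη3 : η ^ 3 = 1 := by
    ext x
    rw [MulChar.pow_apply_coe, MulChar.one_apply_coe]
    obtain ⟨a, ha⟩ := Ideal.Quotient.mk_surjective (x : Eis ⧸ Ideal.span {p})
    rw [← ha, qchar_mk]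
    refine congrArg Subtype.val (hχ.cube_eq hpr ?_)
    rw [← isUnit_quot, ha]; exact x.isUnit
  obtain ⟨hne, hJ⟩ := jacobi_eval hp hpr (Ideal.Quotient.mk (Ideal.span {p}))
    (fun x => by rw [Ideal.Quotient.eq_zero_iff_mem, Ideal.mem_span_singleton]) k hk0
    (by rw [hcard, hN]) hN η hη hη3
  -- complex characters
  let ι : Eis →+* ℂ := Eis.subtype
  have hι : Function.Injective ι := Subtype.val_injective
  let ηc := η.ringHomComp ι
  have hηc3 : ηc ^ 3 = 1 := by rw [MulChar.ringHomComp_pow, hη3, MulChar.ringHomComp_one]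
  have hηcne : ηc ≠ 1 := (MulChar.ringHomComp_ne_one_iff hι).2 hne
  let ψ := qadd hp.ne_zero 1
  have hψ1 : ψ ≠ 1 := by
    intro h
    rw [qadd_eq_one_iff] at h
    exact hp.not_isUnit (isUnit_of_dvd_one h)
  have hψ : ψ.IsPrimitive := AddChar.IsPrimitive.of_ne_one hψ1
  have hord : orderOf ηc = 3 := by
    have := orderOf_dvd_of_pow_eq_one hηc3
    rcases (Nat.dvd_prime Nat.prime_three).1 this with h | h
    · exact absurd (orderOf_eq_one_iff.1 h) hηcne
    · exact h
  have hg3 := gaussSum_pow_eq_prod_jacobiSum (χ := ηc) (ψ := ψ) (by rw [hord]; norm_num) hψ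
  have hm1 : ηc (-1) = 1 := by
    have : (-1 : Eis ⧸ Ideal.span {p}) = Ideal.Quotient.mk _ (-1) := by simp
    rw [this, MulChar.ringHomComp_apply, qchar_mk, hχ.top_neg_one hpr]; simp
  have hIco : Finset.Ico 1 (3 - 1) = {1} := by decide
  rw [hord, hIco, Finset.prod_singleton, pow_one, jacobiSum_ringHomComp, hJ, hm1, one_mul, hcard] at hg3
  -- Frobenius
  obtain ⟨n, hℓ, hn⟩ := FiniteField.card (Eis ⧸ Ideal.span {p'}) (ringChar (Eis ⧸ Ideal.span {p'}))
  set ℓ := ringChar (Eis ⧸ Ideal.span {p'}) with hℓdef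
  rw [hcard'] at hn
  have hmod' := hpr'.NmN_mod
  have hℓ3 : ℓ ≠ 3 := by
    intro h
    rw [hn, h] at hmod'
    have : 3 ∣ 3 ^ (n : ℕ) := dvd_pow_self _ n.ne_zero
    omega
  have hpℓ : p' ∣ (ℓ : Eis) := by
    rw [← Ideal.mem_span_singleton, ← Ideal.Quotient.eq_zero_iff_mem, map_natCast]
    exact CharP.cast_eq_zero _ _
  have hcop : IsCoprime p' (p * cj p) :=
    (prime_coprime hp' h1).mul_right (prime_coprime hp' h2)
  have h1' : ¬ p ∣ p' := fun h => h1 (hp.irreducible.associated_of_dvd hp'.irreducible h).symm.dvd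
  have h2' : ¬ p ∣ cj p' := fun h => h2 (by
    have := cj_dvd h
    rw [cj_cj] at this
    exact ((cj_prime hp).irreducible.associated_of_dvd hp'.irreducible this).symm.dvd)
  have hq0 : ((NmN p' : ℕ) : Eis ⧸ Ideal.span {p}) ≠ 0 := by
    have : ((NmN p' : ℕ) : Eis ⧸ Ideal.span {p}) = Ideal.Quotient.mk _ (p' * cj p') := by
      rw [mul_cj]; simp
    rw [this, Ne, Ideal.Quotient.eq_zero_iff_mem, Ideal.mem_span_singleton]
    intro h
    rcases hp.dvd_or_dvd h with h | h
    · exact h1' h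
    · exact h2' h
  obtain ⟨hgi, hF⟩ := gauss_frob ηc hηc3 ψ hℓ hℓ3 n (by rw [← hn]; exact hmod')
    (by rw [← hn]; exact hq0)
  rw [← hn] at hF
  set g := gaussSum ηc ψ with hgdef
  have hgg : g * (starRingEnd ℂ) g = NmN p := by
    have := gaussSum_mul_gaussSum_eq_card hηcne hψ
    rw [← star_gaussSum_eq, hcard] at this
    exact this
  set k' := (NmN p' - 1) / 3 with hk'
  have hN' : NmN p' = 3 * k' + 1 := by omega
  have hinv : ηc⁻¹ ((NmN p' : ℕ) : Eis ⧸ Ideal.span {p}) = ((cj (χ p (p' * cj p')) : Eis) : ℂ) := by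
    rw [← MulChar.star_apply']
    have : ((NmN p' : ℕ) : Eis ⧸ Ideal.span {p}) = Ideal.Quotient.mk _ (p' * cj p') := by
      rw [mul_cj]; simp
    rw [this, MulChar.ringHomComp_apply, qchar_mk]; rfl
  have hF2 := hF.mul (isIntegral_conj hgi)
  let y : Eis := (p * cj p) * ((p * cj p * (-p)) ^ k' - cj (χ p (p' * cj p')))
  have hgk : g ^ NmN p' = ((((p * cj p * (-p)) ^ k' : Eis)) : ℂ) * g := by
    have hcast : ((NmN p : ℕ) : ℂ) = ((p * cj p : Eis) : ℂ) := by rw [mul_cj]; simp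
    rw [hN', pow_succ, pow_mul, hg3, hcast]
    congr 1
  have hy : (g ^ NmN p' - ηc⁻¹ ((NmN p' : ℕ) : Eis ⧸ Ideal.span {p}) * g) / ℓ * (starRingEnd ℂ) g
      = (y : ℂ) / ℓ := by
    rw [hgk, hinv]
    have hcast : ((NmN p : ℕ) : ℂ) = ((p * cj p : Eis) : ℂ) := by rw [mul_cj]; simp
    rw [hcast] at hgg
    have e : (y : ℂ) = ((p * cj p : Eis) : ℂ) * ((((p * cj p * (-p)) ^ k' : Eis) : ℂ)
      - ((cj (χ p (p' * cj p')) : Eis) : ℂ)) := by simp only [y]; push_cast; ring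
    rw [e, ← hgg]; ring
  rw [hy] at hF2
  have hℓy : p' ∣ y := hpℓ.trans (int_desc ((Nat.coprime_primes hℓ Nat.prime_three).2 hℓ3) hF2)
  have hd : p' ∣ (p * cj p * (-p)) ^ k' - cj (χ p (p' * cj p')) := hcop.dvd_of_dvd_mul_left hℓy
  have hd2 := hχ.prime_congr p' (p * cj p * (-p)) hp' hpr'
  have heq : χ p' (p * cj p * (-p)) = cj (χ p (p' * cj p')) := by
    apply IsVal.eq_of_dvd (hχ.isVal hpr' _) (IsVal.cj (hχ.isVal hpr _)) hp' hpr'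
    have := dvd_sub hd hd2
    rwa [sub_sub_sub_cancel_left] at this
  have e2 : p * cj p * (-p) = (-1) * (p * (p * cj p)) := by ring
  rw [e2, hχ.mul_top hpr', hχ.top_neg_one hpr', one_mul] at heq
  rw [heq, (hχ.isVal hpr _).cj_eq_sq]
  have : χ p (p' * cj p') ^ 2 * χ p (p' * cj p') = χ p (p' * cj p') ^ 3 := by ring
  rw [this]
  exact hχ.cube_eq hpr ((prime_coprime hp h1').mul_right (prime_coprime hp h2'))

lemma recip_prime {χ : Eis → Eis → Eis} (hχ : IsCubicSymbol χ) {p p' : Eis} (hp : Prime p)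
    (hpr : Pr p) (hp' : Prime p') (hpr' : Pr p') (h1 : p' ≠ p) (h2 : p' ≠ cj p) :
    χ p' p = χ p p' := by
  have g1 : ¬ p' ∣ p := fun h => h1 (hpr'.eq_of_assoc hpr
    (hp'.irreducible.associated_of_dvd hp.irreducible h))
  have g2 : ¬ p' ∣ cj p := fun h => h2 (hpr'.eq_of_assoc hpr.cj
    (hp'.irreducible.associated_of_dvd (cj_prime hp).irreducible h))
  have g3 : ¬ p ∣ p' := fun h => h1 (hpr.eq_of_assoc hpr'
    (hp.irreducible.associated_of_dvd hp'.irreducible h)).symm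
  have g4 : ¬ p ∣ cj p' := fun h => h2 (by
    rw [hpr.eq_of_assoc hpr'.cj (hp.irreducible.associated_of_dvd (cj_prime hp').irreducible h),
      cj_cj])
  have e1 := recip_aux hχ hp hpr hp' hpr' g1 g2
  have e2 := recip_aux hχ hp' hpr' hp hpr g3 g4
  simp only [hχ.mul_top hpr, hχ.mul_top hpr'] at e1 e2
  have n1 : χ p' p ≠ 0 := (hχ.ne_zero_iff hpr' _).2 (prime_coprime hp' g1)
  have n2 : χ p' (cj p) ≠ 0 := (hχ.ne_zero_iff hpr' _).2 (prime_coprime hp' g2)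
  have n3 : χ p p' ≠ 0 := (hχ.ne_zero_iff hpr _).2 (prime_coprime hp g3)
  have n4 : χ p (cj p') ≠ 0 := (hχ.ne_zero_iff hpr _).2 (prime_coprime hp g4)
  have : (χ p' p * χ p' (cj p) * χ p p' * χ p (cj p')) * χ p' p
      = (χ p' p * χ p' (cj p) * χ p p' * χ p (cj p')) * χ p p' := by
    linear_combination e1 - e2
  exact mul_left_cancel₀ (by simp [n1, n2, n3, n4]) this

/-- Reciprocity when no prime factor of `b` is `p` or `p̄`. -/
lemma recip_semi {χ : Eis → Eis → Eis} (hχ : IsCubicSymbol χ) {p : Eis} (hp : Prime p)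
    (hpr : Pr p) {b : Eis} (hb : Pr b) : ¬ p ∣ b → ¬ cj p ∣ b → χ b p = χ p b := by
  induction hb using Pr.induction with
  | h1 => intro _ _; rw [hχ.one_bot, hχ.top_one hpr]
  | hmul q x hq hqr hx ih =>
    intro h1 h2
    rw [hχ.mul_bot _ _ _ hqr hx, hχ.mul_top hpr, ih (fun h => h1 (h.mul_left _))
      (fun h => h2 (h.mul_left _)), recip_prime hχ hp hpr hq hqr]
    · rintro rfl; exact h1 (dvd_mul_right _ _)
    · rintro rfl; exact h2 (dvd_mul_right _ _)

lemma IsVal.eq_one_of_cj {x : Eis} (hx : IsVal x) (h0 : x ≠ 0) (h : CubicPaper.cj x = x) : x = 1 := by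
  rw [hx.cj_eq_sq] at h
  have := mul_left_cancel₀ h0 (show x * x = x * 1 by rw [mul_one, ← pow_two, h])
  exact this

lemma recip_cj {χ : Eis → Eis → Eis} (hχ : IsCubicSymbol χ) {p : Eis} (hp : Prime p)
    (hpr : Pr p) (hne : cj p ≠ p) : χ p (cj p) = 1 := by
  have g1 : ¬ p ∣ cj p := fun h => hne (hpr.eq_of_assoc hpr.cj
    (hp.irreducible.associated_of_dvd (cj_prime hp).irreducible h)).symm
  have g2 : ¬ cj p ∣ p := fun h => g1 (by have := cj_dvd h; rwa [cj_cj] at this)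
  set t := -(p + cj p) with ht
  have htp : Pr t := by
    obtain ⟨d, hd⟩ := hpr.cj
    obtain ⟨c, hc⟩ := hpr
    refine ⟨-c - d - 1, ?_⟩
    linear_combination -hc - hd
  have n1 : ¬ p ∣ t := fun h => g1 (by
    have : cj p = -t - p := by rw [ht]; ring
    rw [this]; exact dvd_sub (dvd_neg.2 h) dvd_rfl)
  have n2 : ¬ cj p ∣ t := fun h => g2 (by
    have h3 : -t - cj p = p := by rw [ht]; ring
    have h4 : cj p ∣ -t - cj p := dvd_sub (dvd_neg.2 h) dvd_rfl
    rwa [h3] at h4)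
  have e1 : χ p (cj p) = χ p t := by
    have h1 : χ p t = χ p (-1 * cj p) := by
      apply hχ.congr_top hpr
      exact ⟨-1, by rw [ht]; ring⟩
    rw [h1, hχ.mul_top hpr, hχ.top_neg_one hpr, one_mul]
  have e2 := recip_semi hχ hp hpr htp n1 n2
  rw [e1, ← e2]
  apply (hχ.isVal htp p).eq_one_of_cj
  · rw [hχ.ne_zero_iff htp]; exact (prime_coprime hp n1).symm
  · have hct : cj t = t := by rw [ht]; simp; ring
    rw [hχ.cj htp, hct]
    have h1 : χ t (cj p) = χ t (-1 * p) := by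
      apply hχ.congr_top htp
      exact ⟨-1, by rw [ht]; ring⟩
    rw [h1, hχ.mul_top htp, hχ.top_neg_one htp, one_mul]

lemma recip_prime' {χ : Eis → Eis → Eis} (hχ : IsCubicSymbol χ) {p p' : Eis} (hp : Prime p)
    (hpr : Pr p) (hp' : Prime p') (hpr' : Pr p') : χ p' p = χ p p' := by
  by_cases h1 : p' = p
  · rw [h1]
  by_cases h2 : p' = cj p
  · subst h2
    have := recip_cj hχ hp hpr h1
    have h3 := hχ.cj hpr (cj p)
    rw [cj_cj, this, map_one] at h3
    rw [← h3, this]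
  exact recip_prime hχ hp hpr hp' hpr' h1 h2

/-- **Cubic reciprocity**. -/
theorem recip {χ : Eis → Eis → Eis} (hχ : IsCubicSymbol χ) {a b : Eis} (ha : Pr a) (hb : Pr b) :
    χ a b = χ b a := by
  induction ha using Pr.induction with
  | h1 => rw [hχ.one_bot, hχ.top_one hb]
  | hmul p x hp hpr hx ih =>
    rw [hχ.mul_bot _ _ _ hpr hx, hχ.mul_top hb, ih]
    congr 1
    clear ih
    induction hb using Pr.induction with
    | h1 => rw [hχ.one_bot, hχ.top_one hpr]
    | hmul q y hq hqr hy ih =>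
      rw [hχ.mul_bot _ _ _ hqr hy, hχ.mul_top hpr, ih, recip_prime' hχ hq hqr hp hpr]

/-! ### Part 7: Poisson summation for Gaussians on the Eisenstein lattice -/

lemma exp_neg_le {x : ℝ} (hx : 0 < x) : Real.exp (-x) ≤ 2 * x ^ (-2 : ℝ) := by
  have h := Real.quadratic_le_exp_of_nonneg hx.le
  rw [Real.exp_neg, Real.rpow_neg hx.le]
  have h2 : x ^ (2:ℝ) = x ^ 2 := by norm_cast
  rw [h2]
  have hx2 : 0 < x ^ 2 := by positivity
  rw [inv_eq_one_div, inv_eq_one_div, mul_one_div, div_le_div_iff₀ (Real.exp_pos x) hx2]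
  nlinarith

lemma summable_gauss {c : ℝ} (hc : 0 < c) : Summable (fun x : Eis => Real.exp (-(c * Nm x))) := by
  have h1 := (summable_Nm (s := 2) (by norm_num)).mul_left (2 * c ^ (-2:ℝ))
  refine Summable.of_norm_bounded_eventually h1 ?_
  have : {x : Eis | ¬ ‖Real.exp (-(c * Nm x))‖ ≤ 2 * c ^ (-2:ℝ) * Nm x ^ (-2:ℝ)} ⊆ {0} := by
    intro x hx
    by_contra hx0
    apply hx
    have hx0 : x ≠ 0 := hx0
    have hN := Nm_pos hx0
    rw [Real.norm_eq_abs, abs_of_pos (Real.exp_pos _)]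
    refine (exp_neg_le (mul_pos hc hN)).trans ?_
    rw [Real.mul_rpow hc.le hN.le]; linarith
  exact (Set.finite_singleton 0).subset this

lemma normSq_add_ge (a z : ℂ) : normSq a / 2 - normSq z ≤ normSq (a + z) := by
  simp only [normSq_apply, add_re, add_im]
  nlinarith [sq_nonneg (a.re + 2 * z.re), sq_nonneg (a.im + 2 * z.im)]

lemma summable_gauss_shift {c : ℝ} (hc : 0 < c) (z : ℂ) :
    Summable (fun x : Eis => Real.exp (-(c * normSq ((x : ℂ) + z)))) := by
  refine Summable.of_nonneg_of_le (fun _ => (Real.exp_pos _).le) (fun x => ?_)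
    ((summable_gauss (half_pos hc)).mul_left (Real.exp (c * normSq z)))
  rw [← Real.exp_add]
  apply Real.exp_le_exp.2
  have := normSq_add_ge (x : ℂ) z
  have h2 : Nm x = normSq (x : ℂ) := rfl
  rw [h2]
  nlinarith

lemma theta1 {a : ℝ} (ha : 0 < a) (c : ℝ) :
    ∑' x : ℤ, cexp (-Real.pi * a * ((x : ℂ) + c) ^ 2) =
      1 / (a : ℂ) ^ (1 / 2 : ℂ) * ∑' u : ℤ, cexp (-Real.pi / a * u ^ 2 + 2 * Real.pi * I * u * c) := by
  have h := Complex.tsum_exp_neg_quadratic (a := (a : ℂ)) (by simpa using ha) (-(a * c : ℂ))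
  have ha' : (a : ℂ) ≠ 0 := by exact_mod_cast ha.ne'
  have e1 : ∀ x : ℤ, cexp (-Real.pi * a * ((x : ℂ) + c) ^ 2) =
      cexp (-Real.pi * a * c ^ 2) * cexp (-Real.pi * a * x ^ 2 + 2 * Real.pi * (-(a * c : ℂ)) * x) := by
    intro x; rw [← Complex.exp_add]; congr 1; ring
  have e2 : ∀ u : ℤ, cexp (-Real.pi / a * u ^ 2 + 2 * Real.pi * I * u * c)
      = cexp (-Real.pi * a * c ^ 2) * cexp (-Real.pi / a * (u + I * (-(a * c : ℂ))) ^ 2) := by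
    intro x; rw [← Complex.exp_add]; congr 1
    field_simp
    ring_nf
    rw [I_sq]; ring
  simp_rw [e1, e2]
  rw [tsum_mul_left, tsum_mul_left, h]; ring

lemma theta2 {A : ℝ} (hA : 0 < A) (p q : ℝ) (u : ℤ) :
    ∑' y : ℤ, cexp (-Real.pi * A * ((y : ℂ) + q) ^ 2) * cexp (2 * Real.pi * I * u * (p - (y + q) / 2))
     = 1 / (A : ℂ) ^ (1 / 2 : ℂ) * ∑' v : ℤ, cexp (-Real.pi / A * (v + u / 2) ^ 2 +
        2 * Real.pi * I * (u * p + v * q)) := by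
  have h := Complex.tsum_exp_neg_quadratic (a := (A : ℂ)) (by simpa using hA) (-(A * q : ℂ) - I * u / 2)
  have ha' : (A : ℂ) ≠ 0 := by exact_mod_cast hA.ne'
  have e1 : ∀ y : ℤ, cexp (-Real.pi * A * ((y : ℂ) + q) ^ 2) *
        cexp (2 * Real.pi * I * u * (p - (y + q) / 2)) =
      cexp (-Real.pi * A * q ^ 2 + 2 * Real.pi * I * u * (p - q / 2)) *
      cexp (-Real.pi * A * y ^ 2 + 2 * Real.pi * (-(A * q : ℂ) - I * u / 2) * y) := by
    intro x; rw [← Complex.exp_add, ← Complex.exp_add]; congr 1; ring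
  have e2 : ∀ v : ℤ, cexp (-Real.pi / A * (v + u / 2) ^ 2 + 2 * Real.pi * I * (u * p + v * q))
      = cexp (-Real.pi * A * q ^ 2 + 2 * Real.pi * I * u * (p - q / 2)) *
        cexp (-Real.pi / A * (v + I * (-(A * q : ℂ) - I * u / 2)) ^ 2) := by
    intro x; rw [← Complex.exp_add]; congr 1
    have hI4 : I ^ 4 = 1 := by rw [show I ^ 4 = (I ^ 2) ^ 2 by ring, I_sq]; norm_num
    have hI3 : I ^ 3 = -I := by rw [show I ^ 3 = (I ^ 2) * I by ring, I_sq]; ring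
    field_simp
    ring_nf
    simp only [I_sq, hI4, hI3]; ring
  simp_rw [e1, e2]
  rw [tsum_mul_left, tsum_mul_left, h]; ring

lemma normSq_xy (x y : ℝ) : normSq ((x : ℂ) + y * ωc) = (x - y / 2) ^ 2 + 3 / 4 * y ^ 2 := by
  rw [normSq_apply, ωc_eq]; simp
  have h : Real.sqrt 3 * Real.sqrt 3 = 3 := Real.mul_self_sqrt (by norm_num)
  linear_combination (y ^ 2 / 4) * h

lemma summable_int_gauss {c : ℝ} (hc : 0 < c) (q : ℝ) :
    Summable (fun y : ℤ => Real.exp (-(c * ((y : ℝ) + q) ^ 2))) := by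
  have h := summable_gauss_shift (mul_pos (show (0:ℝ) < 4/3 by norm_num) hc) (q * ωc + q / 2)
  have hinj : Function.Injective (fun y : ℤ => mk 0 (2 * y)) := by
    intro a b hab
    have := (mk_inj.1 hab).2
    omega
  have hinj2 : Function.Injective (fun y : ℤ => mk 0 y) := by
    intro a b hab
    exact (mk_inj.1 hab).2
  refine Summable.of_nonneg_of_le (fun _ => (Real.exp_pos _).le) (fun y => ?_)
    ((summable_gauss_shift hc (q * ωc)).comp_injective hinj2)
  apply Real.exp_le_exp.2
  simp only [Function.comp, coe_mk]
  have e : ((0 : ℤ) : ℂ) + y * ωc + q * ωc = ((0 : ℝ) : ℂ) + ((y + q : ℝ) : ℂ) * ωc := by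
    push_cast; ring
  rw [e, normSq_xy]
  nlinarith [sq_nonneg (y + q : ℝ)]

/-! ### Part 8: Poisson summation for Gaussians on the Eisenstein lattice, final form -/

lemma poisson {a : ℝ} (ha : 0 < a) (z : ℂ) :
    ∑' k : Eis, ((Real.exp (-(Real.pi * a * normSq ((k : ℂ) + z))) : ℝ) : ℂ) =
      ((2 / (a * Real.sqrt 3) : ℝ) : ℂ) *
        ∑' h : Eis, ((Real.exp (-(4 * Real.pi * Nm h / (3 * a))) : ℝ) : ℂ) * eψ ((h : ℂ) * z) := by
  obtain ⟨p, q, rfl⟩ := exists_xy z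
  have hpi := Real.pi_pos
  set A : ℝ := 3 / 4 * a with hA
  have hA0 : 0 < A := by positivity
  have hs1 : Summable (fun xy : ℤ × ℤ =>
      ((Real.exp (-(Real.pi * a * normSq (((eqv xy : Eis) : ℂ) + (p + q * ωc)))) : ℝ) : ℂ)) := by
    have := (summable_gauss_shift (mul_pos hpi ha) (p + q * ωc)).comp_injective eqv.injective
    exact Complex.ofRealCLM.summable this
  rw [← eqv.tsum_eq]
  rw [hs1.tsum_prod, ← Summable.tsum_comm (f := fun (x y : ℤ) =>
      ((Real.exp (-(Real.pi * a * normSq (((eqv (x, y) : Eis) : ℂ) + (p + q * ωc)))) : ℝ) : ℂ)) hs1]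
  have e1 : ∀ x y : ℤ,
      ((Real.exp (-(Real.pi * a * normSq (((eqv (x, y) : Eis) : ℂ) + (p + q * ωc)))) : ℝ) : ℂ)
      = cexp (-Real.pi * A * ((y : ℂ) + q) ^ 2) *
        cexp (-Real.pi * a * ((x : ℂ) + ((p - (y + q) / 2 : ℝ) : ℂ)) ^ 2) := by
    intro x y
    rw [eqv_apply, coe_mk, show ((x : ℂ) + y * ωc + (p + q * ωc)) = ((x + p : ℝ) : ℂ) +
      ((y + q : ℝ) : ℂ) * ωc by push_cast; ring, normSq_xy, ← Complex.exp_add]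
    push_cast
    congr 1
    rw [hA]; push_cast; ring
  have e2 : ∀ y : ℤ, ∑' x : ℤ,
      ((Real.exp (-(Real.pi * a * normSq (((eqv (x, y) : Eis) : ℂ) + (p + q * ωc)))) : ℝ) : ℂ)
      = 1 / (a : ℂ) ^ (1 / 2 : ℂ) * ∑' u : ℤ, cexp (-Real.pi / a * u ^ 2) *
        (cexp (-Real.pi * A * ((y : ℂ) + q) ^ 2) *
          cexp (2 * Real.pi * I * u * (p - (y + q) / 2))) := by
    intro y
    simp_rw [e1]
    rw [tsum_mul_left, theta1 ha, mul_left_comm, ← tsum_mul_left]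
    congr 1
    apply tsum_congr
    intro u
    rw [Complex.exp_add]
    push_cast
    ring
  simp_rw [e2]
  rw [tsum_mul_left]
  have hs2 : Summable (Function.uncurry fun (y u : ℤ) => cexp (-Real.pi / a * u ^ 2) *
        (cexp (-Real.pi * A * ((y : ℂ) + q) ^ 2) *
          cexp (2 * Real.pi * I * u * (p - (y + q) / 2)))) := by
    have h1 := summable_int_gauss (div_pos hpi ha) 0
    have h2 := summable_int_gauss (mul_pos hpi hA0) q
    have h3 := h2.mul_of_nonneg h1 (fun _ => (Real.exp_pos _).le) (fun _ => (Real.exp_pos _).le)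
    refine Summable.of_norm_bounded h3 ?_
    rintro ⟨y, u⟩
    simp only [Function.uncurry]
    rw [norm_mul, norm_mul]
    have n1 : ‖cexp (-Real.pi / a * u ^ 2)‖ = Real.exp (-(Real.pi / a * ((u:ℝ) + 0) ^ 2)) := by
      rw [show (-Real.pi / a * u ^ 2 : ℂ) = ((-(Real.pi / a * ((u:ℝ) + 0) ^ 2) : ℝ) : ℂ) by
        push_cast; ring, ← Complex.ofReal_exp, Complex.norm_real, Real.norm_eq_abs,
        abs_of_pos (Real.exp_pos _)]
    have n2 : ‖cexp (-Real.pi * A * ((y : ℂ) + q) ^ 2)‖ =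
        Real.exp (-(Real.pi * A * ((y:ℝ) + q) ^ 2)) := by
      rw [show (-Real.pi * A * ((y : ℂ) + q) ^ 2 : ℂ) =
        ((-(Real.pi * A * ((y:ℝ) + q) ^ 2) : ℝ) : ℂ) by
        push_cast; ring, ← Complex.ofReal_exp, Complex.norm_real, Real.norm_eq_abs,
        abs_of_pos (Real.exp_pos _)]
    have n3 : ‖cexp (2 * Real.pi * I * u * (p - (y + q) / 2))‖ = 1 := by
      rw [show (2 * Real.pi * I * u * (p - (y + q) / 2) : ℂ) =
        ((2 * Real.pi * u * (p - (y + q) / 2) : ℝ) : ℂ) * I by push_cast; ring]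
      exact Complex.norm_exp_ofReal_mul_I _
    rw [n1, n2, n3, mul_one, mul_comm]
  rw [← Summable.tsum_comm (f := fun (y u : ℤ) => cexp (-Real.pi / a * u ^ 2) *
        (cexp (-Real.pi * A * ((y : ℂ) + q) ^ 2) *
          cexp (2 * Real.pi * I * u * (p - (y + q) / 2)))) hs2]
  simp_rw [tsum_mul_left, theta2 hA0 p q]
  -- right-hand side
  let φ : ℤ × ℤ ≃ ℤ × ℤ := ⟨fun x => (x.1 + x.2, x.1), fun y => (y.2, y.1 - y.2),
    fun x => by simp, fun x => by simp⟩
  rw [← eqv.tsum_eq (fun h : Eis => ((Real.exp (-(4 * Real.pi * Nm h / (3 * a))) : ℝ) : ℂ) *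
    eψ ((h : ℂ) * (p + q * ωc))), ← φ.tsum_eq]
  have hs3 : Summable (fun c : ℤ × ℤ => ((Real.exp (-(4 * Real.pi * Nm (eqv (φ c)) / (3 * a))) : ℝ) : ℂ) *
    eψ (((eqv (φ c) : Eis) : ℂ) * (p + q * ωc))) := by
    have h0 := (summable_gauss (show 0 < 4 * Real.pi / (3 * a) by positivity)).comp_injective
      (eqv.injective.comp φ.injective)
    refine Summable.of_norm_bounded h0 ?_
    intro c
    rw [norm_mul, norm_eψ, mul_one, Complex.norm_real, Real.norm_eq_abs,
        abs_of_pos (Real.exp_pos _)]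
    apply le_of_eq
    simp only [Function.comp]
    congr 1; ring
  rw [hs3.tsum_prod]
  have e3 : ∀ u v : ℤ, ((Real.exp (-(4 * Real.pi * Nm (eqv (φ (u, v))) / (3 * a))) : ℝ) : ℂ) *
      eψ (((eqv (φ (u, v)) : Eis) : ℂ) * (p + q * ωc)) = cexp (-Real.pi / a * u ^ 2) *
      cexp (-Real.pi / A * (v + u / 2) ^ 2 + 2 * Real.pi * I * (u * p + v * q)) := by
    intro u v
    have : φ (u, v) = (u + v, u) := rfl
    rw [this, eqv_apply, Nm_mk, coe_mk]
    have e : (((u + v : ℤ) : ℂ) + u * ωc) * (p + q * ωc) =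
      (((u + v) * p - u * q : ℝ) : ℂ) + ((u * p + v * q : ℝ) : ℂ) * ωc := by
      push_cast
      linear_combination ((u : ℂ) * q) * ωc_sq
    rw [e, eψ_xy, Complex.ofReal_exp, ← Complex.exp_add, ← Complex.exp_add]
    congr 1
    have ha' : (a : ℂ) ≠ 0 := by exact_mod_cast ha.ne'
    rw [hA]
    push_cast
    field_simp
    ring
  simp_rw [e3]
  simp_rw [tsum_mul_left, mul_left_comm _ (1 / (A : ℂ) ^ (1 / 2 : ℂ)), tsum_mul_left]
  rw [← mul_assoc]
  congr 1
  have r1 : (a : ℂ) ^ (1 / 2 : ℂ) = ((Real.sqrt a : ℝ) : ℂ) := by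
    rw [Real.sqrt_eq_rpow, Complex.ofReal_cpow ha.le]; push_cast; rfl
  have r2 : (A : ℂ) ^ (1 / 2 : ℂ) = ((Real.sqrt A : ℝ) : ℂ) := by
    rw [Real.sqrt_eq_rpow, Complex.ofReal_cpow hA0.le]; push_cast; rfl
  rw [r1, r2]
  have r3 : Real.sqrt A = Real.sqrt 3 / 2 * Real.sqrt a := by
    rw [hA, Real.sqrt_mul (by norm_num), Real.sqrt_div (by norm_num),
      show (4:ℝ) = 2 ^ 2 by norm_num, Real.sqrt_sq (by norm_num)]
  rw [r3]
  norm_cast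
  have r4 := Real.mul_self_sqrt ha.le
  have r5 : Real.sqrt a ≠ 0 := by positivity
  have r6 := sqrt3_ne
  field_simp
  nlinarith

set_option linter.style.haveILetI false

/-! ### Part 9: Gauss sums and the twisted theta formula -/

/-- The symbol as a complex number. -/
def Xc (χ : Eis → Eis → Eis) (b a : Eis) : ℂ := ((χ b a : Eis) : ℂ)

section
variable {χ : Eis → Eis → Eis}

lemma Xc_mul_top (hχ : IsCubicSymbol χ) {b : Eis} (hb : Pr b) (a a' : Eis) :
    Xc χ b (a * a') = Xc χ b a * Xc χ b a' := by
  simp [Xc, hχ.mul_top hb]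

lemma Xc_mul_bot (hχ : IsCubicSymbol χ) {b b' : Eis} (hb : Pr b) (hb' : Pr b') (a : Eis) :
    Xc χ (b * b') a = Xc χ b a * Xc χ b' a := by
  simp [Xc, hχ.mul_bot b b' a hb hb']

lemma Xc_norm_le (hχ : IsCubicSymbol χ) {b : Eis} (hb : Pr b) (a : Eis) : ‖Xc χ b a‖ ≤ 1 :=
  (hχ.isVal hb a).norm_le

lemma Xc_recip (hχ : IsCubicSymbol χ) {a b : Eis} (ha : Pr a) (hb : Pr b) :
    Xc χ a b = Xc χ b a := by rw [Xc, Xc, recip hχ ha hb]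

lemma Xc_congr (hχ : IsCubicSymbol χ) {b : Eis} (hb : Pr b) {a a' : Eis} (h : b ∣ a - a') :
    Xc χ b a = Xc χ b a' := by rw [Xc, Xc, hχ.congr_top hb h]

lemma Xc_one_top (hχ : IsCubicSymbol χ) {b : Eis} (hb : Pr b) : Xc χ b 1 = 1 := by
  rw [Xc, hχ.top_one hb]; simp

lemma Xc_one_bot (hχ : IsCubicSymbol χ) (a : Eis) : Xc χ 1 a = 1 := by
  rw [Xc, hχ.one_bot]; simp

lemma Xc_ne_zero_iff (hχ : IsCubicSymbol χ) {b : Eis} (hb : Pr b) (a : Eis) :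
    Xc χ b a ≠ 0 ↔ IsCoprime b a := by
  rw [← hχ.ne_zero_iff hb, Xc]; simp

lemma Xc_norm_eq (hχ : IsCubicSymbol χ) {b : Eis} (hb : Pr b) {a : Eis} (h : IsCoprime b a) :
    ‖Xc χ b a‖ = 1 := (hχ.isVal hb a).norm_eq ((hχ.ne_zero_iff hb a).2 h)

lemma Xc_mul_conj_of (hχ : IsCubicSymbol χ) {b : Eis} (hb : Pr b) {a : Eis} (h : IsCoprime b a) :
    Xc χ b a * (starRingEnd ℂ) (Xc χ b a) = 1 := by
  rw [Complex.mul_conj, Complex.normSq_eq_norm_sq, Xc_norm_eq hχ hb h]; simp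

lemma Xc_eq_zero (hχ : IsCubicSymbol χ) {b : Eis} (hb : Pr b) {a : Eis} (h : ¬ IsCoprime b a) :
    Xc χ b a = 0 := by
  by_contra h2
  exact h ((Xc_ne_zero_iff hχ hb a).1 h2)

lemma Xc_neg (hχ : IsCubicSymbol χ) {b : Eis} (hb : Pr b) (a : Eis) : Xc χ b (-a) = Xc χ b a := by
  rw [← neg_one_mul, Xc_mul_top hχ hb, Xc, hχ.top_neg_one hb]; simp

lemma Xc_sq_bot (hχ : IsCubicSymbol χ) {b : Eis} (hb : Pr b) (a : Eis) :
    Xc χ b a ^ 2 = (starRingEnd ℂ) (Xc χ b a) := by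
  have h := (hχ.isVal hb a).cj_eq_sq
  have h2 := congrArg (Subtype.val) h
  rw [Xc]
  have h3 := coe_cj (χ b a)
  rw [← h3, h]; simp

/-- Sum of a function over residues modulo `n`. -/
def qs (n : Eis) (f : Eis → ℂ) : ℂ := ∑' d : Eis ⧸ Ideal.span {n}, f d.out

lemma out_sub {n : Eis} (a : Eis) :
    n ∣ Quotient.out (Ideal.Quotient.mk (Ideal.span {n}) a) - a := by
  rw [← Ideal.mem_span_singleton, ← Ideal.Quotient.mk_eq_mk_iff_sub_mem, Ideal.Quotient.mk_out]

lemma qs_mul_right (n : Eis) (f : Eis → ℂ) (c : ℂ) : qs n (fun d => f d * c) = qs n f * c := by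
  rw [qs, qs, tsum_mul_right]

/-- Multiplying the residues by something coprime to the modulus. -/
lemma qs_shift {n : Eis} {f : Eis → ℂ} (hf : ∀ a b, n ∣ a - b → f a = f b) {u : Eis}
    (hu : IsCoprime n u) : qs n (fun d => f (u * d)) = qs n f := by
  have hu' : IsUnit (Ideal.Quotient.mk (Ideal.span {n}) u) := isUnit_quot.2 hu
  rw [qs, qs]
  have e := (hu'.unit.mulLeft).tsum_eq (fun d : Eis ⧸ Ideal.span {n} => f d.out)
  rw [← e]
  apply tsum_congr
  intro d
  apply hf
  rw [← Ideal.mem_span_singleton, ← Ideal.Quotient.mk_eq_mk_iff_sub_mem, map_mul,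
    Ideal.Quotient.mk_out, Ideal.Quotient.mk_out]
  rfl

lemma exists_nontriv (hχ : IsCubicSymbol χ) {p : Eis} (hp : Prime p) (hpr : Pr p) :
    ∃ a, ¬ p ∣ a ∧ χ p a ≠ 1 := by
  have := span_prime_max hp
  letI : Field (Eis ⧸ Ideal.span {p}) := Ideal.Quotient.field _
  have := finite_quot hp.ne_zero
  letI : Fintype (Eis ⧸ Ideal.span {p}) := Fintype.ofFinite _
  have hcard : Fintype.card (Eis ⧸ Ideal.span {p}) = NmN p := by
    rw [← card_quot, Nat.card_eq_fintype_card]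
  set k := (NmN p - 1) / 3 with hk
  have hN : NmN p = 3 * k + 1 := by have := hpr.NmN_mod; omega
  have hk0 : 0 < k := by
    rcases Nat.eq_zero_or_pos k with h | h
    · exfalso; apply hp.not_isUnit
      rw [isUnit_iff_Nm, ← NmN_cast, hN, h]; simp
    · exact h
  obtain ⟨x, hx0, hx⟩ := exists_pow_ne_one (F := Eis ⧸ Ideal.span {p}) k hk0 (by rw [hcard, hN])
  obtain ⟨a, rfl⟩ := Ideal.Quotient.mk_surjective x
  refine ⟨a, ?_, ?_⟩
  · intro h; apply hx0; rw [Ideal.Quotient.eq_zero_iff_mem, Ideal.mem_span_singleton]; exact h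
  · intro h
    apply hx
    have := hχ.prime_congr p a hp hpr
    rw [h, ← Ideal.mem_span_singleton, ← Ideal.Quotient.mk_eq_mk_iff_sub_mem] at this
    rw [← map_pow, hk, this, map_one]

/-- The Gauss sum. -/
def GS (χ : Eis → Eis → Eis) (n h : Eis) : ℂ :=
  qs n (fun d => Xc χ n d * eψ ((h * d : ℂ) / n))

lemma GS_coprime (hχ : IsCubicSymbol χ) {n : Eis} (hn : Pr n) {h : Eis} (hh : IsCoprime n h) :
    GS χ n h = (starRingEnd ℂ) (Xc χ n h) * GS χ n 1 := by
  have e : GS χ n 1 = Xc χ n h * GS χ n h := by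
    rw [GS, ← qs_shift (u := h) _ hh, GS, mul_comm, ← qs_mul_right]
    · congr 1; ext d
      rw [Xc_mul_top hχ hn]
      have : (((1 : Eis) : ℂ) * ((h * d : Eis) : ℂ)) = (h : ℂ) * d := by push_cast; ring
      rw [this]; ring
    · intro a b hab
      rw [Xc_congr hχ hn hab, eψ_congr hn.ne_zero 1 hab]
  rw [e, ← mul_assoc, mul_comm ((starRingEnd ℂ) _), Xc_mul_conj_of hχ hn hh, one_mul]

lemma exists_prime_common {n h : Eis} (hn : Pr n) (hh : ¬ IsCoprime n h) :
    ∃ p, Prime p ∧ Pr p ∧ p ∣ n ∧ p ∣ h := by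
  by_contra hcon
  push Not at hcon
  apply hh
  revert hh hcon
  induction hn using Pr.induction with
  | h1 => intro _ _; exact isCoprime_one_left
  | hmul p x hp hpr hx ih =>
    intro _ hcon
    have h1 : IsCoprime p h := prime_coprime hp (hcon p hp hpr (dvd_mul_right _ _))
    have h2 : IsCoprime x h := by
      by_contra h2
      exact h2 (ih h2 (fun q hq hqr hqx => hcon q hq hqr (hqx.mul_left _)))
    exact h1.mul_left h2

lemma GS_not_coprime (hχ : IsCubicSymbol χ) {n : Eis} (hn : Pr n) (hsq : Squarefree n) {h : Eis}
    (hh : ¬ IsCoprime n h) : GS χ n h = 0 := by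
  obtain ⟨p, hp, hpr, ⟨n', rfl⟩, ⟨h', rfl⟩⟩ := exists_prime_common hn hh
  have hn' : Pr n' := hpr.cofactor hn
  have hcop : IsCoprime p n' := by
    apply prime_coprime hp
    rintro ⟨c, rfl⟩
    exact hp.not_isUnit (hsq p ⟨c, by ring⟩)
  obtain ⟨a, ha, hane⟩ := exists_nontriv hχ hp hpr
  obtain ⟨s, t, hst⟩ := hcop
  -- d0 ≡ 1 mod n', ≡ a mod p
  set d0 := s * p + a * (t * n') with hd0
  have h1 : n' ∣ d0 - 1 := ⟨t * (a - 1), by rw [hd0]; linear_combination hst⟩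
  have h2 : p ∣ d0 - a := ⟨s * (1 - a), by rw [hd0]; linear_combination a * hst⟩
  have hX : Xc χ (p * n') d0 = Xc χ p a := by
    rw [Xc_mul_bot hχ hpr hn', Xc_congr hχ hn' h1, Xc_one_top hχ hn', mul_one, Xc_congr hχ hpr h2]
  have hcop2 : IsCoprime (p * n') d0 := by
    rw [← Xc_ne_zero_iff hχ hn, hX, Xc_ne_zero_iff hχ hpr]
    exact prime_coprime hp ha
  have e : GS χ (p * n') (p * h') = Xc χ p a * GS χ (p * n') (p * h') := by
    conv_lhs => rw [GS]
    rw [← qs_shift (u := d0) _ hcop2, GS, mul_comm (Xc χ p a), ← qs_mul_right]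
    · congr 1; ext d
      rw [Xc_mul_top hχ hn, hX]
      obtain ⟨t, ht⟩ := h1
      have hd : d0 = n' * t + 1 := by rw [← ht]; ring
      have : (((p * h' : Eis) : ℂ) * ((d0 * d : Eis) : ℂ)) / ((p * n' : Eis) : ℂ) =
          ((h' * t * d : Eis) : ℂ) + (((p * h' : Eis) : ℂ) * d) / ((p * n' : Eis) : ℂ) := by
        have h0 : (p : ℂ) ≠ 0 := by simpa using hp.ne_zero
        have h0' : (n' : ℂ) ≠ 0 := by simpa using hn'.ne_zero
        rw [hd]; push_cast; field_simp
      rw [this, eψ_add, eψ_eis]; ring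
    · intro a b hab
      rw [Xc_congr hχ hn hab, eψ_congr hn.ne_zero _ hab]
  have hne : Xc χ p a ≠ 1 := by
    intro h; apply hane; apply Subtype.ext; exact h
  have : (1 - Xc χ p a) * GS χ (p * n') (p * h') = 0 := by linear_combination e
  rcases mul_eq_zero.1 this with h | h
  · exact absurd (sub_eq_zero.1 h).symm hne
  · exact h

lemma GS_eval (hχ : IsCubicSymbol χ) {n : Eis} (hn : Pr n) (hsq : Squarefree n) (h : Eis) :
    GS χ n h = (starRingEnd ℂ) (Xc χ n h) * GS χ n 1 := by
  by_cases hh : IsCoprime n h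
  · exact GS_coprime hχ hn hh
  · rw [GS_not_coprime hχ hn hsq hh, Xc_eq_zero hχ hn hh]; simp

lemma GS_conj (hχ : IsCubicSymbol χ) {n : Eis} (hn : Pr n) (hsq : Squarefree n) (h : Eis) :
    qs n (fun d => (starRingEnd ℂ) (Xc χ n d) * eψ ((h * d : ℂ) / n)) =
      Xc χ n h * (starRingEnd ℂ) (GS χ n 1) := by
  have e : qs n (fun d => (starRingEnd ℂ) (Xc χ n d) * eψ ((h * d : ℂ) / n)) =
      (starRingEnd ℂ) (GS χ n (-h)) := by
    rw [GS, qs, qs, Complex.conj_tsum]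
    apply tsum_congr
    intro d
    rw [map_mul, ← eψ_neg]
    congr 2
    push_cast; ring
  rw [e, GS_eval hχ hn hsq, Xc_neg hχ hn]; simp

end

/-! ### Part 10: Parseval, CRT and the theta formula -/
section
variable {χ : Eis → Eis → Eis}

lemma qadd_mul {n : Eis} (hn : n ≠ 0) (x y : Eis) :
    qadd hn 1 (Ideal.Quotient.mk _ x * Ideal.Quotient.mk _ y) = eψ ((x * y : ℂ) / n) := by
  rw [← map_mul, qadd_mk]; congr 1; push_cast; ring

lemma qadd_one_prim {n : Eis} (hn : n ≠ 0) : (qadd hn 1).IsPrimitive := by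
  intro a ha h
  obtain ⟨a, rfl⟩ := Ideal.Quotient.mk_surjective a
  apply ha
  rw [Ideal.Quotient.eq_zero_iff_mem, Ideal.mem_span_singleton, ← qadd_eq_one_iff hn]
  ext d
  obtain ⟨d, rfl⟩ := Ideal.Quotient.mk_surjective d
  have := DFunLike.congr_fun h (Ideal.Quotient.mk _ d)
  rw [AddChar.mulShift_apply, qadd_mul] at this
  rw [qadd_mk, this]

lemma GS_norm (hχ : IsCubicSymbol χ) {n : Eis} (hn : Pr n) (hsq : Squarefree n) :
    ‖GS χ n 1‖ ^ 2 = Nm n := by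
  classical
  have := finite_quot hn.ne_zero
  letI : Fintype (Eis ⧸ Ideal.span {n}) := Fintype.ofFinite _
  have hcard : (Fintype.card (Eis ⧸ Ideal.span {n}) : ℝ) = Nm n := by
    rw [← Nat.card_eq_fintype_card, card_quot, NmN_cast]
  let Q := Eis ⧸ Ideal.span {n}
  let f : Q → ℂ := fun d => Xc χ n d.out
  let ψ : AddChar Q ℂ := qadd hn.ne_zero 1
  have hG : ∀ h : Q, GS χ n h.out = ∑ d : Q, f d * ψ (h * d) := by
    intro h
    rw [GS, qs, tsum_fintype]
    refine Finset.sum_congr rfl fun d _ => ?_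
    have := qadd_mul hn.ne_zero (Quotient.out h) (Quotient.out d)
    rw [Ideal.Quotient.mk_out, Ideal.Quotient.mk_out] at this
    rw [← this]
  have hconj : ∀ x : Q, (starRingEnd ℂ) (ψ x) = ψ (-x) := by
    intro x
    obtain ⟨x, rfl⟩ := Ideal.Quotient.mk_surjective x
    rw [← map_neg, qadd_mk, qadd_mk, ← eψ_neg]
    congr 1; push_cast; ring
  have hP : ∑ h : Q, GS χ n h.out * (starRingEnd ℂ) (GS χ n h.out)
      = (Fintype.card Q : ℂ) * ∑ d : Q, f d * (starRingEnd ℂ) (f d) := by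
    simp_rw [hG, map_sum, map_mul, hconj, Finset.sum_mul_sum]
    rw [Finset.sum_comm]
    rw [Finset.mul_sum]
    refine Finset.sum_congr rfl fun d _ => ?_
    rw [Finset.sum_comm]
    rw [Finset.sum_eq_single d]
    · simp_rw [show ∀ h : Q, f d * ψ (h * d) * ((starRingEnd ℂ) (f d) * ψ (-(h * d)))
        = f d * (starRingEnd ℂ) (f d) by
        intro h
        rw [mul_mul_mul_comm, ← AddChar.map_add_eq_mul, add_neg_cancel, AddChar.map_zero_eq_one,
          mul_one]]
      rw [Finset.sum_const, nsmul_eq_mul]; rfl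
    · intro d' _ hd'
      simp_rw [show ∀ h : Q, f d * ψ (h * d) * ((starRingEnd ℂ) (f d') * ψ (-(h * d')))
        = f d * (starRingEnd ℂ) (f d') * ψ (h * (d - d')) by
        intro h
        rw [mul_mul_mul_comm, ← AddChar.map_add_eq_mul]; congr 2; ring]
      rw [← Finset.mul_sum, AddChar.sum_mulShift _ (qadd_one_prim hn.ne_zero),
        if_neg (sub_ne_zero.2 (Ne.symm hd'))]; simp
    · simp
  have hP2 : ∑ h : Q, GS χ n h.out * (starRingEnd ℂ) (GS χ n h.out)
      = (GS χ n 1 * (starRingEnd ℂ) (GS χ n 1)) * ∑ d : Q, f d * (starRingEnd ℂ) (f d) := by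
    rw [Finset.mul_sum]
    refine Finset.sum_congr rfl fun d _ => ?_
    rw [GS_eval hχ hn hsq, map_mul, Complex.conj_conj]; ring
  have hne : ∑ d : Q, f d * (starRingEnd ℂ) (f d) ≠ 0 := by
    simp_rw [Complex.mul_conj]
    rw [← Complex.ofReal_sum]
    rw [Complex.ofReal_ne_zero]
    apply ne_of_gt
    refine Finset.sum_pos' (fun _ _ => normSq_nonneg _) ⟨1, Finset.mem_univ _, ?_⟩
    rw [normSq_pos]
    have : f 1 = 1 := by
      change Xc χ n _ = 1
      have h1 := out_sub (n := n) 1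
      rw [map_one] at h1
      rw [Xc_congr hχ hn h1, Xc_one_top hχ hn]
    rw [this]; exact one_ne_zero
  have h3 : GS χ n 1 * (starRingEnd ℂ) (GS χ n 1) = (Fintype.card Q : ℂ) := by
    apply mul_right_cancel₀ hne
    rw [← hP2, hP]
  rw [Complex.mul_conj, Complex.normSq_eq_norm_sq] at h3
  rw [← hcard]
  exact_mod_cast h3

/-- Chinese remainder theorem for residue sums. -/
lemma qs_crt {a b : Eis} (ha : a ≠ 0) (hb : b ≠ 0) (hab : IsCoprime a b) {f g : Eis → ℂ}
    {F : Eis → ℂ} (hF : ∀ x y, a * b ∣ x - y → F x = F y)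
    (hfg : ∀ x y, F (x * b + y * a) = f x * g y) :
    qs (a * b) F = qs a f * qs b g := by
  have := finite_quot ha
  have := finite_quot hb
  have := finite_quot (mul_ne_zero ha hb)
  let φ : (Eis ⧸ Ideal.span {a}) × (Eis ⧸ Ideal.span {b}) → Eis ⧸ Ideal.span {a * b} :=
    fun p => Ideal.Quotient.mk _ (p.1.out * b + p.2.out * a)
  have hφ : Function.Bijective φ := by
    constructor
    · rintro ⟨x, y⟩ ⟨x', y'⟩ h
      simp only [φ] at h
      rw [Ideal.Quotient.mk_eq_mk_iff_sub_mem, Ideal.mem_span_singleton] at h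
      have h1 : a ∣ x.out - x'.out := by
        apply hab.dvd_of_dvd_mul_right
        have h2 := (dvd_mul_right a b).trans h
        have e : (x.out - x'.out) * b = (x.out * b + y.out * a - (x'.out * b + y'.out * a))
          - a * (y.out - y'.out) := by ring
        rw [e]; exact dvd_sub h2 (dvd_mul_right _ _)
      have h1' : b ∣ y.out - y'.out := by
        apply hab.symm.dvd_of_dvd_mul_right
        have h2 := (dvd_mul_left b a).trans h
        have e : (y.out - y'.out) * a = (x.out * b + y.out * a - (x'.out * b + y'.out * a))
          - b * (x.out - x'.out) := by ring
        rw [e]; exact dvd_sub h2 (dvd_mul_right _ _)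
      rw [← Ideal.mem_span_singleton, ← Ideal.Quotient.mk_eq_mk_iff_sub_mem, Ideal.Quotient.mk_out,
        Ideal.Quotient.mk_out] at h1 h1'
      rw [h1, h1']
    · intro d
      obtain ⟨d, rfl⟩ := Ideal.Quotient.mk_surjective d
      obtain ⟨u, v, huv⟩ := hab
      refine ⟨(Ideal.Quotient.mk _ (d * v), Ideal.Quotient.mk _ (d * u)), ?_⟩
      simp only [φ]
      rw [Ideal.Quotient.mk_eq_mk_iff_sub_mem, Ideal.mem_span_singleton]
      obtain ⟨s, hs⟩ := out_sub (n := a) (d * v)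
      obtain ⟨t, ht⟩ := out_sub (n := b) (d * u)
      refine ⟨s + t, ?_⟩
      linear_combination b * hs + a * ht + d * huv
  rw [qs, ← (Equiv.ofBijective φ hφ).tsum_eq]
  have e : ∀ p : (Eis ⧸ Ideal.span {a}) × (Eis ⧸ Ideal.span {b}),
      F (Quotient.out (Equiv.ofBijective φ hφ p)) = f p.1.out * g p.2.out := by
    intro p
    rw [← hfg]
    apply hF
    exact out_sub _
  simp_rw [e]
  rw [(Summable.of_finite).tsum_prod]
  simp_rw [tsum_mul_left]
  rw [tsum_mul_right]
  rfl

/-- Poisson summation for a function periodic modulo `n`. -/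
lemma poisson_per {n : Eis} (hn : n ≠ 0) {f : Eis → ℂ} (hf : ∀ a b, n ∣ a - b → f a = f b)
    {M : ℝ} (hM : 0 < M) :
    ∑' m : Eis, ((Real.exp (-(Real.pi * Nm m / M)) : ℝ) : ℂ) * f m =
      ((2 * M / (Nm n * Real.sqrt 3) : ℝ) : ℂ) *
        ∑' h : Eis, ((Real.exp (-(4 * Real.pi * M * Nm h / (3 * Nm n))) : ℝ) : ℂ) *
          qs n (fun d => f d * eψ ((h * d : ℂ) / n)) := by
  classical
  have := finite_quot hn
  letI : Fintype (Eis ⧸ Ideal.span {n}) := Fintype.ofFinite _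
  have hN := Nm_pos hn
  have hpi := Real.pi_pos
  have hn' : (n : ℂ) ≠ 0 := by simpa using hn
  let φ : (Eis ⧸ Ideal.span {n}) × Eis → Eis := fun p => p.1.out + n * p.2
  have hφ : Function.Bijective φ := by
    constructor
    · rintro ⟨x, y⟩ ⟨x', y'⟩ h
      simp only [φ] at h
      have hx : x = x' := by
        rw [← Ideal.Quotient.mk_out x, ← Ideal.Quotient.mk_out x',
          Ideal.Quotient.mk_eq_mk_iff_sub_mem, Ideal.mem_span_singleton]
        exact ⟨y' - y, by linear_combination h⟩
      subst hx
      have := mul_left_cancel₀ hn (add_left_cancel h)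
      rw [this]
    · intro d
      obtain ⟨c, hc⟩ := out_sub (n := n) d
      exact ⟨(Ideal.Quotient.mk _ d, -c), by simp only [φ]; linear_combination hc⟩
  obtain ⟨B, hB⟩ : ∃ B : ℝ, ∀ m, ‖f m‖ ≤ B := by
    refine ⟨∑ d : Eis ⧸ Ideal.span {n}, ‖f d.out‖, fun m => ?_⟩
    rw [hf m _ ((dvd_sub_comm).1 (out_sub (n := n) m))]
    exact Finset.single_le_sum (f := fun d : Eis ⧸ Ideal.span {n} => ‖f d.out‖)
      (fun _ _ => norm_nonneg _) (Finset.mem_univ _)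
  have hs : Summable (fun m : Eis => ((Real.exp (-(Real.pi * Nm m / M)) : ℝ) : ℂ) * f m) := by
    refine Summable.of_norm_bounded ((summable_gauss (div_pos hpi hM)).mul_right B) fun m => ?_
    rw [norm_mul, Complex.norm_real, Real.norm_eq_abs, abs_of_pos (Real.exp_pos _)]
    rw [show Real.pi * Nm m / M = Real.pi / M * Nm m by ring]
    exact mul_le_mul_of_nonneg_left (hB m) (Real.exp_pos _).le
  rw [← (Equiv.ofBijective φ hφ).tsum_eq]
  have hs' := (Equiv.ofBijective φ hφ).summable_iff.2 hs
  rw [Summable.tsum_prod (by exact hs'), tsum_fintype]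
  have e1 : ∀ d : Eis ⧸ Ideal.span {n}, ∑' k : Eis,
      ((Real.exp (-(Real.pi * Nm (Equiv.ofBijective φ hφ (d, k)) / M)) : ℝ) : ℂ) *
        f (Equiv.ofBijective φ hφ (d, k)) =
      ((2 * M / (Nm n * Real.sqrt 3) : ℝ) : ℂ) * ∑' h : Eis,
        ((Real.exp (-(4 * Real.pi * M * Nm h / (3 * Nm n))) : ℝ) : ℂ) *
          (f d.out * eψ ((h * d.out : ℂ) / n)) := by
    intro d
    have e2 : ∀ k : Eis, ((Real.exp (-(Real.pi * Nm (Equiv.ofBijective φ hφ (d, k)) / M)) : ℝ) : ℂ) *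
        f (Equiv.ofBijective φ hφ (d, k)) =
        ((Real.exp (-(Real.pi * (Nm n / M) * normSq ((k : ℂ) + d.out / n))) : ℝ) : ℂ) * f d.out := by
      intro k
      have e3 : (Equiv.ofBijective φ hφ (d, k)) = d.out + n * k := rfl
      rw [e3, hf (d.out + n * k) d.out ⟨k, by ring⟩]
      congr 4
      have : Nm (d.out + n * k) = Nm n * normSq ((k : ℂ) + d.out / n) := by
        rw [Nm, Nm, ← normSq_mul]; congr 1; push_cast; field_simp; ring
      rw [this]; ring
    simp_rw [e2]
    rw [tsum_mul_right, poisson (div_pos hN hM), mul_assoc, ← tsum_mul_right]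
    congr 1
    · congr 1; field_simp
    · apply tsum_congr; intro h
      rw [show 4 * Real.pi * Nm h / (3 * (Nm n / M)) = 4 * Real.pi * M * Nm h / (3 * Nm n) by
        field_simp, mul_div_assoc]
      ring
  simp_rw [e1]
  rw [← Finset.mul_sum]
  congr 1
  simp_rw [qs, tsum_fintype, Finset.mul_sum]
  rw [Summable.tsum_finsetSum]
  intro d _
  have hc : 0 < 4 * Real.pi * M / (3 * Nm n) := by positivity
  refine Summable.of_norm_bounded ((summable_gauss hc).mul_right B) fun h => ?_
  rw [norm_mul, norm_mul, norm_eψ, mul_one, Complex.norm_real, Real.norm_eq_abs,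
    abs_of_pos (Real.exp_pos _)]
  rw [show 4 * Real.pi * M * Nm h / (3 * Nm n) = 4 * Real.pi * M / (3 * Nm n) * Nm h by ring]
  exact mul_le_mul_of_nonneg_left (hB _) (Real.exp_pos _).le

/-- The twisted theta transformation formula. -/
lemma theta_formula (hχ : IsCubicSymbol χ) {a b : Eis} (ha : Pr a) (hb : Pr b)
    (hsa : Squarefree a) (hsb : Squarefree b) (hab : IsCoprime a b) {M : ℝ} (hM : 0 < M) :
    ∑' m : Eis, ((Real.exp (-(Real.pi * Nm m / M)) : ℝ) : ℂ) *
        (Xc χ a m * (starRingEnd ℂ) (Xc χ b m)) =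
      ((2 * M / (Nm (a * b) * Real.sqrt 3) : ℝ) : ℂ) *
        (GS χ a 1 * (starRingEnd ℂ) (GS χ b 1)) *
        ∑' h : Eis, ((Real.exp (-(4 * Real.pi * M * Nm h / (3 * Nm (a * b)))) : ℝ) : ℂ) *
          ((starRingEnd ℂ) (Xc χ a h) * Xc χ b h) := by
  have ha0 : (a : ℂ) ≠ 0 := by simpa using ha.ne_zero
  have hb0 : (b : ℂ) ≠ 0 := by simpa using hb.ne_zero
  rw [poisson_per (mul_ne_zero ha.ne_zero hb.ne_zero) (f := fun m =>
    Xc χ a m * (starRingEnd ℂ) (Xc χ b m)) _ hM]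
  · rw [mul_assoc ((2 * M / (Nm (a * b) * Real.sqrt 3) : ℝ) : ℂ)]
    congr 1
    rw [← tsum_mul_left]
    apply tsum_congr
    intro h
    rw [qs_crt ha.ne_zero hb.ne_zero hab (f := fun x => Xc χ a x * eψ ((h * x : ℂ) / a))
      (g := fun y => (starRingEnd ℂ) (Xc χ b y) * eψ ((h * y : ℂ) / b))]
    · have h1 := GS_eval hχ ha hsa h
      rw [GS] at h1
      rw [h1, GS_conj hχ hb hsb]; ring
    · intro x y hxy
      rw [Xc_congr hχ ha ((dvd_mul_right a b).trans hxy),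
        Xc_congr hχ hb ((dvd_mul_left b a).trans hxy),
        eψ_congr (mul_ne_zero ha.ne_zero hb.ne_zero) h hxy]
    · intro x y
      have h1 : Xc χ a (x * b + y * a) = Xc χ a x * Xc χ a b := by
        rw [← Xc_mul_top hχ ha]; apply Xc_congr hχ ha; exact ⟨y, by ring⟩
      have h2 : Xc χ b (x * b + y * a) = Xc χ b y * Xc χ a b := by
        rw [Xc_recip hχ ha hb, ← Xc_mul_top hχ hb]; apply Xc_congr hχ hb; exact ⟨x, by ring⟩
      have h3 : eψ (((h : ℂ) * ((x * b + y * a : Eis) : ℂ)) / ((a * b : Eis) : ℂ)) =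
          eψ ((h * x : ℂ) / a) * eψ ((h * y : ℂ) / b) := by
        rw [← eψ_add]; congr 1; push_cast; field_simp
      rw [h1, h2, h3, map_mul]
      have h4 := Xc_mul_conj_of hχ ha hab
      linear_combination (Xc χ a x * (starRingEnd ℂ) (Xc χ b y) * eψ ((h * x : ℂ) / a) *
        eψ ((h * y : ℂ) / b)) * h4
  · intro x y hxy
    rw [Xc_congr hχ ha ((dvd_mul_right a b).trans hxy),
        Xc_congr hχ hb ((dvd_mul_left b a).trans hxy)]

end

/-! ### Part 11: squarefree primary elements, divisors, Moebius -/
section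
open Classical in
/-- squarefree primary elements of norm at most `Y` -/
def SF (Y : ℝ) : Finset Eis := (finite_ball Y).toFinset.filter (fun x => Pr x ∧ Squarefree x)

lemma mem_SF {Y : ℝ} {x : Eis} : x ∈ SF Y ↔ Nm x ≤ Y ∧ Pr x ∧ Squarefree x := by
  simp [SF]

open Classical in
/-- primary divisors -/
def Dv (n : Eis) : Finset Eis := (finite_ball (Nm n)).toFinset.filter (fun d => Pr d ∧ d ∣ n)

lemma Nm_dvd_le {d x : Eis} (h : d ∣ x) (hx : x ≠ 0) : Nm d ≤ Nm x := Nm_prime_dvd h hx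

lemma mem_Dv {n d : Eis} (hn : Pr n) : d ∈ Dv n ↔ Pr d ∧ d ∣ n := by
  simp only [Dv, Finset.mem_filter, Set.Finite.mem_toFinset, Set.mem_ofPred_eq, and_iff_right_iff_imp]
  exact fun h => Nm_dvd_le h.2 hn.ne_zero

lemma Dv_one : Dv 1 = {1} := by
  ext d
  rw [mem_Dv Pr_one, Finset.mem_singleton]
  constructor
  · rintro ⟨h1, h2⟩
    exact h1.unit_eq_one (isUnit_of_dvd_one h2)
  · rintro rfl
    exact ⟨Pr_one, dvd_rfl⟩

lemma sum_Dv_mul {E : Type*} [AddCommMonoid E] {p x : Eis} (hp : Prime p) (hpp : Pr p) (hx : Pr x)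
    (hpx : ¬ p ∣ x) (f : Eis → E) :
    ∑ d ∈ Dv (p * x), f d = ∑ d ∈ Dv x, f d + ∑ d ∈ Dv x, f (p * d) := by
  classical
  have hinj : Function.Injective (fun d => p * d) := mul_right_injective₀ hp.ne_zero
  have : Dv (p * x) = Dv x ∪ (Dv x).image (fun d => p * d) := by
    ext d
    simp only [Finset.mem_union, Finset.mem_image, mem_Dv hx, mem_Dv (hpp.mul hx)]
    constructor
    · rintro ⟨h1, h2⟩
      by_cases hpd : p ∣ d
      · right
        obtain ⟨e, rfl⟩ := hpd
        exact ⟨e, ⟨hpp.cofactor h1, (mul_dvd_mul_iff_left hp.ne_zero).1 h2⟩, rfl⟩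
      · left
        exact ⟨h1, ((prime_coprime hp hpd).symm).dvd_of_dvd_mul_left h2⟩
    · rintro (⟨h1, h2⟩ | ⟨e, ⟨h1, h2⟩, rfl⟩)
      · exact ⟨h1, h2.mul_left p⟩
      · exact ⟨hpp.mul h1, mul_dvd_mul_left p h2⟩
  rw [this, Finset.sum_union, Finset.sum_image (fun a _ b _ h => hinj h)]
  rw [Finset.disjoint_left]
  intro d hd hd'
  obtain ⟨e, he, rfl⟩ := Finset.mem_image.1 hd'
  exact hpx ((dvd_mul_right p e).trans ((mem_Dv hx).1 hd).2)

lemma card_Dv_mul {p x : Eis} (hp : Prime p) (hpp : Pr p) (hx : Pr x)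
    (hpx : ¬ p ∣ x) : (Dv (p * x)).card = 2 * (Dv x).card := by
  have := sum_Dv_mul hp hpp hx hpx (fun _ => (1 : ℕ))
  simp only [Finset.sum_const, smul_eq_mul, mul_one] at this
  omega

/-- squarefree induction -/
lemma sf_not_dvd {p x : Eis} (hp : Prime p) (hsq : Squarefree (p * x)) : ¬ p ∣ x := by
  rintro ⟨y, rfl⟩
  exact hp.not_isUnit (hsq p ⟨y, by ring⟩)

lemma sf_right {p x : Eis} (hsq : Squarefree (p * x)) : Squarefree x :=
  hsq.squarefree_of_dvd (dvd_mul_left x p)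

lemma sf_left {p x : Eis} (hsq : Squarefree (p * x)) : Squarefree p :=
  hsq.squarefree_of_dvd (dvd_mul_right p x)

lemma sf_coprime {a b : Eis} (ha : Pr a) (hsq : Squarefree (a * b)) : IsCoprime a b := by
  by_contra h
  obtain ⟨p, hp, -, h1, h2⟩ := exists_prime_common ha h
  exact hp.not_isUnit (hsq p (mul_dvd_mul h1 h2))

lemma sf_mul {a b : Eis} (ha : Squarefree a) (hb : Squarefree b) (h : IsCoprime a b) :
    Squarefree (a * b) := (squarefree_mul_iff).2 ⟨h.isRelPrime, ha, hb⟩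

/-- Moebius function on squarefree primary elements -/
def mob (e : Eis) : ℝ := (-1) ^ (Nat.log 2 (Dv e).card)

lemma one_le_card_Dv {n : Eis} (hn : Pr n) : 1 ≤ (Dv n).card :=
  Finset.card_pos.2 ⟨1, (mem_Dv hn).2 ⟨Pr_one, one_dvd n⟩⟩

lemma abs_mob (e : Eis) : |mob e| = 1 := by simp [mob]

lemma mob_mul {p x : Eis} (hp : Prime p) (hpp : Pr p) (hx : Pr x)
    (hpx : ¬ p ∣ x) : mob (p * x) = - mob x := by
  have := one_le_card_Dv hx
  rw [mob, card_Dv_mul hp hpp hx hpx, mul_comm 2, Nat.log_mul_base (by norm_num) (by omega), pow_succ, mob]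
  ring

lemma sum_mob {g : Eis} (hg : Pr g) (hsq : Squarefree g) :
    ∑ e ∈ Dv g, mob e = if g = 1 then 1 else 0 := by
  induction hg using Pr.induction with
  | h1 => simp [Dv_one, mob]
  | hmul p x hp hpr hx ih =>
    have hpx := sf_not_dvd hp hsq
    rw [sum_Dv_mul hp hpr hx hpx, if_neg, ← Finset.sum_add_distrib]
    · apply Finset.sum_eq_zero
      intro d hd
      obtain ⟨h1, h2⟩ := (mem_Dv hx).1 hd
      rw [mob_mul hp hpr h1 (fun h => hpx (h.trans h2))]; ring
    · intro h
      exact hp.not_isUnit (IsUnit.of_mul_eq_one _ h)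

/-- The Moebius detection of coprimality. -/
lemma sum_mob_coprime {n : Eis} (hn : Pr n) (hsq : Squarefree n) (m : Eis) :
    ∑ d ∈ Dv n, (open Classical in if d ∣ m then mob d else 0) = open Classical in if IsCoprime n m then 1 else 0 := by
  classical
  obtain ⟨g, hg⟩ := IsPrincipalIdealRing.principal (Ideal.span {n, m})
  have hg' : Ideal.span {n, m} = Ideal.span {g} := hg
  have hgx : g ∣ n := by
    rw [← Ideal.mem_span_singleton, ← hg']; exact Ideal.subset_span (by simp)
  obtain ⟨g', hp, hass⟩ := exists_Pr_assoc (fun h => hn.not_lam_dvd (h.trans hgx) : ¬ lam ∣ g)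
  have hg'' : Ideal.span {n, m} = Ideal.span {g'} := by
    rw [hg']; exact Ideal.span_singleton_eq_span_singleton.2 hass
  have hgn : g' ∣ n := by
    rw [← Ideal.mem_span_singleton, ← hg'']; exact Ideal.subset_span (by simp)
  have hgm : g' ∣ m := by
    rw [← Ideal.mem_span_singleton, ← hg'']; exact Ideal.subset_span (by simp)
  have hc : IsCoprime n m ↔ g' = 1 := by
    constructor
    · intro h
      exact hp.unit_eq_one (h.isUnit_of_dvd' hgn hgm)
    · rintro rfl
      have : (1 : Eis) ∈ Ideal.span {n, m} := by rw [hg'']; exact Ideal.mem_span_singleton_self 1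
      obtain ⟨a, b, hab⟩ := Ideal.mem_span_pair.1 this
      exact ⟨a, b, hab⟩
  have hset : (Dv n).filter (fun d => d ∣ m) = Dv g' := by
    ext d
    rw [Finset.mem_filter, mem_Dv hn, mem_Dv hp]
    constructor
    · rintro ⟨⟨h1, h2⟩, h3⟩
      refine ⟨h1, ?_⟩
      have : g' ∈ Ideal.span {n, m} := by rw [hg'']; exact Ideal.mem_span_singleton_self _
      obtain ⟨a, b, hab⟩ := Ideal.mem_span_pair.1 this
      rw [← hab]
      exact dvd_add (h2.mul_left a) (h3.mul_left b)
    · rintro ⟨h1, h2⟩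
      exact ⟨⟨h1, h2.trans hgn⟩, h2.trans hgm⟩
  rw [← Finset.sum_filter, hset, sum_mob hp (hsq.squarefree_of_dvd hgn)]
  simp only [hc]

lemma divisor_bound {ε : ℝ} (hε : 0 < ε) : ∃ C : ℝ, 1 ≤ C ∧ ∀ n : Eis, Pr n → Squarefree n →
    ((Dv n).card : ℝ) ≤ C * Nm n ^ ε := by
  classical
  set B : Finset Eis := (finite_ball ((2:ℝ) ^ (1 / ε))).toFinset with hB
  refine ⟨2 ^ B.card, one_le_pow₀ (by norm_num), ?_⟩
  have key : ∀ n : Eis, Pr n → Squarefree n →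
      ((Dv n).card : ℝ) ≤ 2 ^ (B.filter (fun p => Prime p ∧ p ∣ n)).card * Nm n ^ ε := by
    intro n hn hsq
    induction hn using Pr.induction with
    | h1 => simp only [Dv_one, Finset.card_singleton, Nm_one, Real.one_rpow]
            norm_num
            exact one_le_pow₀ (by norm_num)
    | hmul p x hp hpr hx ih =>
      have hpx := sf_not_dvd hp hsq
      specialize ih (sf_right hsq)
      rw [card_Dv_mul hp hpr hx hpx, Nm_mul, Real.mul_rpow (Nm_nonneg _) (Nm_nonneg _)]
      push_cast
      have hx0 : 0 ≤ Nm x ^ ε := Real.rpow_nonneg (Nm_nonneg _) _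
      have hp1 : 1 ≤ Nm p ^ ε := Real.one_le_rpow (one_le_Nm hp.ne_zero) hε.le
      by_cases hpB : p ∈ B
      · have hlt : (B.filter (fun q => Prime q ∧ q ∣ x)).card + 1 ≤
            (B.filter (fun q => Prime q ∧ q ∣ p * x)).card := by
          apply Finset.card_lt_card
          rw [Finset.ssubset_iff_of_subset]
          · exact ⟨p, by simp [hpB, hp], by simp [hpx]⟩
          · intro q hq
            simp only [Finset.mem_filter] at hq ⊢
            exact ⟨hq.1, hq.2.1, hq.2.2.mul_left p⟩
        calc 2 * ((Dv x).card : ℝ) ≤ 2 * (2 ^ (B.filter (fun q => Prime q ∧ q ∣ x)).card * Nm x ^ ε) := by gcongr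
          _ = 2 ^ ((B.filter (fun q => Prime q ∧ q ∣ x)).card + 1) * (1 * Nm x ^ ε) := by ring
          _ ≤ _ := by gcongr; norm_num
      · have hp2 : 2 ≤ Nm p ^ ε := by
          have : (2:ℝ) ^ (1/ε) < Nm p := by
            by_contra h
            exact hpB (by simpa [hB] using h)
          calc (2:ℝ) = ((2:ℝ) ^ (1/ε)) ^ ε := by rw [← Real.rpow_mul (by norm_num)]; field_simp; simp
            _ ≤ _ := by gcongr
        have hle : (B.filter (fun q => Prime q ∧ q ∣ x)).card ≤
            (B.filter (fun q => Prime q ∧ q ∣ p * x)).card := by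
          apply Finset.card_le_card
          intro q hq
          simp only [Finset.mem_filter] at hq ⊢
          exact ⟨hq.1, hq.2.1, hq.2.2.mul_left p⟩
        calc 2 * ((Dv x).card : ℝ) ≤ 2 * (2 ^ (B.filter (fun q => Prime q ∧ q ∣ x)).card * Nm x ^ ε) := by gcongr
          _ = 2 ^ ((B.filter (fun q => Prime q ∧ q ∣ x)).card) * (2 * Nm x ^ ε) := by ring
          _ ≤ _ := by gcongr; norm_num
  intro n hn hsq
  refine (key n hn hsq).trans ?_
  have hx0 : 0 ≤ Nm n ^ ε := Real.rpow_nonneg (Nm_nonneg _) _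
  gcongr
  · norm_num
  · exact Finset.filter_subset _ _

/-- counting bounds -/
lemma sum_Nm_neg {ε : ℝ} (hε : 0 < ε) : ∃ C : ℝ, 0 < C ∧ ∀ T : Finset Eis,
    ∑ x ∈ T, Nm x ^ (-(1 + ε)) ≤ C := by
  have h := summable_Nm (s := 1 + ε) (by linarith)
  refine ⟨1 + ∑' x : Eis, Nm x ^ (-(1+ε)), ?_, fun T => ?_⟩
  · have : 0 ≤ ∑' x : Eis, Nm x ^ (-(1+ε)) := tsum_nonneg (fun x : Eis => Real.rpow_nonneg (Nm_nonneg x) (-(1+ε)))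
    linarith
  · have := h.sum_le_tsum T (fun x _ => Real.rpow_nonneg (Nm_nonneg x) (-(1+ε)))
    linarith

lemma sum_Nm_pow {ε : ℝ} (hε : 0 < ε) : ∃ C : ℝ, 0 < C ∧ ∀ (s Y : ℝ) (T : Finset Eis), s ≤ 1 + ε →
    (∀ x ∈ T, x ≠ 0 ∧ Nm x ≤ Y) → 0 ≤ Y → ∑ x ∈ T, Nm x ^ (-s) ≤ C * Y ^ (1 + ε - s) := by
  obtain ⟨C, hC, h⟩ := sum_Nm_neg hε
  refine ⟨C, hC, fun s Y T hs hT hY => ?_⟩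
  calc ∑ x ∈ T, Nm x ^ (-s) ≤ ∑ x ∈ T, Nm x ^ (-(1+ε)) * Y ^ (1 + ε - s) := by
        apply Finset.sum_le_sum
        intro x hx
        have hp := Nm_pos (hT x hx).1
        have : Nm x ^ (-s) = Nm x ^ (-(1+ε)) * Nm x ^ (1 + ε - s) := by
          rw [← Real.rpow_add hp]; ring_nf
        rw [this]
        have := (hT x hx).2
        gcongr
    _ ≤ _ := by
        rw [← Finset.sum_mul]
        gcongr
        exact h T

lemma card_le {ε : ℝ} (hε : 0 < ε) : ∃ C : ℝ, 0 < C ∧ ∀ (Y : ℝ) (T : Finset Eis),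
    (∀ x ∈ T, x ≠ 0 ∧ Nm x ≤ Y) → 0 ≤ Y → (T.card : ℝ) ≤ C * Y ^ (1 + ε) := by
  obtain ⟨C, hC, h⟩ := sum_Nm_pow hε
  refine ⟨C, hC, fun Y T hT hY => ?_⟩
  have := h 0 Y T (by linarith) hT hY
  simpa using this

end

/-! ### Part 12: separation of variables and layering -/
section

lemma real_exp_hasSum (x : ℝ) : HasSum (fun n : ℕ => x ^ n / (n.factorial : ℝ)) (Real.exp x) := by
  rw [Real.exp_eq_exp_ℝ]
  exact NormedSpace.expSeries_div_hasSum_exp x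

/-- separation weights -/
def sg (X : ℝ) (i : ℕ × ℕ × ℕ) : ℝ :=
  Real.exp (-X) * (((-X / 81) ^ i.1 / (i.1.factorial : ℝ)) * (((-X / 9) ^ i.2.1 / (i.2.1.factorial : ℝ)) *
    ((-X / 9) ^ i.2.2 / (i.2.2.factorial : ℝ))))

/-- separation majorant -/
def rho (i : ℕ × ℕ × ℕ) : ℝ := (8 / 81) ^ i.1 * ((8 / 9) ^ i.2.1 * (8 / 9) ^ i.2.2)

lemma rho_nonneg (i : ℕ × ℕ × ℕ) : 0 ≤ rho i := by unfold rho; positivity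

lemma summable_rho : Summable rho := by
  have h1 : Summable (fun n : ℕ => ((8:ℝ) / 81) ^ n) := summable_geometric_of_lt_one (by norm_num) (by norm_num)
  have h2 : Summable (fun n : ℕ => ((8:ℝ) / 9) ^ n) := summable_geometric_of_lt_one (by norm_num) (by norm_num)
  exact h1.mul_of_nonneg (h2.mul_of_nonneg h2 (fun n => by positivity) (fun n => by positivity))
    (fun n => by positivity) (fun n => by positivity)

lemma hasSum3 {f g k : ℕ → ℝ} {a b c : ℝ} (hf : HasSum f a) (hg : HasSum g b) (hk : HasSum k c) :
    HasSum (fun i : ℕ × ℕ × ℕ => f i.1 * (g i.2.1 * k i.2.2)) (a * (b * c)) := by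
  have h23 := hg.mul hk (summable_mul_of_summable_norm hg.summable.norm hk.summable.norm)
  exact hf.mul h23 (summable_mul_of_summable_norm hf.summable.norm h23.summable.norm)

lemma sg_alg (X s t : ℝ) (k j l : ℕ) (p q r e : ℝ) :
    e * ((-X / 81) ^ k / p * ((-X / 9) ^ j / q * ((-X / 9) ^ l / r))) * (s ^ (k + j) * t ^ (k + l)) =
    e * ((-X / 81 * (s * t)) ^ k / p * ((-X / 9 * s) ^ j / q * ((-X / 9 * t) ^ l / r))) := by
  rw [mul_pow, mul_pow, mul_pow, mul_pow, pow_add, pow_add]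
  ring

lemma hasSum_sg (X s t : ℝ) :
    HasSum (fun i : ℕ × ℕ × ℕ => sg X i * (s ^ (i.1 + i.2.1) * t ^ (i.1 + i.2.2)))
      (Real.exp (-(X * (1 + s / 9) * (1 + t / 9)))) := by
  have h4 := (hasSum3 (real_exp_hasSum (-X / 81 * (s * t))) (real_exp_hasSum (-X / 9 * s))
    (real_exp_hasSum (-X / 9 * t))).mul_left (Real.exp (-X))
  have e : Real.exp (-(X * (1 + s / 9) * (1 + t / 9))) =
      Real.exp (-X) * (Real.exp (-X / 81 * (s * t)) * (Real.exp (-X / 9 * s) * Real.exp (-X / 9 * t))) := by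
    rw [← Real.exp_add, ← Real.exp_add, ← Real.exp_add]
    congr 1; ring
  rw [e]
  have e2 : (fun i : ℕ × ℕ × ℕ => sg X i * (s ^ (i.1 + i.2.1) * t ^ (i.1 + i.2.2))) = _ :=
    funext fun i => sg_alg X s t i.1 i.2.1 i.2.2 _ _ _ _
  rw [e2]
  exact h4

lemma abs_sg_aux {X : ℝ} (hX : 0 ≤ X) (n : ℕ) {c : ℝ} (hc : 0 < c) :
    |(-X / c) ^ n / (n.factorial : ℝ)| ≤ Real.exp (X / 8) * (8 / c) ^ n := by
  have h := Real.pow_div_factorial_le_exp (x := X / 8) (by positivity) n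
  have : |(-X / c) ^ n / (n.factorial : ℝ)| = ((X / 8) ^ n / n.factorial) * (8 / c) ^ n := by
    rw [abs_div, abs_pow, abs_div, abs_neg, abs_of_nonneg hX, abs_of_pos hc, Nat.abs_cast]
    rw [div_mul_eq_mul_div, ← mul_pow]
    congr 2
    field_simp
  rw [this]
  gcongr

lemma abs_sg {X : ℝ} (hX : 0 ≤ X) (i : ℕ × ℕ × ℕ) : |sg X i| ≤ Real.exp (-X / 2) * rho i := by
  unfold sg rho
  rw [abs_mul, abs_mul, abs_mul, abs_of_pos (Real.exp_pos _)]
  have h1 := abs_sg_aux hX i.1 (c := 81) (by norm_num)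
  have h2 := abs_sg_aux hX i.2.1 (c := 9) (by norm_num)
  have h3 := abs_sg_aux hX i.2.2 (c := 9) (by norm_num)
  calc _ ≤ Real.exp (-X) * ((Real.exp (X / 8) * (8 / 81) ^ i.1) * ((Real.exp (X / 8) * (8 / 9) ^ i.2.1) *
        (Real.exp (X / 8) * (8 / 9) ^ i.2.2))) := by gcongr
    _ = Real.exp (-X + X / 8 + X / 8 + X / 8) * ((8 / 81) ^ i.1 * ((8 / 9) ^ i.2.1 * (8 / 9) ^ i.2.2)) := by
        rw [Real.exp_add, Real.exp_add, Real.exp_add]; ring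
    _ ≤ _ := by
        gcongr
        linarith

lemma bil_sum {ι : Type*} (T : Finset ι) (X : ι → ℝ) (hX : ∀ h, 0 ≤ X h) (A : Finset Eis)
    (α : ι → Eis → ℂ) (v : Eis → ℝ) (B : ℝ) (hB0 : 0 ≤ B)
    (hB : ∀ l : ℕ, ∑ h ∈ T, Real.exp (-X h / 2) * ‖∑ a ∈ A, ((v a ^ l : ℝ) : ℂ) * α h a‖ ^ 2 ≤ B) :
    ∑ h ∈ T, ‖∑ a ∈ A, ∑ b ∈ A, ((Real.exp (-(X h * (1 + v a / 9) * (1 + v b / 9))) : ℝ) : ℂ) *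
      (α h a * (starRingEnd ℂ) (α h b))‖ ≤ (∑' i, rho i) * B := by
  set P : ℕ → ι → ℂ := fun l h => ∑ a ∈ A, ((v a ^ l : ℝ) : ℂ) * α h a with hP
  have hs : ∀ h, HasSum (fun i : ℕ × ℕ × ℕ => (sg (X h) i : ℂ) * (P (i.1 + i.2.1) h * (starRingEnd ℂ) (P (i.1 + i.2.2) h)))
      (∑ a ∈ A, ∑ b ∈ A, ((Real.exp (-(X h * (1 + v a / 9) * (1 + v b / 9))) : ℝ) : ℂ) *
      (α h a * (starRingEnd ℂ) (α h b))) := by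
    intro h
    have : ∀ a ∈ A, ∀ b ∈ A, HasSum (fun i : ℕ × ℕ × ℕ => ((sg (X h) i * (v a ^ (i.1 + i.2.1) * v b ^ (i.1 + i.2.2)) : ℝ) : ℂ) *
        (α h a * (starRingEnd ℂ) (α h b))) (((Real.exp (-(X h * (1 + v a / 9) * (1 + v b / 9))) : ℝ) : ℂ) *
      (α h a * (starRingEnd ℂ) (α h b))) := by
      intro a _ b _
      exact (Complex.hasSum_ofReal.2 (hasSum_sg (X h) (v a) (v b))).mul_right _
    have := hasSum_sum (fun a ha => hasSum_sum (this a ha))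
    convert this using 1
    ext i
    rw [hP]
    simp only [map_sum, Finset.sum_mul, Finset.mul_sum, map_mul, conj_ofReal]
    rw [Finset.sum_comm]
    apply Finset.sum_congr rfl; intro a _
    apply Finset.sum_congr rfl; intro b _
    push_cast
    ring
  have ht := tendsto_finsetSum T (fun h _ => (hs h).norm)
  refine le_of_tendsto ht (Filter.Eventually.of_forall fun I => ?_)
  calc ∑ h ∈ T, ‖∑ i ∈ I, (sg (X h) i : ℂ) * (P (i.1 + i.2.1) h * (starRingEnd ℂ) (P (i.1 + i.2.2) h))‖
      ≤ ∑ h ∈ T, ∑ i ∈ I, rho i * ((Real.exp (-X h / 2) * ‖P (i.1 + i.2.1) h‖ ^ 2 +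
          Real.exp (-X h / 2) * ‖P (i.1 + i.2.2) h‖ ^ 2) / 2) := by
        apply Finset.sum_le_sum; intro h _
        refine (norm_sum_le _ _).trans (Finset.sum_le_sum fun i _ => ?_)
        rw [norm_mul, norm_mul, RCLike.norm_conj, norm_real, Real.norm_eq_abs]
        have h1 := abs_sg (hX h) i
        have h2 : ‖P (i.1 + i.2.1) h‖ * ‖P (i.1 + i.2.2) h‖ ≤ (‖P (i.1 + i.2.1) h‖ ^ 2 + ‖P (i.1 + i.2.2) h‖ ^ 2) / 2 := by
          nlinarith [sq_nonneg (‖P (i.1 + i.2.1) h‖ - ‖P (i.1 + i.2.2) h‖)]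
        have hr := rho_nonneg i
        calc _ ≤ (Real.exp (-X h / 2) * rho i) * ((‖P (i.1 + i.2.1) h‖ ^ 2 + ‖P (i.1 + i.2.2) h‖ ^ 2) / 2) := by
              gcongr
          _ = _ := by ring
    _ = ∑ i ∈ I, rho i * ((∑ h ∈ T, Real.exp (-X h / 2) * ‖P (i.1 + i.2.1) h‖ ^ 2 +
          ∑ h ∈ T, Real.exp (-X h / 2) * ‖P (i.1 + i.2.2) h‖ ^ 2) / 2) := by
        rw [Finset.sum_comm]
        apply Finset.sum_congr rfl; intro i _
        rw [← Finset.mul_sum, ← Finset.sum_div, Finset.sum_add_distrib]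
    _ ≤ ∑ i ∈ I, rho i * B := by
        apply Finset.sum_le_sum; intro i _
        have := rho_nonneg i
        gcongr
        have h1 := hB (i.1 + i.2.1)
        have h2 := hB (i.1 + i.2.2)
        linarith
    _ ≤ _ := by
        rw [← Finset.sum_mul]
        gcongr
        exact summable_rho.sum_le_tsum I (fun i _ => rho_nonneg i)

lemma summable_layer (r : ℕ) : Summable (fun j : ℕ => Real.exp (-(j:ℝ)) * ((j:ℝ) + 1) ^ r) := by
  have h := Real.summable_pow_mul_exp_neg_nat_mul r (r := 1) (by norm_num)
  have h2 := ((summable_nat_add_iff 1).2 h).mul_left (Real.exp 1)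
  refine h2.congr fun j => ?_
  push_cast
  have : Real.exp (-(j:ℝ)) = Real.exp 1 * Real.exp (-1 * ((j:ℝ) + 1)) := by
    rw [← Real.exp_add]; congr 1; ring
  rw [this]; ring

lemma layer (r : ℕ) : ∃ C : ℝ, 0 < C ∧ ∀ (T : Finset Eis) (g : Eis → ℝ) (G : ℝ → ℝ) (K : ℝ), 0 < K →
    (∀ h, 0 ≤ g h) → 0 ≤ G K →
    (∀ Y, 0 < Y → ∑ h ∈ T, (if Nm h ≤ Y then g h else 0) ≤ G Y) →
    (∀ t, 1 ≤ t → G (t * K) ≤ t ^ r * G K) →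
    ∑ h ∈ T, Real.exp (-(Nm h / K)) * g h ≤ C * G K := by
  refine ⟨1 + ∑' j : ℕ, Real.exp (-(j:ℝ)) * ((j:ℝ) + 1) ^ r, ?_, ?_⟩
  · have : 0 ≤ ∑' j : ℕ, Real.exp (-(j:ℝ)) * ((j:ℝ) + 1) ^ r := tsum_nonneg fun j => by positivity
    linarith
  intro T g G K hK hg hGK hG hGt
  obtain ⟨J, hJ⟩ : ∃ J : ℕ, ∀ h ∈ T, ⌊Nm h / K⌋₊ < J := by
    refine ⟨T.sup (fun h => ⌊Nm h / K⌋₊) + 1, fun h hh => ?_⟩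
    have := Finset.le_sup (f := fun h => ⌊Nm h / K⌋₊) hh
    omega
  calc ∑ h ∈ T, Real.exp (-(Nm h / K)) * g h
      ≤ ∑ h ∈ T, ∑ j ∈ Finset.range J, Real.exp (-(j:ℝ)) * (if Nm h ≤ ((j:ℝ) + 1) * K then g h else 0) := by
        apply Finset.sum_le_sum; intro h hh
        have hx : 0 ≤ Nm h / K := div_nonneg (Nm_nonneg h) hK.le
        have hj : (⌊Nm h / K⌋₊ : ℝ) ≤ Nm h / K := Nat.floor_le hx
        have hj' : Nm h / K < ⌊Nm h / K⌋₊ + 1 := Nat.lt_floor_add_one _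
        refine le_trans ?_ (Finset.single_le_sum (f := fun j : ℕ => Real.exp (-(j:ℝ)) * (if Nm h ≤ ((j:ℝ) + 1) * K then g h else 0))
          (fun j _ => ?_) (Finset.mem_range.2 (hJ h hh)))
        · rw [if_pos]
          · have := hg h
            gcongr
          · exact ((div_lt_iff₀ hK).1 hj').le
        · have := hg h
          positivity
    _ = ∑ j ∈ Finset.range J, Real.exp (-(j:ℝ)) * ∑ h ∈ T, (if Nm h ≤ ((j:ℝ) + 1) * K then g h else 0) := by
        rw [Finset.sum_comm]
        simp_rw [Finset.mul_sum]
    _ ≤ ∑ j ∈ Finset.range J, Real.exp (-(j:ℝ)) * ((j:ℝ) + 1) ^ r * G K := by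
        apply Finset.sum_le_sum; intro j _
        rw [mul_assoc]
        gcongr
        exact (hG _ (by positivity)).trans (hGt _ (by linarith [(Nat.cast_nonneg j : (0:ℝ) ≤ j)]))
    _ ≤ _ := by
        rw [← Finset.sum_mul]
        gcongr
        have := (summable_layer r).sum_le_tsum (Finset.range J) (fun i _ => by positivity)
        linarith

end

/-! ### Part 13: the dual sum -/
section
variable {χ : Eis → Eis → Eis}

/-- The hypothesis on sums over all `h`. -/
def H3 (p q : Fin 3 → ℝ) : Prop := ∀ ε : ℝ, 0 < ε → ∃ C : ℝ, 0 < C ∧ ∀ χ, IsCubicSymbol χ →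
  ∀ (Y N : ℝ), 0 < Y → 1 ≤ N → ∀ (c : Eis → ℂ) (T : Finset Eis), (∀ h ∈ T, h ≠ 0 ∧ Nm h ≤ Y) →
  ∑ h ∈ T, ‖∑ n ∈ SF N, c n * Xc χ n h‖ ^ 2 ≤
    C * N ^ ε * (∑ i, Y ^ (p i + ε) * N ^ (q i)) * ∑ n ∈ SF N, ‖c n‖ ^ 2

open Classical in
lemma sum_div_swap (E A : Finset Eis) (F : Eis → Eis → Eis → ℂ) :
    ∑ e ∈ E, ∑ a ∈ A.filter (e ∣ ·), ∑ b ∈ A.filter (e ∣ ·), F e a b =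
      ∑ a ∈ A, ∑ b ∈ A, ∑ e ∈ E.filter (fun e => e ∣ a ∧ e ∣ b), F e a b := by
  rw [Finset.sum_comm' (t' := A) (s' := fun a => E.filter (· ∣ a)) (by
      intro e b
      simp only [Finset.mem_filter]; tauto)]
  apply Finset.sum_congr rfl
  intro a _
  rw [Finset.sum_comm' (t' := A) (s' := fun b => E.filter (fun e => e ∣ a ∧ e ∣ b)) (by
      intro e b
      simp only [Finset.mem_filter]; tauto)]

open Classical in
lemma sum_div_count (E A : Finset Eis) (f : Eis → ℝ) :
    ∑ e ∈ E, ∑ a ∈ A.filter (e ∣ ·), f a = ∑ a ∈ A, ((E.filter (· ∣ a)).card : ℝ) * f a := by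
  rw [Finset.sum_comm' (t' := A) (s' := fun a => E.filter (· ∣ a)) (by
      intro e b
      simp only [Finset.mem_filter]; tauto)]
  apply Finset.sum_congr rfl
  intro a _
  rw [Finset.sum_const, nsmul_eq_mul]

lemma bil_sum_ex : ∃ ρ : ℝ, 0 < ρ ∧ ∀ (T : Finset Eis) (X : Eis → ℝ), (∀ h, 0 ≤ X h) → ∀ (A : Finset Eis)
    (α : Eis → Eis → ℂ) (v : Eis → ℝ) (B : ℝ), 0 ≤ B →
    (∀ l : ℕ, ∑ h ∈ T, Real.exp (-X h / 2) * ‖∑ a ∈ A, ((v a ^ l : ℝ) : ℂ) * α h a‖ ^ 2 ≤ B) →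
    ∑ h ∈ T, ‖∑ a ∈ A, ∑ b ∈ A, ((Real.exp (-(X h * (1 + v a / 9) * (1 + v b / 9))) : ℝ) : ℂ) *
      (α h a * (starRingEnd ℂ) (α h b))‖ ≤ ρ * B := by
  have h0 : 0 ≤ ∑' i, rho i := tsum_nonneg rho_nonneg
  refine ⟨1 + ∑' i, rho i, by linarith, ?_⟩
  intro T X hX A α v B hB0 hB
  refine (bil_sum T X hX A α v B hB0 hB).trans ?_
  nlinarith

set_option maxHeartbeats 1000000 in
open Classical in
lemma main_h {p q : Fin 3 → ℝ} (hp : ∀ i, 0 ≤ p i) (H : H3 p q) {ε : ℝ} (hε : 0 < ε) :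
    ∃ C : ℝ, 0 < C ∧ ∀ χ, IsCubicSymbol χ → ∀ (N M : ℝ), 1 ≤ N → 0 < M → ∀ (A : Finset Eis),
      (∀ a ∈ A, a ∈ SF N ∧ 9 / 10 * N < Nm a) → ∀ (z : Eis → ℂ) (T : Finset Eis), (0 ∉ T) →
      ∑ h ∈ T, ‖∑ a ∈ A, ∑ b ∈ A, if IsCoprime a b then
        ((Real.exp (-(4 * Real.pi * M * Nm h / (3 * Nm (a * b)))) : ℝ) : ℂ) *
          ((z a * (starRingEnd ℂ) (Xc χ a h)) * (starRingEnd ℂ) (z b * (starRingEnd ℂ) (Xc χ b h))) else 0‖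
      ≤ C * N ^ ε * (∑ i, (N ^ 2 / M) ^ (p i + ε) * N ^ (q i)) * ∑ a ∈ A, (Dv a).card * ‖z a‖ ^ 2 := by
  obtain ⟨C₁, hC₁, H1⟩ := H ε hε
  obtain ⟨r, hr⟩ : ∃ r : ℕ, ∀ i, p i + ε ≤ r := by
    obtain ⟨r, hr⟩ := exists_nat_ge (∑ i, p i + ε)
    refine ⟨r, fun i => le_trans ?_ hr⟩
    have := Finset.single_le_sum (f := p) (fun i _ => hp i) (Finset.mem_univ i)
    linarith
  obtain ⟨C₂, hC₂, H2⟩ := layer r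
  obtain ⟨ρ, hρ, HB⟩ := bil_sum_ex
  refine ⟨ρ * (C₂ * C₁), by positivity, ?_⟩
  intro χ hχ N M hN hM A hA z T hT
  have hN0 : 0 < N := by linarith
  set K := N ^ 2 / M with hK
  have hK0 : 0 < K := by positivity
  set X : Eis → ℝ := fun h => 4 * Real.pi * M * Nm h / (3 * N ^ 2) with hX
  have hX0 : ∀ h, 0 ≤ X h := fun h => by have := Nm_nonneg h; positivity
  set v : Eis → ℝ := fun a => 9 * (N / Nm a - 1) with hv
  have hAp : ∀ a ∈ A, 0 < Nm a := fun a ha => Nm_pos ((mem_SF.1 (hA a ha).1).2.1.ne_zero)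
  have hv01 : ∀ a ∈ A, 0 ≤ v a ∧ v a ≤ 1 := by
    intro a ha
    have h1 := hAp a ha
    have h2 := (mem_SF.1 (hA a ha).1).1
    have h3 := (hA a ha).2
    have h4 : 1 ≤ N / Nm a := (one_le_div h1).2 h2
    have h5 : N / Nm a ≤ 10 / 9 := by rw [div_le_iff₀ h1]; linarith
    simp only [hv]
    constructor <;> linarith
  set α : Eis → Eis → ℂ := fun h a => z a * (starRingEnd ℂ) (Xc χ a h) with hα
  set G0 : ℝ := C₁ * N ^ ε * (∑ i, K ^ (p i + ε) * N ^ (q i)) with hG0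
  have hG00 : 0 ≤ G0 := by positivity
  -- bound for each e
  have hBe : ∀ (A' : Finset Eis), A' ⊆ A → ∀ l : ℕ,
      ∑ h ∈ T, Real.exp (-X h / 2) * ‖∑ a ∈ A', ((v a ^ l : ℝ) : ℂ) * α h a‖ ^ 2 ≤
        C₂ * (G0 * ∑ a ∈ A', ‖z a‖ ^ 2) := by
    intro A' hA' l
    set S := ∑ a ∈ A', ‖z a‖ ^ 2 with hS
    have hS0 : 0 ≤ S := by positivity
    refine le_trans ?_ (H2 T (fun h => ‖∑ a ∈ A', ((v a ^ l : ℝ) : ℂ) * α h a‖ ^ 2)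
      (fun Y => C₁ * N ^ ε * (∑ i, Y ^ (p i + ε) * N ^ (q i)) * S) K hK0 (fun h => by positivity) (by positivity) ?_ ?_)
    · apply Finset.sum_le_sum
      intro h _
      gcongr
      have h1 : Nm h / K ≤ X h / 2 := by
        have : X h / 2 = Nm h / K * (2 * Real.pi / 3) := by
          simp only [hX, hK]; field_simp; ring
        rw [this]
        apply le_mul_of_one_le_right (div_nonneg (Nm_nonneg h) hK0.le)
        linarith [Real.pi_gt_three]
      linarith
    · intro Y hY
      set c : Eis → ℂ := fun a => if a ∈ A' then (starRingEnd ℂ) (((v a ^ l : ℝ) : ℂ) * z a) else 0 with hc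
      have hsub : A' ⊆ SF N := fun a ha => (hA a (hA' ha)).1
      have h1 := H1 χ hχ Y N hY hN c (T.filter (fun h => Nm h ≤ Y)) (by
        intro h hh
        rw [Finset.mem_filter] at hh
        exact ⟨fun h0 => hT (h0 ▸ hh.1), hh.2⟩)
      rw [← Finset.sum_filter]
      have e1 : ∀ h, ‖∑ n ∈ SF N, c n * Xc χ n h‖ = ‖∑ a ∈ A', ((v a ^ l : ℝ) : ℂ) * α h a‖ := by
        intro h
        rw [← RCLike.norm_conj (∑ a ∈ A', ((v a ^ l : ℝ) : ℂ) * α h a), map_sum,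
          ← Finset.sum_subset hsub (fun x _ hx => by simp [hc, hx])]
        congr 1
        apply Finset.sum_congr rfl
        intro a ha
        simp only [hc, if_pos ha, hα, map_mul, Complex.conj_conj]
        ring
      simp_rw [e1] at h1
      refine h1.trans ?_
      gcongr
      rw [← Finset.sum_subset hsub (fun x _ hx => by simp [hc, hx]), hS]
      apply Finset.sum_le_sum
      intro a ha
      simp only [hc, if_pos ha]
      rw [RCLike.norm_conj, norm_mul, norm_real, Real.norm_eq_abs, abs_pow, mul_pow]
      obtain ⟨v0, v1⟩ := hv01 a (hA' ha)
      rw [abs_of_nonneg v0]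
      apply mul_le_of_le_one_left (by positivity)
      apply pow_le_one₀ (by positivity)
      exact pow_le_one₀ v0 v1
    · intro t ht
      have : ∑ i, (t * K) ^ (p i + ε) * N ^ (q i) ≤ t ^ r * ∑ i, K ^ (p i + ε) * N ^ (q i) := by
        rw [Finset.mul_sum]
        apply Finset.sum_le_sum
        intro i _
        rw [Real.mul_rpow (by linarith) hK0.le, ← mul_assoc]
        gcongr
        rw [← Real.rpow_natCast]
        exact Real.rpow_le_rpow_of_exponent_le ht (hr i)
      calc C₁ * N ^ ε * (∑ i, (t * K) ^ (p i + ε) * N ^ (q i)) * S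
          ≤ C₁ * N ^ ε * (t ^ r * ∑ i, K ^ (p i + ε) * N ^ (q i)) * S := by gcongr
        _ = _ := by ring
  -- pointwise decomposition
  have hpt : ∀ h, (∑ a ∈ A, ∑ b ∈ A, if IsCoprime a b then
        ((Real.exp (-(4 * Real.pi * M * Nm h / (3 * Nm (a * b)))) : ℝ) : ℂ) *
          ((z a * (starRingEnd ℂ) (Xc χ a h)) * (starRingEnd ℂ) (z b * (starRingEnd ℂ) (Xc χ b h))) else 0)
      = ∑ e ∈ SF N, (mob e : ℂ) * ∑ a ∈ A.filter (e ∣ ·), ∑ b ∈ A.filter (e ∣ ·),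
        ((Real.exp (-(X h * (1 + v a / 9) * (1 + v b / 9))) : ℝ) : ℂ) *
      (α h a * (starRingEnd ℂ) (α h b)) := by
    intro h
    simp_rw [Finset.mul_sum]
    rw [sum_div_swap]
    apply Finset.sum_congr rfl
    intro a ha
    apply Finset.sum_congr rfl
    intro b hb
    rw [← Finset.sum_mul]
    obtain ⟨ha1, ha2, ha3⟩ := mem_SF.1 (hA a ha).1
    have hset : (SF N).filter (fun e => e ∣ a ∧ e ∣ b) = (Dv a).filter (fun e => e ∣ b) := by
      ext e
      simp only [Finset.mem_filter, mem_SF, mem_Dv ha2]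
      constructor
      · rintro ⟨⟨-, h2, -⟩, h4, h5⟩; exact ⟨⟨h2, h4⟩, h5⟩
      · rintro ⟨⟨h2, h4⟩, h5⟩
        exact ⟨⟨(Nm_dvd_le h4 ha2.ne_zero).trans ha1, h2, ha3.squarefree_of_dvd h4⟩, h4, h5⟩
    have hm := sum_mob_coprime ha2 ha3 b
    rw [← Finset.sum_filter] at hm
    rw [hset, ← Complex.ofReal_sum, hm]
    have hXe : X h * (1 + v a / 9) * (1 + v b / 9) = 4 * Real.pi * M * Nm h / (3 * Nm (a * b)) := by
      have h1 := hAp a ha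
      have h2 := hAp b hb
      simp only [hX, hv, Nm_mul]
      field_simp
      ring
    rw [hXe]
    by_cases hcop : IsCoprime a b
    · rw [if_pos hcop, if_pos hcop]; push_cast; ring
    · rw [if_neg hcop, if_neg hcop]; push_cast; ring
  simp_rw [hpt]
  calc ∑ h ∈ T, ‖∑ e ∈ SF N, (mob e : ℂ) * ∑ a ∈ A.filter (e ∣ ·), ∑ b ∈ A.filter (e ∣ ·),
        ((Real.exp (-(X h * (1 + v a / 9) * (1 + v b / 9))) : ℝ) : ℂ) *
      (α h a * (starRingEnd ℂ) (α h b))‖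
      ≤ ∑ h ∈ T, ∑ e ∈ SF N, ‖∑ a ∈ A.filter (e ∣ ·), ∑ b ∈ A.filter (e ∣ ·),
        ((Real.exp (-(X h * (1 + v a / 9) * (1 + v b / 9))) : ℝ) : ℂ) *
      (α h a * (starRingEnd ℂ) (α h b))‖ := by
        apply Finset.sum_le_sum; intro h _
        refine (norm_sum_le _ _).trans (Finset.sum_le_sum fun e _ => ?_)
        rw [norm_mul, norm_real, Real.norm_eq_abs, abs_mob, one_mul]
    _ = ∑ e ∈ SF N, ∑ h ∈ T, ‖∑ a ∈ A.filter (e ∣ ·), ∑ b ∈ A.filter (e ∣ ·),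
        ((Real.exp (-(X h * (1 + v a / 9) * (1 + v b / 9))) : ℝ) : ℂ) *
      (α h a * (starRingEnd ℂ) (α h b))‖ := Finset.sum_comm
    _ ≤ ∑ e ∈ SF N, ρ * (C₂ * (G0 * ∑ a ∈ A.filter (e ∣ ·), ‖z a‖ ^ 2)) := by
        apply Finset.sum_le_sum; intro e _
        exact HB T X hX0 _ α v _ (by positivity) (hBe _ (Finset.filter_subset _ _))
    _ = ρ * (C₂ * (G0 * ∑ a ∈ A, ((SF N).filter (· ∣ a)).card * ‖z a‖ ^ 2)) := by
        rw [← Finset.mul_sum, ← Finset.mul_sum, ← Finset.mul_sum, sum_div_count]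
    _ ≤ ρ * (C₂ * (G0 * ∑ a ∈ A, (Dv a).card * ‖z a‖ ^ 2)) := by
        refine mul_le_mul_of_nonneg_left (mul_le_mul_of_nonneg_left (mul_le_mul_of_nonneg_left
          (Finset.sum_le_sum fun a ha => mul_le_mul_of_nonneg_right ?_ (by positivity)) hG00) hC₂.le) hρ.le
        refine Nat.cast_le.2 (Finset.card_le_card ?_)
        · intro e he
          rw [Finset.mem_filter, mem_SF] at he
          exact (mem_Dv (mem_SF.1 (hA a ha).1).2.1).2 ⟨he.1.2.1, he.2⟩
    _ = _ := by rw [hG0]; ring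

end

/-! ### Part 14: bilinear theta sums -/
section
variable {χ : Eis → Eis → Eis}

lemma summable_XX {κ : ℝ} (hκ : 0 < κ)
    (f g : Eis → ℂ) (hf : ∀ h, ‖f h‖ ≤ 1) (hg : ∀ h, ‖g h‖ ≤ 1) :
    Summable (fun h : Eis => ((Real.exp (-(κ * Nm h)) : ℝ) : ℂ) * (f h * g h)) := by
  refine Summable.of_norm_bounded (summable_gauss hκ) fun h => ?_
  rw [norm_mul, norm_mul, norm_real, Real.norm_eq_abs, abs_of_pos (Real.exp_pos _)]
  apply mul_le_of_le_one_right (Real.exp_pos _).le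
  exact mul_le_one₀ (hf h) (norm_nonneg _) (hg h)

lemma HasSum.congr_aux {ι : Type*} {f g : ι → ℂ} {s : ℂ} (h : HasSum f s) (hfg : ∀ i, g i = f i) : HasSum g s := by
  have : g = f := funext hfg
  rwa [this]

lemma Xc_zero (hχ : IsCubicSymbol χ) {a : Eis} (ha : Pr a) (h1 : a ≠ 1) : Xc χ a 0 = 0 := by
  apply Xc_eq_zero hχ ha
  intro h
  exact h1 (ha.unit_eq_one (isCoprime_zero_right.1 h))

set_option maxHeartbeats 1000000 in
open Classical in
lemma main_theta {p q : Fin 3 → ℝ} (hp : ∀ i, 0 ≤ p i) (H : H3 p q) {ε : ℝ} (hε : 0 < ε) :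
    ∃ C : ℝ, 0 < C ∧ ∀ χ, IsCubicSymbol χ → ∀ (N M : ℝ), 1 ≤ N → 0 < M → ∀ (A : Finset Eis),
      (∀ a ∈ A, a ∈ SF N ∧ 9 / 10 * N < Nm a) → ∀ (y : Eis → ℂ),
      ‖∑ a ∈ A, ∑ b ∈ A, if IsCoprime a b then (y a * (starRingEnd ℂ) (y b)) *
        ∑' m : Eis, ((Real.exp (-(Real.pi * Nm m / M)) : ℝ) : ℂ) *
        (Xc χ a m * (starRingEnd ℂ) (Xc χ b m)) else 0‖
      ≤ C * (M + M / N * N ^ ε * (∑ i, (N ^ 2 / M) ^ (p i + ε) * N ^ (q i))) *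
        ∑ a ∈ A, (Dv a).card * ‖y a‖ ^ 2 := by
  obtain ⟨C₁, hC₁, H1⟩ := main_h hp H hε
  refine ⟨2 * 2 + 2 * (C₁ * (10 / 9)), by positivity, ?_⟩
  intro χ hχ N M hN hM A hA y
  have hN0 : 0 < N := by linarith only [hN]
  have hA' : ∀ a ∈ A, Pr a ∧ Squarefree a ∧ 0 < Nm a := fun a ha =>
    ⟨(mem_SF.1 (hA a ha).1).2.1, (mem_SF.1 (hA a ha).1).2.2, Nm_pos ((mem_SF.1 (hA a ha).1).2.1.ne_zero)⟩
  set z : Eis → ℂ := fun a => y a * GS χ a 1 / (Nm a : ℂ) with hz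
  have hznorm : ∀ a ∈ A, ‖z a‖ ^ 2 = ‖y a‖ ^ 2 / Nm a := by
    intro a ha
    obtain ⟨h1, h2, h3⟩ := hA' a ha
    simp only [hz]
    rw [norm_div, norm_mul, div_pow, mul_pow, GS_norm hχ h1 h2, norm_real, Real.norm_eq_abs, abs_of_pos h3]
    field_simp
  obtain ⟨S, hS⟩ : ∃ S : ℝ, S = ∑ a ∈ A, (Dv a).card * ‖y a‖ ^ 2 := ⟨_, rfl⟩
  have hS0 : 0 ≤ S := by rw [hS]; exact Finset.sum_nonneg fun a _ => mul_nonneg (Nat.cast_nonneg _) (sq_nonneg _)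
  have hcard : ∀ a ∈ A, (1:ℝ) ≤ (Dv a).card := fun a ha => by exact_mod_cast one_le_card_Dv (hA' a ha).1
  obtain ⟨F, hF⟩ : ∃ F, F = N ^ ε * (∑ i, (N ^ 2 / M) ^ (p i + ε) * N ^ (q i)) := ⟨_, rfl⟩
  have hF0 : 0 ≤ F := by rw [hF]; positivity
  have hzS : ∑ a ∈ A, (Dv a).card * ‖z a‖ ^ 2 ≤ (10 / 9) / N * S := by
    rw [hS, Finset.mul_sum]
    refine Finset.sum_le_sum fun a ha => ?_
    rw [hznorm a ha]
    have h1 := (hA a ha).2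
    have h2 := (hA' a ha).2.2
    have : ‖y a‖ ^ 2 / Nm a ≤ (10 / 9) / N * ‖y a‖ ^ 2 := by
      rw [div_le_iff₀ h2]
      have : 1 ≤ 10 / 9 / N * Nm a := by
        rw [div_mul_eq_mul_div, one_le_div hN0]; linarith only [h1]
      nlinarith only [this, sq_nonneg ‖y a‖]
    calc ((Dv a).card : ℝ) * (‖y a‖ ^ 2 / Nm a) ≤ (Dv a).card * ((10 / 9) / N * ‖y a‖ ^ 2) := by gcongr
      _ = _ := by ring
  obtain ⟨κ, hκ⟩ : ∃ κ : ℝ, κ = 2 * M / Real.sqrt 3 := ⟨_, rfl⟩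
  have h3 : 1 ≤ Real.sqrt 3 := Real.one_le_sqrt.2 (by norm_num)
  have hκ0 : 0 ≤ κ := by rw [hκ]; positivity
  have hκ2 : κ ≤ 2 * M := by rw [hκ]; exact div_le_self (by positivity) h3
  set E : Eis → ℂ := fun h => ∑ a ∈ A, ∑ b ∈ A, if IsCoprime a b then
        ((Real.exp (-(4 * Real.pi * M * Nm h / (3 * Nm (a * b)))) : ℝ) : ℂ) *
          ((z a * (starRingEnd ℂ) (Xc χ a h)) * (starRingEnd ℂ) (z b * (starRingEnd ℂ) (Xc χ b h))) else 0 with hE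
  have hsum : HasSum (fun h => (κ : ℂ) * E h) (∑ a ∈ A, ∑ b ∈ A, if IsCoprime a b then (y a * (starRingEnd ℂ) (y b)) *
        ∑' m : Eis, ((Real.exp (-(Real.pi * Nm m / M)) : ℝ) : ℂ) *
        (Xc χ a m * (starRingEnd ℂ) (Xc χ b m)) else 0) := by
    simp only [hE, Finset.mul_sum]
    refine hasSum_sum fun a ha => hasSum_sum fun b hb => ?_
    obtain ⟨a1, a2, a3⟩ := hA' a ha
    obtain ⟨b1, b2, b3⟩ := hA' b hb
    by_cases hab : IsCoprime a b
    · simp only [if_pos hab]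
      rw [theta_formula hχ a1 b1 a2 b2 hab hM]
      have hs : Summable (fun h : Eis => ((Real.exp (-(4 * Real.pi * M * Nm h / (3 * Nm (a * b)))) : ℝ) : ℂ) *
          ((starRingEnd ℂ) (Xc χ a h) * Xc χ b h)) := by
        have := summable_XX (κ := 4 * Real.pi * M / (3 * Nm (a * b)))
          (by rw [Nm_mul]; have := Real.pi_pos; positivity)
          (fun h => (starRingEnd ℂ) (Xc χ a h)) (fun h => Xc χ b h)
          (fun h => by rw [RCLike.norm_conj]; exact Xc_norm_le hχ a1 h) (fun h => Xc_norm_le hχ b1 h)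
        refine this.congr fun h => ?_
        congr 4
        ring
      have := hs.hasSum.mul_left ((y a * (starRingEnd ℂ) (y b)) * ((2 * M / (Nm (a * b) * Real.sqrt 3) : ℝ) : ℂ) *
        (GS χ a 1 * (starRingEnd ℂ) (GS χ b 1)))
      rw [← mul_assoc, ← mul_assoc]
      refine HasSum.congr_aux this fun h => ?_
      simp only [hz, hκ, map_mul, map_div₀, Complex.conj_conj, conj_ofReal, Nm_mul]
      push_cast
      have t1 : (Nm a : ℂ) ≠ 0 := by exact_mod_cast a3.ne'
      have t2 : (Nm b : ℂ) ≠ 0 := by exact_mod_cast b3.ne'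
      have t3 : ((Real.sqrt 3 : ℝ) : ℂ) ≠ 0 := by
        have : Real.sqrt 3 ≠ 0 := by positivity
        exact_mod_cast this
      generalize Complex.exp _ = ex
      field_simp
    · simp only [if_neg hab, mul_zero]
      exact hasSum_zero
  have hE0 : ‖E 0‖ ≤ 2 * S := by
    have : ‖E 0‖ ≤ ∑ a ∈ A, ∑ b ∈ A, if a = b then ‖y a‖ ^ 2 else 0 := by
      refine (norm_sum_le _ _).trans (Finset.sum_le_sum fun a ha => (norm_sum_le _ _).trans
        (Finset.sum_le_sum fun b hb => ?_))
      by_cases ha1 : a = 1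
      · by_cases hb1 : b = 1
        · have hab : a = b := by rw [ha1, hb1]
          rw [if_pos hab, ← hab]
          by_cases hc : IsCoprime a a
          · rw [if_pos hc, norm_mul, norm_mul, RCLike.norm_conj, norm_mul, RCLike.norm_conj, norm_real, Real.norm_eq_abs,
              abs_of_pos (Real.exp_pos _)]
            have hX := Xc_norm_le hχ (hA' a ha).1 0
            have e1 : Real.exp (-(4 * Real.pi * M * Nm 0 / (3 * Nm (a * a)))) = 1 := by simp
            rw [e1, one_mul]
            have hzn := hznorm a ha
            rw [ha1, Nm_one, div_one, ← ha1] at hzn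
            calc ‖z a‖ * ‖Xc χ a 0‖ * (‖z a‖ * ‖Xc χ a 0‖) ≤ ‖z a‖ * 1 * (‖z a‖ * 1) := by gcongr
              _ = ‖y a‖ ^ 2 := by rw [← hzn]; ring
          · rw [if_neg hc, norm_zero]; positivity
        · have : Xc χ b 0 = 0 := Xc_zero hχ (hA' b hb).1 hb1
          rw [this]; simp only [map_zero, mul_zero, ite_self, norm_zero]; positivity
      · have : Xc χ a 0 = 0 := Xc_zero hχ (hA' a ha).1 ha1
        rw [this]; simp only [map_zero, mul_zero, zero_mul, ite_self, norm_zero]; positivity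
    refine this.trans ?_
    have h2 : ∑ a ∈ A, ∑ b ∈ A, (if a = b then ‖y a‖ ^ 2 else 0) ≤ S := by
      rw [hS]
      refine Finset.sum_le_sum fun a ha => ?_
      rw [Finset.sum_ite_eq, if_pos ha]
      exact le_mul_of_one_le_left (by positivity) (hcard a ha)
    linarith only [hS0, h2]
  refine le_of_tendsto hsum.norm (Filter.Eventually.of_forall fun T => ?_)
  have hT := H1 χ hχ N M hN hM A hA z (T.erase 0) (Finset.notMem_erase 0 T)
  have hT' : ∑ h ∈ T.erase 0, ‖E h‖ ≤ C₁ * F * ((10 / 9) / N * S) := by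
    refine hT.trans ?_
    rw [mul_assoc C₁, ← hF]
    exact mul_le_mul_of_nonneg_left hzS (mul_nonneg hC₁.le hF0)
  calc ‖∑ h ∈ T, (κ : ℂ) * E h‖ ≤ ∑ h ∈ T, κ * ‖E h‖ := by
        refine (norm_sum_le _ _).trans (Finset.sum_le_sum fun h _ => ?_)
        rw [norm_mul, norm_real, Real.norm_eq_abs, abs_of_nonneg hκ0]
    _ ≤ ∑ h ∈ insert 0 (T.erase 0), κ * ‖E h‖ := by
        apply Finset.sum_le_sum_of_subset_of_nonneg
        · intro h hh
          by_cases h0 : h = 0 <;> simp [h0, hh]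
        · intros; positivity
    _ = κ * (‖E 0‖ + ∑ h ∈ T.erase 0, ‖E h‖) := by
        rw [Finset.sum_insert (Finset.notMem_erase 0 T), ← Finset.mul_sum]; ring
    _ ≤ (2 * M) * (2 * S + C₁ * F * ((10 / 9) / N * S)) := by gcongr
    _ = 4 * M * S + 2 * (C₁ * (10 / 9)) * (M / N * F) * S := by ring
    _ ≤ (2 * 2 + 2 * (C₁ * (10 / 9))) * (M + M / N * F) * S := by
        have h1 : 0 ≤ 2 * (C₁ * (10 / 9)) * M * S := by positivity
        have h2 : 0 ≤ 4 * (M / N * F) * S := by positivity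
        nlinarith only [h1, h2]
    _ = _ := by rw [hF, hS]; ring

end

/-! ### Part 15: decomposition by greatest common divisors -/
section
variable {χ : Eis → Eis → Eis}

open Classical in
/-- cofactors of `Δ` in `L` -/
def Aset (L : Finset Eis) (N : ℝ) (Δ : Eis) : Finset Eis := (SF N).filter (fun a => Δ * a ∈ L)

lemma mem_Aset {L : Finset Eis} {N : ℝ} {Δ a : Eis} : a ∈ Aset L N Δ ↔ a ∈ SF N ∧ Δ * a ∈ L := by
  simp [Aset]

lemma Nm_le_mul_left {x y : Eis} (hx : x ≠ 0) : Nm y ≤ Nm (x * y) := by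
  rw [Nm_mul]
  exact le_mul_of_one_le_left (Nm_nonneg _) (one_le_Nm hx)

lemma Nm_le_mul_right {x y : Eis} (hy : y ≠ 0) : Nm x ≤ Nm (x * y) := by
  rw [mul_comm]; exact Nm_le_mul_left hy

open Classical in
lemma gcd_decomp {L : Finset Eis} {N : ℝ} (hL : ∀ n ∈ L, n ∈ SF N) (F : Eis → Eis → ℂ) :
    ∑ m ∈ L, ∑ n ∈ L, F m n = ∑ Δ ∈ SF N, ∑ a ∈ Aset L N Δ, ∑ b ∈ Aset L N Δ,
      if IsCoprime a b then F (Δ * a) (Δ * b) else 0 := by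
  have e1 : ∀ Δ ∈ SF N, ∑ a ∈ Aset L N Δ, ∑ b ∈ Aset L N Δ,
      (if IsCoprime a b then F (Δ * a) (Δ * b) else 0) =
      ∑ x ∈ (Aset L N Δ ×ˢ Aset L N Δ).filter (fun x => IsCoprime x.1 x.2), F (Δ * x.1) (Δ * x.2) := by
    intro Δ _
    rw [Finset.sum_filter, Finset.sum_product]
  rw [Finset.sum_congr rfl e1, ← Finset.sum_product', Finset.sum_sigma']
  symm
  refine Finset.sum_bij (fun x _ => (x.1 * x.2.1, x.1 * x.2.2)) ?_ ?_ ?_ ?_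
  · rintro ⟨Δ, a, b⟩ h
    simp only [Finset.mem_sigma, Finset.mem_filter, Finset.mem_product, mem_Aset] at h
    simp only [Finset.mem_product]
    exact ⟨h.2.1.1.2, h.2.1.2.2⟩
  · rintro ⟨Δ, a, b⟩ h ⟨Δ', a', b'⟩ h' heq
    simp only [Finset.mem_sigma, Finset.mem_filter, Finset.mem_product, mem_Aset] at h h'
    simp only [Prod.mk.injEq] at heq
    obtain ⟨h1, h2⟩ := heq
    have hd : Δ = Δ' := by
      apply (mem_SF.1 h.1).2.1.eq_of_assoc (mem_SF.1 h'.1).2.1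
      apply associated_of_dvd_dvd
      · obtain ⟨u, v, huv⟩ := h'.2.2
        refine ⟨u * a + v * b, ?_⟩
        calc Δ' = Δ' * (u * a' + v * b') := by rw [huv, mul_one]
          _ = u * (Δ' * a') + v * (Δ' * b') := by ring
          _ = _ := by rw [← h1, ← h2]; ring
      · obtain ⟨u, v, huv⟩ := h.2.2
        refine ⟨u * a' + v * b', ?_⟩
        calc Δ = Δ * (u * a + v * b) := by rw [huv, mul_one]
          _ = u * (Δ * a) + v * (Δ * b) := by ring
          _ = _ := by rw [h1, h2]; ring
    subst hd
    have h0 := (mem_SF.1 h.1).2.1.ne_zero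
    have ha := mul_left_cancel₀ h0 h1
    have hb := mul_left_cancel₀ h0 h2
    subst ha hb
    rfl
  · rintro ⟨m, n⟩ h
    simp only [Finset.mem_product] at h
    have hm := mem_SF.1 (hL m h.1)
    have hn := mem_SF.1 (hL n h.2)
    obtain ⟨g, a, b, hg, ha, hb, e1, e2, hab⟩ := exists_Pr_gcd hm.2.1 hn.2.1
    subst e1 e2
    refine ⟨⟨g, a, b⟩, ?_, rfl⟩
    simp only [Finset.mem_sigma, Finset.mem_filter, Finset.mem_product, mem_Aset, mem_SF]
    exact ⟨⟨(Nm_le_mul_right ha.ne_zero).trans hm.1, hg, sf_left hm.2.2⟩,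
      ⟨⟨⟨(Nm_le_mul_left hg.ne_zero).trans hm.1, ha, sf_right hm.2.2⟩, h.1⟩,
       ⟨(Nm_le_mul_left hg.ne_zero).trans hn.1, hb, sf_right hn.2.2⟩, h.2⟩, hab⟩
  · rintro ⟨Δ, a, b⟩ h
    rfl

open Classical in
/-- the bilinear theta sum -/
def TH (χ : Eis → Eis → Eis) (A : Finset Eis) (y : Eis → ℂ) (M : ℝ) : ℂ :=
  ∑ a ∈ A, ∑ b ∈ A, if IsCoprime a b then (y a * (starRingEnd ℂ) (y b)) *
        ∑' m : Eis, ((Real.exp (-(Real.pi * Nm m / M)) : ℝ) : ℂ) *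
        (Xc χ a m * (starRingEnd ℂ) (Xc χ b m)) else 0

open Classical in
lemma hasSum_TH (hχ : IsCubicSymbol χ) {A : Finset Eis} (hA : ∀ a ∈ A, Pr a) (c : Eis → ℂ) {M : ℝ} (hM : 0 < M)
    {d : Eis} (hd : d ≠ 0) :
    HasSum (fun m : Eis => if d ∣ m then ∑ a ∈ A, ∑ b ∈ A, if IsCoprime a b then
      (c a * (starRingEnd ℂ) (c b)) * (((Real.exp (-(Real.pi * Nm m / M)) : ℝ) : ℂ) *
        (Xc χ a m * (starRingEnd ℂ) (Xc χ b m))) else 0 else 0)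
      (TH χ A (fun a => c a * Xc χ a d) (M / Nm d)) := by
  have hinj : Function.Injective (fun m : Eis => d * m) := fun _ _ h => mul_left_cancel₀ hd h
  have hNd := Nm_pos hd
  rw [← hinj.hasSum_iff (by
    intro x hx
    rw [if_neg]
    rintro ⟨y, rfl⟩
    exact hx ⟨y, rfl⟩)]
  unfold TH
  simp only [Function.comp_def, dvd_mul_right, if_true]
  refine hasSum_sum fun a ha => hasSum_sum fun b hb => ?_
  have a1 := hA a ha
  have b1 := hA b hb
  by_cases hab : IsCoprime a b
  · simp only [if_pos hab]
    have hs := summable_XX (κ := Real.pi / (M / Nm d)) (by have := Real.pi_pos; positivity)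
      (fun h => Xc χ a h) (fun h => (starRingEnd ℂ) (Xc χ b h))
      (fun h => Xc_norm_le hχ a1 h) (fun h => by rw [RCLike.norm_conj]; exact Xc_norm_le hχ b1 h)
    have e : ∀ m : Eis, Real.pi / (M / Nm d) * Nm m = Real.pi * Nm m / (M / Nm d) := fun m => by ring
    simp only [e] at hs
    refine HasSum.congr_aux (hs.hasSum.mul_left _) fun m => ?_
    rw [Xc_mul_top hχ a1, Xc_mul_top hχ b1, Nm_mul]
    have e2 : Real.pi * (Nm d * Nm m) / M = Real.pi * Nm m / (M / Nm d) := by field_simp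
    rw [e2]
    simp only [map_mul]
    ring
  · simp only [if_neg hab]
    exact hasSum_zero

open Classical in
lemma hasSum_main (hχ : IsCubicSymbol χ) {N M : ℝ} (hM : 0 < M) {L : Finset Eis} (hL : ∀ n ∈ L, n ∈ SF N)
    (c : Eis → ℂ) :
    HasSum (fun m : Eis => ((Real.exp (-(Real.pi * Nm m / M)) * ‖∑ n ∈ L, c n * Xc χ n m‖ ^ 2 : ℝ) : ℂ))
      (∑ Δ ∈ SF N, ∑ d ∈ Dv Δ, (mob d : ℂ) *
        TH χ (Aset L N Δ) (fun a => c (Δ * a) * Xc χ a d) (M / Nm d)) := by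
  have hA : ∀ Δ, ∀ a ∈ Aset L N Δ, Pr a := fun Δ a ha => (mem_SF.1 (mem_Aset.1 ha).1).2.1
  have H : HasSum (fun m : Eis => ∑ Δ ∈ SF N, ∑ d ∈ Dv Δ, (mob d : ℂ) *
      (if d ∣ m then ∑ a ∈ Aset L N Δ, ∑ b ∈ Aset L N Δ, if IsCoprime a b then
      (c (Δ * a) * (starRingEnd ℂ) (c (Δ * b))) * (((Real.exp (-(Real.pi * Nm m / M)) : ℝ) : ℂ) *
        (Xc χ a m * (starRingEnd ℂ) (Xc χ b m))) else 0 else 0))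
      (∑ Δ ∈ SF N, ∑ d ∈ Dv Δ, (mob d : ℂ) *
        TH χ (Aset L N Δ) (fun a => c (Δ * a) * Xc χ a d) (M / Nm d)) := by
    refine hasSum_sum fun Δ hΔ => hasSum_sum fun d hd => HasSum.mul_left _ ?_
    exact hasSum_TH hχ (hA Δ) (fun a => c (Δ * a)) hM ((mem_Dv (mem_SF.1 hΔ).2.1).1 hd).1.ne_zero
  refine HasSum.congr_aux H fun m => ?_
  have e1 : ((‖∑ n ∈ L, c n * Xc χ n m‖ ^ 2 : ℝ) : ℂ) = ∑ n ∈ L, ∑ n' ∈ L,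
      (c n * Xc χ n m) * (starRingEnd ℂ) (c n' * Xc χ n' m) := by
    rw [← Finset.sum_mul_sum, ← map_sum, Complex.mul_conj, Complex.normSq_eq_norm_sq]
  rw [Complex.ofReal_mul, e1, gcd_decomp hL, Finset.mul_sum]
  refine Finset.sum_congr rfl fun Δ hΔ => ?_
  have hΔ' := mem_SF.1 hΔ
  have hmob : ∑ d ∈ Dv Δ, (if d ∣ m then (mob d : ℂ) else 0) = if IsCoprime Δ m then 1 else 0 := by
    have := sum_mob_coprime hΔ'.2.1 hΔ'.2.2 m
    have h2 := congrArg (fun x : ℝ => (x : ℂ)) this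
    simp only [Complex.ofReal_sum, apply_ite (fun x : ℝ => (x : ℂ)), Complex.ofReal_zero, Complex.ofReal_one] at h2
    exact h2
  obtain ⟨B, hB⟩ : ∃ B, B = ∑ a ∈ Aset L N Δ, ∑ b ∈ Aset L N Δ, if IsCoprime a b then
      (c (Δ * a) * (starRingEnd ℂ) (c (Δ * b))) * (((Real.exp (-(Real.pi * Nm m / M)) : ℝ) : ℂ) *
        (Xc χ a m * (starRingEnd ℂ) (Xc χ b m))) else 0 := ⟨_, rfl⟩
  have e2 : ∑ d ∈ Dv Δ, (mob d : ℂ) * (if d ∣ m then B else 0) = (if IsCoprime Δ m then 1 else 0) * B := by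
    rw [← hmob, Finset.sum_mul]
    refine Finset.sum_congr rfl fun d _ => ?_
    split_ifs <;> simp
  rw [← hB, e2, hB, Finset.mul_sum, Finset.mul_sum]
  refine Finset.sum_congr rfl fun a ha => ?_
  rw [Finset.mul_sum, Finset.mul_sum]
  refine Finset.sum_congr rfl fun b hb => ?_
  by_cases hab : IsCoprime a b
  · simp only [if_pos hab]
    rw [Xc_mul_bot hχ hΔ'.2.1 (hA Δ a ha), Xc_mul_bot hχ hΔ'.2.1 (hA Δ b hb)]
    simp only [map_mul]
    by_cases hc : IsCoprime Δ m
    · rw [if_pos hc, one_mul]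
      have := Xc_mul_conj_of hχ hΔ'.2.1 hc
      linear_combination (((Real.exp (-(Real.pi * Nm m / M)) : ℝ) : ℂ) * c (Δ * a) * (starRingEnd ℂ) (c (Δ * b)) * Xc χ a m *
        (starRingEnd ℂ) (Xc χ b m)) * this
    · rw [if_neg hc, Xc_eq_zero hχ hΔ'.2.1 hc]
      simp
  · simp [if_neg hab]

end

/-! ### Part 16: the recursive step -/
section
variable {χ : Eis → Eis → Eis}

lemma rpow_combine {N M p q : ℝ} (hN : 0 < N) (hM : 0 < M) :
    M / N * (N ^ 2 / M) ^ p * N ^ q = M ^ (1 - p) * N ^ (2 * p + q - 1) := by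
  rw [Real.div_rpow (by positivity) hM.le, ← Real.rpow_natCast N 2, ← Real.rpow_mul hN.le,
    Real.rpow_sub hM, Real.rpow_sub hN, Real.rpow_add hN, Real.rpow_one, Real.rpow_one]
  push_cast
  field_simp

lemma rpow_combine2 {N M p q : ℝ} (hN : 0 < N) (hM : 0 < M) :
    M ^ (1 - p) * N ^ (2 * p + q - 1) = (M / N) ^ (1 - p) * N ^ (p + q) := by
  have : 2 * p + q - 1 = (p + q) - (1 - p) := by ring
  rw [Real.div_rpow hM.le hN.le, this, Real.rpow_sub hN]
  field_simp

lemma real_term {p q ε N N' M M' : ℝ} (h1 : 1 ≤ N') (h2 : N' ≤ N) (h3 : N' ≤ M') (h4 : M' ≤ M)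
    (h5 : M / N ≤ M' / N') (hpq1 : 1 ≤ 2 * p + q) (hpq : 0 ≤ p + q) (hε : 0 < ε) :
    M' / N' * ((N' ^ 2 / M') ^ (p + ε) * N' ^ q) ≤ N ^ ε * (M ^ (1 - p) * N ^ (2 * p + q - 1)) := by
  have hN' : 0 < N' := by linarith
  have hN : 0 < N := by linarith
  have hM' : 0 < M' := by linarith
  have hM : 0 < M := by linarith
  have e1 : M' ^ (1 - p) * N' ^ (2 * p + q - 1) ≤ M ^ (1 - p) * N ^ (2 * p + q - 1) := by
    rcases le_or_gt p 1 with hp | hp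
    · have i1 : M' ^ (1 - p) ≤ M ^ (1 - p) := Real.rpow_le_rpow hM'.le h4 (by linarith)
      have i2 : N' ^ (2 * p + q - 1) ≤ N ^ (2 * p + q - 1) := Real.rpow_le_rpow hN'.le h2 (by linarith)
      exact mul_le_mul i1 i2 (by positivity) (by positivity)
    · rw [rpow_combine2 hN' hM', rpow_combine2 hN hM]
      have i1 : (M' / N') ^ (1 - p) ≤ (M / N) ^ (1 - p) :=
        Real.rpow_le_rpow_of_nonpos (by positivity) h5 (by linarith)
      have i2 : N' ^ (p + q) ≤ N ^ (p + q) := Real.rpow_le_rpow hN'.le h2 hpq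
      exact mul_le_mul i1 i2 (by positivity) (by positivity)
  have e2 : (N' ^ 2 / M') ^ ε ≤ N ^ ε := by
    apply Real.rpow_le_rpow (by positivity) _ hε.le
    rw [div_le_iff₀ hM']
    nlinarith
  rw [Real.rpow_add (by positivity)]
  calc M' / N' * ((N' ^ 2 / M') ^ p * (N' ^ 2 / M') ^ ε * N' ^ q)
      = (N' ^ 2 / M') ^ ε * (M' / N' * (N' ^ 2 / M') ^ p * N' ^ q) := by ring
    _ = (N' ^ 2 / M') ^ ε * (M' ^ (1 - p) * N' ^ (2 * p + q - 1)) := by rw [rpow_combine hN' hM']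
    _ ≤ _ := mul_le_mul e2 e1 (by positivity) (by positivity)

lemma real_sum {p q : Fin 3 → ℝ} {ε N N' M M' : ℝ} (h1 : 1 ≤ N') (h2 : N' ≤ N) (h3 : N' ≤ M') (h4 : M' ≤ M)
    (h5 : M / N ≤ M' / N') (hpq1 : ∀ i, 1 ≤ 2 * p i + q i) (hpq : ∀ i, 0 ≤ p i + q i) (hε : 0 < ε) :
    M' + M' / N' * N' ^ ε * (∑ i, (N' ^ 2 / M') ^ (p i + ε) * N' ^ (q i)) ≤
      N ^ (2 * ε) * (M + ∑ i, M ^ (1 - p i) * N ^ (2 * p i + q i - 1)) := by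
  have hN' : 0 < N' := by linarith
  have hN : 0 < N := by linarith
  have hM' : 0 < M' := by linarith
  have hM : 0 < M := by linarith
  rw [mul_add, Finset.mul_sum, Finset.mul_sum]
  refine add_le_add ?_ (Finset.sum_le_sum fun i _ => ?_)
  · have : 1 ≤ N ^ (2 * ε) := Real.one_le_rpow (by linarith) (by linarith)
    nlinarith
  · have i1 := real_term h1 h2 h3 h4 h5 (hpq1 i) (hpq i) hε
    have i2 : N' ^ ε ≤ N ^ ε := Real.rpow_le_rpow hN'.le h2 hε.le
    calc M' / N' * N' ^ ε * ((N' ^ 2 / M') ^ (p i + ε) * N' ^ (q i))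
        = N' ^ ε * (M' / N' * ((N' ^ 2 / M') ^ (p i + ε) * N' ^ (q i))) := by ring
      _ ≤ N ^ ε * (N ^ ε * (M ^ (1 - p i) * N ^ (2 * p i + q i - 1))) :=
          mul_le_mul i2 i1 (by positivity) (by positivity)
      _ = _ := by rw [two_mul ε, Real.rpow_add hN]; ring

open Classical in
lemma sum_Aset_le {L : Finset Eis} {N : ℝ} (hL : ∀ n ∈ L, n ∈ SF N) {g : Eis → ℝ} (hg : ∀ n, 0 ≤ g n) :
    ∑ Δ ∈ SF N, ∑ a ∈ Aset L N Δ, g (Δ * a) ≤ ∑ n ∈ L, (Dv n).card * g n := by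
  calc ∑ Δ ∈ SF N, ∑ a ∈ Aset L N Δ, g (Δ * a) ≤ ∑ Δ ∈ SF N, ∑ n ∈ L.filter (Δ ∣ ·), g n := by
        refine Finset.sum_le_sum fun Δ hΔ => ?_
        have h0 := (mem_SF.1 hΔ).2.1.ne_zero
        rw [← Finset.sum_image (f := g) (s := Aset L N Δ) (g := fun a => Δ * a)
          (fun x _ y _ h => mul_left_cancel₀ h0 h)]
        refine Finset.sum_le_sum_of_subset_of_nonneg ?_ (fun _ _ _ => hg _)
        intro n hn
        obtain ⟨a, ha, rfl⟩ := Finset.mem_image.1 hn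
        exact Finset.mem_filter.2 ⟨(mem_Aset.1 ha).2, dvd_mul_right _ _⟩
    _ = ∑ n ∈ L, (((SF N).filter (· ∣ n)).card : ℝ) * g n := sum_div_count _ _ _
    _ ≤ _ := by
        refine Finset.sum_le_sum fun n hn => mul_le_mul_of_nonneg_right ?_ (hg n)
        refine Nat.cast_le.2 (Finset.card_le_card ?_)
        intro e he
        rw [Finset.mem_filter, mem_SF] at he
        exact (mem_Dv (mem_SF.1 (hL n hn)).2.1).2 ⟨he.1.2.1, he.2⟩

/-- the localised recursive step -/
lemma local_step {p q : Fin 3 → ℝ} (hp : ∀ i, 0 ≤ p i) (hpq1 : ∀ i, 1 ≤ 2 * p i + q i)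
    (hpq : ∀ i, 0 ≤ p i + q i) (H : H3 p q) {ε : ℝ} (hε : 0 < ε) :
    ∃ C : ℝ, 0 < C ∧ ∀ χ, IsCubicSymbol χ → ∀ (N M : ℝ), 1 ≤ N → N ≤ M → ∀ (L : Finset Eis),
      (∀ a ∈ L, a ∈ SF N ∧ 9 / 10 * N < Nm a) → ∀ (c : Eis → ℂ) (T : Finset Eis), (∀ m ∈ T, Nm m ≤ M) →
      ∑ m ∈ T, ‖∑ n ∈ L, c n * Xc χ n m‖ ^ 2
      ≤ C * N ^ ε * (M + ∑ i, M ^ (1 - p i) * N ^ (2 * p i + q i - 1)) * ∑ n ∈ L, ‖c n‖ ^ 2 := by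
  obtain ⟨C₁, hC₁, H1⟩ := main_theta hp H (ε := ε / 5) (by positivity)
  obtain ⟨C₂, hC₂, H2⟩ := divisor_bound (ε := ε / 5) (by positivity)
  refine ⟨Real.exp Real.pi * (C₁ * C₂ ^ 3), by have := Real.exp_pos Real.pi; positivity, ?_⟩
  intro χ hχ N M hN hNM L hL c T hT
  have hN0 : 0 < N := by linarith only [hN]
  have hM0 : 0 < M := by linarith only [hN, hNM]
  have hL' : ∀ n ∈ L, n ∈ SF N := fun n hn => (hL n hn).1
  obtain ⟨G, hG⟩ : ∃ G, G = M + ∑ i, M ^ (1 - p i) * N ^ (2 * p i + q i - 1) := ⟨_, rfl⟩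
  have hG0 : 0 ≤ G := by rw [hG]; positivity
  have hdiv : ∀ n ∈ SF N, ((Dv n).card : ℝ) ≤ C₂ * N ^ (ε / 5) := by
    intro n hn
    obtain ⟨h1, h2, h3⟩ := mem_SF.1 hn
    refine (H2 n h2 h3).trans (mul_le_mul_of_nonneg_left ?_ (by linarith only [hC₂]))
    exact Real.rpow_le_rpow (Nm_nonneg _) h1 (by positivity)
  obtain ⟨K, hK⟩ : ∃ K, K = C₂ * N ^ (ε / 5) := ⟨_, rfl⟩
  have hK0 : 0 ≤ K := by rw [hK]; positivity
  rw [← hK] at hdiv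
  obtain ⟨S, hS⟩ : ∃ S, S = ∑ n ∈ L, ‖c n‖ ^ 2 := ⟨_, rfl⟩
  have hmain := hasSum_main (χ := χ) hχ hM0 hL' c
  -- bound for a single theta sum
  have hTH : ∀ Δ ∈ SF N, ∀ d ∈ Dv Δ, ‖TH χ (Aset L N Δ) (fun a => c (Δ * a) * Xc χ a d) (M / Nm d)‖ ≤
      C₁ * (N ^ (2 * (ε / 5)) * G) * (K * ∑ a ∈ Aset L N Δ, ‖c (Δ * a)‖ ^ 2) := by
    intro Δ hΔ d hd
    obtain ⟨hΔ1, hΔ2, hΔ3⟩ := mem_SF.1 hΔ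
    obtain ⟨hd1, hd2⟩ := (mem_Dv hΔ2).1 hd
    rcases (Aset L N Δ).eq_empty_or_nonempty with he | ⟨a0, ha0⟩
    · simp [TH, he]
    have hNd := Nm_pos hd1.ne_zero
    have hNd1 := one_le_Nm hd1.ne_zero
    have hNΔ := Nm_pos hΔ2.ne_zero
    have hNΔ1 := one_le_Nm hΔ2.ne_zero
    have hdΔ := Nm_dvd_le hd2 hΔ2.ne_zero
    have hloc : ∀ a ∈ Aset L N Δ, a ∈ SF (N / Nm Δ) ∧ 9 / 10 * (N / Nm Δ) < Nm a := by
      intro a ha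
      obtain ⟨h1, h2⟩ := mem_Aset.1 ha
      have h3 := mem_SF.1 h1
      obtain ⟨h4, h5⟩ := hL _ h2
      have h6 := (mem_SF.1 h4).1
      rw [Nm_mul] at h5 h6
      refine ⟨mem_SF.2 ⟨?_, h3.2⟩, ?_⟩
      · rw [le_div_iff₀ hNΔ]; linarith only [h6]
      · rw [← mul_div_assoc, div_lt_iff₀ hNΔ]; linarith only [h5]
    have hN'1 : 1 ≤ N / Nm Δ :=
      (one_le_Nm (mem_SF.1 (hloc a0 ha0).1).2.1.ne_zero).trans (mem_SF.1 (hloc a0 ha0).1).1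
    have h1 := H1 χ hχ (N / Nm Δ) (M / Nm d) hN'1 (by positivity) (Aset L N Δ) hloc
      (fun a => c (Δ * a) * Xc χ a d)
    have hr := real_sum (p := p) (q := q) (ε := ε / 5) (N := N) (N' := N / Nm Δ) (M := M) (M' := M / Nm d) hN'1
      (div_le_self hN0.le hNΔ1)
      (div_le_div₀ hM0.le hNM hNd hdΔ) (div_le_self hM0.le hNd1) (by
        rw [div_div_div_eq]
        rw [div_le_div_iff₀ hN0 (by positivity)]
        have : M * N * Nm d ≤ M * N * Nm Δ := mul_le_mul_of_nonneg_left hdΔ (by positivity)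
        linarith only [this]) hpq1 hpq (by positivity)
    rw [← hG] at hr
    have hs : ∑ a ∈ Aset L N Δ, ((Dv a).card : ℝ) * ‖c (Δ * a) * Xc χ a d‖ ^ 2 ≤
        K * ∑ a ∈ Aset L N Δ, ‖c (Δ * a)‖ ^ 2 := by
      rw [Finset.mul_sum]
      refine Finset.sum_le_sum fun a ha => ?_
      have i1 := hdiv a (mem_Aset.1 ha).1
      have i2 : ‖c (Δ * a) * Xc χ a d‖ ^ 2 ≤ ‖c (Δ * a)‖ ^ 2 := by
        rw [norm_mul]
        refine pow_le_pow_left₀ (by positivity) (mul_le_of_le_one_right (norm_nonneg _) ?_) 2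
        exact Xc_norm_le hχ (mem_SF.1 (mem_Aset.1 ha).1).2.1 d
      exact mul_le_mul i1 i2 (sq_nonneg _) hK0
    refine h1.trans (mul_le_mul (mul_le_mul_of_nonneg_left hr hC₁.le) hs
      (Finset.sum_nonneg fun a _ => mul_nonneg (Nat.cast_nonneg _) (sq_nonneg _)) ?_)
    exact mul_nonneg hC₁.le (mul_nonneg (Real.rpow_nonneg hN0.le _) hG0)
  have hX0 : 0 ≤ C₁ * (N ^ (2 * (ε / 5)) * G) * K :=
    mul_nonneg (mul_nonneg hC₁.le (mul_nonneg (Real.rpow_nonneg hN0.le _) hG0)) hK0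
  have htot : ‖∑ Δ ∈ SF N, ∑ d ∈ Dv Δ, (mob d : ℂ) *
        TH χ (Aset L N Δ) (fun a => c (Δ * a) * Xc χ a d) (M / Nm d)‖ ≤
      C₁ * (N ^ (2 * (ε / 5)) * G) * K * (K * (K * S)) := by
    calc _ ≤ ∑ Δ ∈ SF N, C₁ * (N ^ (2 * (ε / 5)) * G) * K * (K * ∑ a ∈ Aset L N Δ, ‖c (Δ * a)‖ ^ 2) := by
          refine (norm_sum_le _ _).trans (Finset.sum_le_sum fun Δ hΔ => ?_)
          have : ∀ d ∈ Dv Δ, ‖(mob d : ℂ) * TH χ (Aset L N Δ) (fun a => c (Δ * a) * Xc χ a d) (M / Nm d)‖ ≤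
              C₁ * (N ^ (2 * (ε / 5)) * G) * (K * ∑ a ∈ Aset L N Δ, ‖c (Δ * a)‖ ^ 2) := by
            intro d hd
            rw [norm_mul, norm_real, Real.norm_eq_abs, abs_mob, one_mul]
            exact hTH Δ hΔ d hd
          refine (norm_sum_le _ _).trans ((Finset.sum_le_sum this).trans ?_)
          rw [Finset.sum_const, nsmul_eq_mul]
          have hs0 : 0 ≤ ∑ a ∈ Aset L N Δ, ‖c (Δ * a)‖ ^ 2 := Finset.sum_nonneg fun _ _ => sq_nonneg _
          have := mul_le_mul_of_nonneg_right (hdiv Δ hΔ) (mul_nonneg hX0 hs0)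
          linarith only [this]
      _ = C₁ * (N ^ (2 * (ε / 5)) * G) * K * (K * ∑ Δ ∈ SF N, ∑ a ∈ Aset L N Δ, ‖c (Δ * a)‖ ^ 2) := by
          rw [← Finset.mul_sum, ← Finset.mul_sum]
      _ ≤ _ := by
          refine mul_le_mul_of_nonneg_left (mul_le_mul_of_nonneg_left ?_ hK0) hX0
          refine (sum_Aset_le hL' (g := fun n => ‖c n‖ ^ 2) fun n => sq_nonneg _).trans ?_
          rw [hS, Finset.mul_sum]
          exact Finset.sum_le_sum fun n hn => mul_le_mul_of_nonneg_right (hdiv n (hL' n hn)) (sq_nonneg _)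
  have hTle : ∑ m ∈ T, Real.exp (-(Real.pi * Nm m / M)) * ‖∑ n ∈ L, c n * Xc χ n m‖ ^ 2 ≤
      C₁ * (N ^ (2 * (ε / 5)) * G) * K * (K * (K * S)) := by
    have hre := (Complex.hasSum_re hmain)
    simp only [Complex.ofReal_re] at hre
    refine (sum_le_hasSum T (fun m _ => ?_) hre).trans ((Complex.re_le_norm _).trans htot)
    exact mul_nonneg (Real.exp_pos _).le (sq_nonneg _)
  have hW : ∀ m ∈ T, ‖∑ n ∈ L, c n * Xc χ n m‖ ^ 2 ≤
      Real.exp Real.pi * (Real.exp (-(Real.pi * Nm m / M)) * ‖∑ n ∈ L, c n * Xc χ n m‖ ^ 2) := by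
    intro m hm
    rw [← mul_assoc, ← Real.exp_add]
    refine le_mul_of_one_le_left (sq_nonneg _) (Real.one_le_exp ?_)
    have : Nm m / M ≤ 1 := (div_le_one hM0).2 (hT m hm)
    have h2 : Real.pi * Nm m / M ≤ Real.pi := by
      rw [mul_div_assoc]; exact mul_le_of_le_one_right Real.pi_pos.le this
    linarith only [h2]
  refine (Finset.sum_le_sum hW).trans ?_
  rw [← Finset.mul_sum]
  refine (mul_le_mul_of_nonneg_left hTle (Real.exp_pos _).le).trans (le_of_eq ?_)
  have e5 : N ^ ε = N ^ (2 * (ε / 5)) * N ^ (ε / 5) * N ^ (ε / 5) * N ^ (ε / 5) := by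
    rw [← Real.rpow_add hN0, ← Real.rpow_add hN0, ← Real.rpow_add hN0]; congr 1; ring
  rw [e5, ← hG, ← hS, hK]
  ring

end

/-! ### Part 17: removing the localisation -/
section
variable {χ : Eis → Eis → Eis}

lemma ranges {ε : ℝ} (hε : 0 < ε) : ∃ C : ℝ, 0 < C ∧ ∀ N : ℝ, 1 ≤ N → ∃ K : ℕ, (K : ℝ) ≤ C * N ^ ε ∧
    ∀ x : ℝ, 1 ≤ x → x ≤ N → ∃ i < K, 9 / 10 * (N / (10 / 9) ^ i) < x ∧ x ≤ N / (10 / 9) ^ i := by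
  have hl : 0 < Real.log (10 / 9) := Real.log_pos (by norm_num)
  refine ⟨1 / ε / Real.log (10 / 9) + 1, by positivity, ?_⟩
  intro N hN
  obtain ⟨K, hK1, hK2⟩ := exists_nat_pow_near hN (show (1:ℝ) < 10 / 9 by norm_num)
  refine ⟨K + 1, ?_, ?_⟩
  · have h1 : (K : ℝ) * Real.log (10 / 9) ≤ Real.log N := by
      rw [← Real.log_pow]; exact Real.log_le_log (by positivity) hK1
    have h2 := Real.log_le_rpow_div (by linarith : 0 ≤ N) hε
    have h3 : 1 ≤ N ^ ε := Real.one_le_rpow hN hε.le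
    have h4 : (K : ℝ) ≤ 1 / ε / Real.log (10 / 9) * N ^ ε := by
      rw [div_mul_eq_mul_div, le_div_iff₀ hl]
      calc _ ≤ _ := h1
        _ ≤ _ := h2
        _ = _ := by ring
    push_cast
    linarith
  · intro x hx hxN
    have hx0 : 0 < x := by linarith
    obtain ⟨i, hi1, hi2⟩ := exists_nat_pow_near ((one_le_div hx0).2 hxN) (show (1:ℝ) < 10 / 9 by norm_num)
    refine ⟨i, ?_, ?_, ?_⟩
    · have : (10 / 9 : ℝ) ^ i < (10 / 9) ^ (K + 1) :=
        (hi1.trans (div_le_self (by linarith) hx)).trans_lt hK2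
      exact (pow_lt_pow_iff_right₀ (by norm_num)).1 this
    · rw [← mul_div_assoc, div_lt_iff₀ (by positivity)]
      rw [div_lt_iff₀ hx0, pow_succ] at hi2
      linarith
    · rw [le_div_iff₀ (by positivity)]
      rw [le_div_iff₀ hx0] at hi1
      linarith

lemma norm_sum_sq_le {ι : Type*} (s : Finset ι) (f : ι → ℂ) :
    ‖∑ i ∈ s, f i‖ ^ 2 ≤ s.card * ∑ i ∈ s, ‖f i‖ ^ 2 := by
  refine (pow_le_pow_left₀ (norm_nonneg _) (norm_sum_le _ _) 2).trans ?_
  exact sq_sum_le_card_mul_sum_sq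

/-- the recursive step -/
lemma step {p q : Fin 3 → ℝ} (hp : ∀ i, 0 ≤ p i) (hpq1 : ∀ i, 1 ≤ 2 * p i + q i)
    (hpq : ∀ i, 0 ≤ p i + q i) (H : H3 p q) {ε : ℝ} (hε : 0 < ε) :
    ∃ C : ℝ, 0 < C ∧ ∀ χ, IsCubicSymbol χ → ∀ (N M : ℝ), 1 ≤ N → N ≤ M →
      ∀ (c : Eis → ℂ) (T : Finset Eis), (∀ m ∈ T, Nm m ≤ M) →
      ∑ m ∈ T, ‖∑ n ∈ SF N, c n * Xc χ n m‖ ^ 2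
      ≤ C * N ^ ε * (M + ∑ i, M ^ (1 - p i) * N ^ (2 * p i + q i - 1)) * ∑ n ∈ SF N, ‖c n‖ ^ 2 := by
  classical
  obtain ⟨C₁, hC₁, H1⟩ := local_step hp hpq1 hpq H (ε := ε / 2) (by positivity)
  obtain ⟨C₂, hC₂, H2⟩ := ranges (ε := ε / 2) (by positivity)
  refine ⟨C₂ * C₁, by positivity, ?_⟩
  intro χ hχ N M hN hNM c T hT
  have hN0 : 0 < N := by linarith only [hN]
  have hM0 : 0 < M := by linarith only [hN, hNM]
  obtain ⟨K, hK, hK'⟩ := H2 N hN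
  have hx : ∀ n : Eis, ∃ i, n ∈ SF N → i < K ∧ 9 / 10 * (N / (10 / 9) ^ i) < Nm n ∧ Nm n ≤ N / (10 / 9) ^ i := by
    intro n
    by_cases hn : n ∈ SF N
    · obtain ⟨i, h1, h2⟩ := hK' (Nm n) (one_le_Nm (mem_SF.1 hn).2.1.ne_zero) (mem_SF.1 hn).1
      exact ⟨i, fun _ => ⟨h1, h2⟩⟩
    · exact ⟨0, fun h => absurd h hn⟩
  choose idx hidx using hx
  have hmaps : ∀ n ∈ SF N, idx n ∈ Finset.range K := fun n hn => Finset.mem_range.2 (hidx n hn).1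
  obtain ⟨G, hG⟩ : ∃ G, G = M + ∑ i, M ^ (1 - p i) * N ^ (2 * p i + q i - 1) := ⟨_, rfl⟩
  have hG0 : 0 ≤ G := by rw [hG]; positivity
  have hpiece : ∀ j ∈ Finset.range K, ∑ m ∈ T, ‖∑ n ∈ (SF N).filter (fun n => idx n = j), c n * Xc χ n m‖ ^ 2
      ≤ C₁ * N ^ (ε / 2) * G * ∑ n ∈ (SF N).filter (fun n => idx n = j), ‖c n‖ ^ 2 := by
    intro j _
    obtain ⟨L, hL⟩ : ∃ L, L = (SF N).filter (fun n => idx n = j) := ⟨_, rfl⟩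
    rw [← hL]
    rcases L.eq_empty_or_nonempty with he | ⟨a0, ha0⟩
    · simp [he]
    have hloc : ∀ a ∈ L, a ∈ SF (N / (10 / 9) ^ j) ∧ 9 / 10 * (N / (10 / 9) ^ j) < Nm a := by
      intro a ha
      rw [hL, Finset.mem_filter] at ha
      obtain ⟨h1, h2⟩ := ha
      have h3 := hidx a h1
      rw [h2] at h3
      exact ⟨mem_SF.2 ⟨h3.2.2, (mem_SF.1 h1).2⟩, h3.2.1⟩
    have h1 : 1 ≤ N / (10 / 9) ^ j := (one_le_Nm (mem_SF.1 (hloc a0 ha0).1).2.1.ne_zero).trans (mem_SF.1 (hloc a0 ha0).1).1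
    have h2 : N / (10 / 9) ^ j ≤ N := div_le_self hN0.le (one_le_pow₀ (by norm_num))
    refine (H1 χ hχ _ M h1 (h2.trans hNM) L hloc c T hT).trans ?_
    refine mul_le_mul_of_nonneg_right (mul_le_mul ?_ ?_ ?_ ?_) (Finset.sum_nonneg fun _ _ => sq_nonneg _)
    · exact mul_le_mul_of_nonneg_left (Real.rpow_le_rpow (by linarith only [h1]) h2 (by positivity)) hC₁.le
    · rw [hG]
      refine add_le_add le_rfl (Finset.sum_le_sum fun i _ => mul_le_mul_of_nonneg_left ?_ (Real.rpow_nonneg hM0.le _))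
      exact Real.rpow_le_rpow (by linarith only [h1]) h2 (by linarith only [hpq1 i])
    · exact add_nonneg hM0.le (Finset.sum_nonneg fun i _ => mul_nonneg (Real.rpow_nonneg hM0.le _)
        (Real.rpow_nonneg (by linarith only [h1]) _))
    · exact mul_nonneg hC₁.le (Real.rpow_nonneg hN0.le _)
  calc ∑ m ∈ T, ‖∑ n ∈ SF N, c n * Xc χ n m‖ ^ 2
      ≤ ∑ m ∈ T, (K : ℝ) * ∑ j ∈ Finset.range K, ‖∑ n ∈ (SF N).filter (fun n => idx n = j), c n * Xc χ n m‖ ^ 2 := by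
        refine Finset.sum_le_sum fun m _ => ?_
        rw [← Finset.sum_fiberwise_of_maps_to hmaps]
        refine (norm_sum_sq_le _ _).trans ?_
        rw [Finset.card_range]
    _ = (K : ℝ) * ∑ j ∈ Finset.range K, ∑ m ∈ T, ‖∑ n ∈ (SF N).filter (fun n => idx n = j), c n * Xc χ n m‖ ^ 2 := by
        rw [← Finset.mul_sum, Finset.sum_comm]
    _ ≤ (K : ℝ) * ∑ j ∈ Finset.range K, C₁ * N ^ (ε / 2) * G * ∑ n ∈ (SF N).filter (fun n => idx n = j), ‖c n‖ ^ 2 :=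
        mul_le_mul_of_nonneg_left (Finset.sum_le_sum hpiece) (Nat.cast_nonneg _)
    _ = (K : ℝ) * (C₁ * N ^ (ε / 2) * G * ∑ n ∈ SF N, ‖c n‖ ^ 2) := by
        rw [← Finset.mul_sum, Finset.sum_fiberwise_of_maps_to hmaps]
    _ ≤ (C₂ * N ^ (ε / 2)) * (C₁ * N ^ (ε / 2) * G * ∑ n ∈ SF N, ‖c n‖ ^ 2) := by
        refine mul_le_mul_of_nonneg_right hK (mul_nonneg (mul_nonneg (mul_nonneg hC₁.le
          (Real.rpow_nonneg hN0.le _)) hG0) (Finset.sum_nonneg fun _ _ => sq_nonneg _))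
    _ = _ := by
        have e5 : N ^ ε = N ^ (ε / 2) * N ^ (ε / 2) := by
          rw [← Real.rpow_add hN0]; congr 1; ring
        rw [e5, ← hG]; ring

end

/-! ### Part 18: large sieve statements, duality -/
section
variable {χ : Eis → Eis → Eis}

/-- the large sieve bound with parameter `ξ` -/
def LS (ξ : ℝ) : Prop := ∀ ε : ℝ, 0 < ε → ∃ C : ℝ, 0 < C ∧ ∀ χ, IsCubicSymbol χ → ∀ M N : ℝ, 1 ≤ M → 1 ≤ N →
  ∀ c : Eis → ℂ, ∑ m ∈ SF M, ‖∑ n ∈ SF N, c n * Xc χ n m‖ ^ 2 ≤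
    C * (M * N) ^ ε * (M + N ^ ξ + (M * N) ^ ((2:ℝ) / 3)) * ∑ n ∈ SF N, ‖c n‖ ^ 2

lemma duality {α β : Type*} (s : Finset α) (t : Finset β) (x : α → β → ℂ) {B : ℝ} (hB : 0 ≤ B)
    (H : ∀ c : α → ℂ, ∑ m ∈ t, ‖∑ n ∈ s, c n * x n m‖ ^ 2 ≤ B * ∑ n ∈ s, ‖c n‖ ^ 2) (d : β → ℂ) :
    ∑ n ∈ s, ‖∑ m ∈ t, d m * x n m‖ ^ 2 ≤ B * ∑ m ∈ t, ‖d m‖ ^ 2 := by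
  obtain ⟨S, hS⟩ : ∃ S, S = ∑ n ∈ s, ‖∑ m ∈ t, d m * x n m‖ ^ 2 := ⟨_, rfl⟩
  have hS0 : 0 ≤ S := by rw [hS]; exact Finset.sum_nonneg fun _ _ => sq_nonneg _
  set c : α → ℂ := fun n => (starRingEnd ℂ) (∑ m ∈ t, d m * x n m) with hc
  have h1 : (S : ℂ) = ∑ m ∈ t, d m * ∑ n ∈ s, c n * x n m := by
    rw [hS]
    simp only [Complex.ofReal_sum, Finset.mul_sum]
    rw [Finset.sum_comm]
    refine Finset.sum_congr rfl fun n _ => ?_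
    rw [← Complex.normSq_eq_norm_sq, ← Complex.mul_conj]
    rw [mul_comm, Finset.mul_sum]
    refine Finset.sum_congr rfl fun m _ => ?_
    simp only [hc]; ring
  have h2 : S ≤ ∑ m ∈ t, ‖d m‖ * ‖∑ n ∈ s, c n * x n m‖ := by
    have : S = ‖(S : ℂ)‖ := by rw [norm_real, Real.norm_eq_abs, abs_of_nonneg hS0]
    rw [this, h1]
    refine (norm_sum_le _ _).trans (le_of_eq (Finset.sum_congr rfl fun m _ => norm_mul _ _))
  have h3 : S ^ 2 ≤ (∑ m ∈ t, ‖d m‖ ^ 2) * (B * S) := by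
    refine (pow_le_pow_left₀ hS0 h2 2).trans ((Finset.sum_mul_sq_le_sq_mul_sq _ _ _).trans ?_)
    refine mul_le_mul_of_nonneg_left ?_ (Finset.sum_nonneg fun _ _ => sq_nonneg _)
    refine (H c).trans (le_of_eq ?_)
    rw [hS]
    congr 1
    refine Finset.sum_congr rfl fun n _ => ?_
    simp only [hc, RCLike.norm_conj]
  rw [← hS]
  rcases hS0.eq_or_lt with h0 | h0
  · rw [← h0]; exact mul_nonneg hB (Finset.sum_nonneg fun _ _ => sq_nonneg _)
  · have : S * S ≤ (B * ∑ m ∈ t, ‖d m‖ ^ 2) * S := by linarith only [h3]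
    exact le_of_mul_le_mul_right this h0

lemma LS.dual {ξ : ℝ} (h : LS ξ) {ε : ℝ} (hε : 0 < ε) : ∃ C : ℝ, 0 < C ∧ ∀ χ, IsCubicSymbol χ → ∀ M N : ℝ, 1 ≤ M → 1 ≤ N →
  ∀ c : Eis → ℂ, ∑ m ∈ SF M, ‖∑ n ∈ SF N, c n * Xc χ n m‖ ^ 2 ≤
    C * (M * N) ^ ε * (N + M ^ ξ + (M * N) ^ ((2:ℝ) / 3)) * ∑ n ∈ SF N, ‖c n‖ ^ 2 := by
  obtain ⟨C, hC, H⟩ := h ε hε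
  refine ⟨C, hC, ?_⟩
  intro χ hχ M N hM hN c
  have hM0 : 0 < M := by linarith
  have hN0 : 0 < N := by linarith
  have := duality (SF M) (SF N) (fun m n => Xc χ m n)
    (B := C * (M * N) ^ ε * (N + M ^ ξ + (M * N) ^ ((2:ℝ) / 3))) (by positivity) (by
      intro c'
      have := H χ hχ N M hN hM c'
      rwa [mul_comm N M] at this) c
  refine le_trans (le_of_eq ?_) this
  refine Finset.sum_congr rfl fun m hm => ?_
  congr 2
  refine Finset.sum_congr rfl fun n hn => ?_
  rw [Xc_recip hχ (mem_SF.1 hm).2.1 (mem_SF.1 hn).2.1]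

lemma SF_mono {M M' : ℝ} (h : M ≤ M') : SF M ⊆ SF M' := fun _ hx =>
  mem_SF.2 ⟨(mem_SF.1 hx).1.trans h, (mem_SF.1 hx).2⟩

/-- trivial bound -/
lemma H3_triv : H3 (fun _ => 1) (fun _ => 1) := by
  intro ε hε
  obtain ⟨C, hC, H⟩ := card_le hε
  refine ⟨C * C, by positivity, ?_⟩
  intro χ hχ Y N hY hN c T hT
  have hN0 : 0 < N := by linarith
  have h1 := H Y T hT hY.le
  have h2 := H N (SF N) (fun x hx => ⟨(mem_SF.1 hx).2.1.ne_zero, (mem_SF.1 hx).1⟩) hN0.le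
  obtain ⟨S, hS⟩ : ∃ S, S = ∑ n ∈ SF N, ‖c n‖ ^ 2 := ⟨_, rfl⟩
  have hS0 : 0 ≤ S := by rw [hS]; exact Finset.sum_nonneg fun _ _ => sq_nonneg _
  have h3 : ∀ h ∈ T, ‖∑ n ∈ SF N, c n * Xc χ n h‖ ^ 2 ≤ (C * N ^ (1 + ε)) * S := by
    intro h _
    refine (norm_sum_sq_le _ _).trans (mul_le_mul h2 ?_ (Finset.sum_nonneg fun _ _ => sq_nonneg _) (by positivity))
    rw [hS]
    refine Finset.sum_le_sum fun n hn => ?_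
    rw [norm_mul]
    exact pow_le_pow_left₀ (by positivity) (mul_le_of_le_one_right (norm_nonneg _) (Xc_norm_le hχ (mem_SF.1 hn).2.1 _)) 2
  refine (Finset.sum_le_sum h3).trans ?_
  rw [Finset.sum_const, nsmul_eq_mul, ← hS]
  calc (T.card : ℝ) * (C * N ^ (1 + ε) * S) ≤ (C * Y ^ (1 + ε)) * (C * N ^ (1 + ε) * S) :=
        mul_le_mul_of_nonneg_right h1 (by positivity)
    _ = C * C * N ^ ε * (Y ^ (1 + ε) * N ^ (1:ℝ)) * S := by rw [Real.rpow_add hN0]; ring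
    _ ≤ _ := by
        rw [Finset.sum_const, Finset.card_univ, Fintype.card_fin]
        refine mul_le_mul_of_nonneg_right (mul_le_mul_of_nonneg_left ?_ (by positivity)) hS0
        have : 0 ≤ Y ^ (1 + ε) * N ^ (1:ℝ) := by positivity
        rw [nsmul_eq_mul]; push_cast; linarith only [this]

lemma LS_two : LS 2 := by
  intro ε hε
  obtain ⟨C, hC, H⟩ := step (fun _ => by norm_num) (fun _ => by norm_num) (fun _ => by norm_num) H3_triv hε
  refine ⟨C * 4, by positivity, ?_⟩
  intro χ hχ M N hM hN c
  have hN0 : 0 < N := by linarith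
  have hM0 : 0 < M := by linarith
  have h := H χ hχ N (max M N) hN (le_max_right _ _) c (SF M)
    (fun m hm => (mem_SF.1 hm).1.trans (le_max_left _ _))
  refine h.trans (mul_le_mul_of_nonneg_right ?_ (Finset.sum_nonneg fun _ _ => sq_nonneg _))
  have e1 : N ^ ε ≤ (M * N) ^ ε := Real.rpow_le_rpow hN0.le (by nlinarith) hε.le
  have e2 : max M N + ∑ _i : Fin 3, (max M N) ^ ((1:ℝ) - 1) * N ^ ((2:ℝ) * 1 + 1 - 1) ≤
      4 * (M + N ^ (2:ℝ) + (M * N) ^ ((2:ℝ) / 3)) := by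
    rw [Finset.sum_const, Finset.card_univ, Fintype.card_fin]
    norm_num
    have : 0 ≤ (M * N) ^ ((2:ℝ) / 3) := by positivity
    rcases max_cases M N with ⟨h1, h2⟩ | ⟨h1, h2⟩ <;> rw [h1] <;> nlinarith
  calc _ ≤ C * (M * N) ^ ε * (4 * (M + N ^ (2:ℝ) + (M * N) ^ ((2:ℝ) / 3))) := by
        refine mul_le_mul (mul_le_mul_of_nonneg_left e1 hC.le) e2 ?_ (by positivity)
        positivity
    _ = _ := by ring

end

/-! ### Part 19: from squarefree to arbitrary elements -/
section
variable {χ : Eis → Eis → Eis}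

lemma sf_prime_mul {p a : Eis} (hp : Prime p) (ha : Squarefree a) (h : ¬ p ∣ a) : Squarefree (p * a) := by
  refine (squarefree_mul_iff).2 ⟨?_, hp.irreducible.squarefree, ha⟩
  exact (hp.irreducible.isRelPrime_iff_not_dvd).2 h

lemma cube_decomp_Pr {x : Eis} (hx : Pr x) : ∃ a b e : Eis, Pr a ∧ Squarefree a ∧ Pr b ∧ Squarefree b ∧ Pr e ∧
    x = a * b ^ 2 * e ^ 3 := by
  induction hx using Pr.induction with
  | h1 => exact ⟨1, 1, 1, Pr_one, squarefree_one, Pr_one, squarefree_one, Pr_one, by simp⟩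
  | hmul p x hp hpr hx ih =>
    obtain ⟨a, b, e, ha, ha', hb, hb', he, rfl⟩ := ih
    by_cases h1 : p ∣ a
    · obtain ⟨a1, rfl⟩ := h1
      by_cases h2 : p ∣ b
      · obtain ⟨b1, rfl⟩ := h2
        exact ⟨p * a1, b1, p * e, ha, ha', hpr.cofactor hb, sf_right hb', hpr.mul he, by ring⟩
      · exact ⟨a1, p * b, e, hpr.cofactor ha, sf_right ha', hpr.mul hb, sf_prime_mul hp hb' h2, he, by ring⟩
    · exact ⟨p * a, b, e, hpr.mul ha, sf_prime_mul hp ha' h1, hb, hb', he, by ring⟩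

lemma lam_decomp {x : Eis} (hx : x ≠ 0) : ∃ (k : ℕ) (y : Eis), ¬ lam ∣ y ∧ x = lam ^ k * y := by
  have hfin : FiniteMultiplicity lam x := FiniteMultiplicity.of_prime_left lam_prime hx
  obtain ⟨y, hy, hy2⟩ := hfin.exists_eq_pow_mul_and_not_dvd
  exact ⟨_, y, hy2, hy⟩

lemma cube_decomp {x : Eis} (hx : x ≠ 0) : ∃ v a b e : Eis, v ≠ 0 ∧ Nm v ≤ 9 ∧ e ≠ 0 ∧ Pr a ∧ Squarefree a ∧ Pr b ∧
    Squarefree b ∧ x = v * a * b ^ 2 * e ^ 3 := by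
  obtain ⟨k, y, hy, rfl⟩ := lam_decomp hx
  obtain ⟨u, hu⟩ := exists_unit_Pr hy
  obtain ⟨a, b, e, ha, ha', hb, hb', he, hdec⟩ := cube_decomp_Pr hu
  have hl := lam_ne_zero
  refine ⟨((u⁻¹ : Eisˣ) : Eis) * lam ^ (k % 3), a, b, lam ^ (k / 3) * e, ?_, ?_, ?_, ha, ha', hb, hb', ?_⟩
  · exact mul_ne_zero (u⁻¹).ne_zero (pow_ne_zero _ hl)
  · rw [Nm_mul, (isUnit_iff_Nm).1 (u⁻¹).isUnit, Nm_pow, Nm_lam, one_mul]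
    have : k % 3 ≤ 2 := by omega
    calc (3:ℝ) ^ (k % 3) ≤ 3 ^ 2 := pow_le_pow_right₀ (by norm_num) this
      _ = 9 := by norm_num
  · exact mul_ne_zero (pow_ne_zero _ hl) he.ne_zero
  · have hk : lam ^ k = lam ^ (k % 3) * (lam ^ (k / 3)) ^ 3 := by
      rw [← pow_mul, ← pow_add]; congr 1; omega
    have hy' : y = ((u⁻¹ : Eisˣ) : Eis) * (a * b ^ 2 * e ^ 3) := by
      rw [← hdec, Units.inv_mul_cancel_left]
    rw [hk, hy']; ring

open Classical in
lemma key_sum {s S : ℝ} (hS : ∀ T : Finset Eis, ∑ x ∈ T, Nm x ^ (-s) ≤ S) (T : Finset Eis)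
    (key : Eis → Eis × Eis × Eis) (F : Eis → ℝ) {D : ℝ} (hD : 0 ≤ D)
    (hv : ∀ h ∈ T, Nm (key h).1 ≤ 9)
    (hF : ∀ h ∈ T, ∑ h' ∈ T.filter (fun h' => key h' = key h), F h' ≤
      D * ((Nm (key h).2.1) ^ (-s) * (Nm (key h).2.2) ^ (-s))) :
    ∑ h ∈ T, F h ≤ D * ((finite_ball 9).toFinset.card * (S * S)) := by
  have hS0 : 0 ≤ S := by simpa using hS ∅
  rw [← Finset.sum_fiberwise_of_maps_to (g := key) (t := T.image key) (fun h hh => Finset.mem_image_of_mem _ hh)]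
  have h1 : ∀ k ∈ T.image key, ∑ h' ∈ T.filter (fun h' => key h' = k), F h' ≤
      D * ((Nm k.2.1) ^ (-s) * (Nm k.2.2) ^ (-s)) := by
    intro k hk
    obtain ⟨h, hh, rfl⟩ := Finset.mem_image.1 hk
    exact hF h hh
  refine (Finset.sum_le_sum h1).trans ?_
  rw [← Finset.mul_sum]
  refine mul_le_mul_of_nonneg_left ?_ hD
  have hsub : T.image key ⊆ (finite_ball 9).toFinset ×ˢ ((T.image fun h => (key h).2.1) ×ˢ (T.image fun h => (key h).2.2)) := by
    intro k hk
    obtain ⟨h, hh, rfl⟩ := Finset.mem_image.1 hk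
    simp only [Finset.mem_product, Set.Finite.mem_toFinset, Set.mem_ofPred_eq]
    exact ⟨hv h hh, Finset.mem_image_of_mem (fun h => (key h).2.1) hh, Finset.mem_image_of_mem (fun h => (key h).2.2) hh⟩
  have hnn : ∀ x : Eis, 0 ≤ Nm x ^ (-s) := fun x => Real.rpow_nonneg (Nm_nonneg x) _
  refine (Finset.sum_le_sum_of_subset_of_nonneg hsub fun k _ _ => mul_nonneg (hnn _) (hnn _)).trans ?_
  rw [Finset.sum_product]
  dsimp only
  rw [Finset.sum_const, nsmul_eq_mul]
  refine mul_le_mul_of_nonneg_left ?_ (Nat.cast_nonneg _)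
  rw [Finset.sum_product]
  dsimp only
  rw [← Finset.sum_mul_sum]
  exact mul_le_mul (hS _) (hS _) (Finset.sum_nonneg fun _ _ => hnn _) hS0

lemma real_key {ξ δ Y N u s : ℝ} (hξ : 1 ≤ ξ) (hδ : 0 < δ) (hs : s = 1 + 3 * δ) (hs2 : s ≤ 4 / 3) (hN : 1 ≤ N) (hu : 1 ≤ u)
    (huY : u ^ 3 ≤ Y) :
    (Y / u ^ 2 * N) ^ δ * (N + (Y / u ^ 2) ^ ξ + (Y / u ^ 2 * N) ^ ((2:ℝ) / 3)) ≤
      N ^ δ * (Y ^ (1 / 3 + 2 * δ) * N ^ (1:ℝ) + Y ^ (ξ + 2 * δ) * N ^ (0:ℝ) + Y ^ (2 / 3 + 2 * δ) * N ^ ((2:ℝ) / 3)) * u ^ (-s) := by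
  have hN0 : 0 < N := by linarith
  have hu0 : 0 < u := by linarith
  have hu3 : 1 ≤ u ^ 3 := one_le_pow₀ hu
  have hY : 1 ≤ Y := by linarith
  have hY0 : 0 < Y := by linarith
  have hM : Y / u ^ 2 ≤ Y := div_le_self hY0.le (one_le_pow₀ hu)
  have hMd : (Y / u ^ 2) ^ δ ≤ Y ^ δ := Real.rpow_le_rpow (by positivity) hM hδ.le
  have hus : u ^ s ≤ Y ^ (1 / 3 + δ) := by
    calc u ^ s = (u ^ 3) ^ (1 / 3 + δ) := by
          rw [← Real.rpow_natCast u 3, ← Real.rpow_mul hu0.le, hs]; congr 1; push_cast; ring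
      _ ≤ _ := Real.rpow_le_rpow (by positivity) huY (by positivity)
  have hYd1 : 1 ≤ Y ^ δ := Real.one_le_rpow hY hδ.le
  have t1 : N ≤ Y ^ (1 / 3 + δ) * N ^ (1:ℝ) * u ^ (-s) := by
    rw [Real.rpow_neg hu0.le, ← div_eq_mul_inv, le_div_iff₀ (by positivity), Real.rpow_one, mul_comm N]
    exact mul_le_mul_of_nonneg_right hus hN0.le
  have t2 : (Y / u ^ 2) ^ ξ ≤ Y ^ ξ * u ^ (-s) := by
    rw [Real.div_rpow hY0.le (by positivity), Real.rpow_neg hu0.le, ← div_eq_mul_inv]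
    refine div_le_div_of_nonneg_left (by positivity) (by positivity) ?_
    rw [← Real.rpow_natCast u 2, ← Real.rpow_mul hu0.le]
    exact Real.rpow_le_rpow_of_exponent_le hu (by push_cast; linarith)
  have t3 : (Y / u ^ 2 * N) ^ ((2:ℝ) / 3) ≤ Y ^ ((2:ℝ) / 3) * N ^ ((2:ℝ) / 3) * u ^ (-s) := by
    rw [Real.mul_rpow (by positivity) hN0.le, Real.div_rpow hY0.le (by positivity), Real.rpow_neg hu0.le]
    have : Y ^ ((2:ℝ) / 3) / (u ^ 2) ^ ((2:ℝ) / 3) ≤ Y ^ ((2:ℝ) / 3) / u ^ s := by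
      refine div_le_div_of_nonneg_left (by positivity) (by positivity) ?_
      rw [← Real.rpow_natCast u 2, ← Real.rpow_mul hu0.le]
      exact Real.rpow_le_rpow_of_exponent_le hu (by push_cast; linarith)
    calc _ ≤ Y ^ ((2:ℝ) / 3) / u ^ s * N ^ ((2:ℝ) / 3) := mul_le_mul_of_nonneg_right this (by positivity)
      _ = _ := by ring
  have e1 : Y ^ (1 / 3 + 2 * δ) = Y ^ δ * Y ^ (1 / 3 + δ) := by rw [← Real.rpow_add hY0]; congr 1; ring
  have e2 : Y ^ (ξ + 2 * δ) = Y ^ δ * (Y ^ δ * Y ^ ξ) := by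
    rw [← Real.rpow_add hY0, ← Real.rpow_add hY0]; congr 1; ring
  have e3 : Y ^ (2 / 3 + 2 * δ) = Y ^ δ * (Y ^ δ * Y ^ ((2:ℝ) / 3)) := by
    rw [← Real.rpow_add hY0, ← Real.rpow_add hY0]; congr 1; ring
  rw [Real.mul_rpow (by positivity) hN0.le, e1, e2, e3, Real.rpow_zero, mul_one]
  have t2' : (Y / u ^ 2) ^ ξ ≤ Y ^ δ * Y ^ ξ * u ^ (-s) := by
    refine t2.trans ?_
    have : 0 ≤ Y ^ ξ * u ^ (-s) := by positivity
    nlinarith only [this, hYd1]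
  have t3' : (Y / u ^ 2 * N) ^ ((2:ℝ) / 3) ≤ Y ^ δ * Y ^ ((2:ℝ) / 3) * N ^ ((2:ℝ) / 3) * u ^ (-s) := by
    refine t3.trans ?_
    have : 0 ≤ Y ^ ((2:ℝ) / 3) * N ^ ((2:ℝ) / 3) * u ^ (-s) := by positivity
    nlinarith only [this, hYd1]
  rw [← Real.mul_rpow (by positivity) hN0.le]
  calc _ ≤ (Y ^ δ * N ^ δ) * (Y ^ (1 / 3 + δ) * N ^ (1:ℝ) * u ^ (-s) + Y ^ δ * Y ^ ξ * u ^ (-s) + Y ^ δ * Y ^ ((2:ℝ) / 3) * N ^ ((2:ℝ) / 3) * u ^ (-s)) := by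
        rw [Real.mul_rpow (by positivity) hN0.le]
        refine mul_le_mul (mul_le_mul_of_nonneg_right hMd (by positivity)) (add_le_add (add_le_add t1 t2') t3') (by positivity) (by positivity)
    _ = _ := by ring

lemma sum_inj_le {T U : Finset Eis} (i : Eis → Eis) (f g : Eis → ℝ) (hi : ∀ h ∈ T, i h ∈ U)
    (hinj : ∀ h ∈ T, ∀ h' ∈ T, i h = i h' → h = h') (hfg : ∀ h ∈ T, f h = g (i h)) (hg : ∀ x, 0 ≤ g x) :
    ∑ h ∈ T, f h ≤ ∑ x ∈ U, g x := by
  classical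
  rw [Finset.sum_congr rfl hfg, ← Finset.sum_image (f := g) (g := i) hinj]
  refine Finset.sum_le_sum_of_subset_of_nonneg ?_ fun _ _ _ => hg _
  intro x hx
  obtain ⟨h, hh, rfl⟩ := Finset.mem_image.1 hx
  exact hi h hh

end

/-! ### Part 20: the large sieve over arbitrary elements -/
section
variable {χ : Eis → Eis → Eis}

lemma twist_norm (hχ : IsCubicSymbol χ) {N : ℝ} (c : Eis → ℂ) (w : Eis) :
    ∑ n ∈ SF N, ‖c n * Xc χ n w‖ ^ 2 ≤ ∑ n ∈ SF N, ‖c n‖ ^ 2 := by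
  refine Finset.sum_le_sum fun n hn => ?_
  rw [norm_mul]
  exact pow_le_pow_left₀ (by positivity) (mul_le_of_le_one_right (norm_nonneg _) (Xc_norm_le hχ (mem_SF.1 hn).2.1 _)) 2

lemma twist_a (hχ : IsCubicSymbol χ) {M N B : ℝ} (hB : 0 ≤ B)
    (H : ∀ c : Eis → ℂ, ∑ m ∈ SF M, ‖∑ n ∈ SF N, c n * Xc χ n m‖ ^ 2 ≤ B * ∑ n ∈ SF N, ‖c n‖ ^ 2)
    (c : Eis → ℂ) (w : Eis) :
    ∑ m ∈ SF M, ‖∑ n ∈ SF N, c n * Xc χ n (w * m)‖ ^ 2 ≤ B * ∑ n ∈ SF N, ‖c n‖ ^ 2 := by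
  refine le_trans (le_of_eq ?_) ((H fun n => c n * Xc χ n w).trans (mul_le_mul_of_nonneg_left (twist_norm hχ c w) hB))
  refine Finset.sum_congr rfl fun m hm => ?_
  congr 2
  refine Finset.sum_congr rfl fun n hn => ?_
  rw [Xc_mul_top hχ (mem_SF.1 hn).2.1, mul_assoc]

lemma twist_b (hχ : IsCubicSymbol χ) {M N B : ℝ} (hB : 0 ≤ B)
    (H : ∀ c : Eis → ℂ, ∑ m ∈ SF M, ‖∑ n ∈ SF N, c n * Xc χ n m‖ ^ 2 ≤ B * ∑ n ∈ SF N, ‖c n‖ ^ 2)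
    (c : Eis → ℂ) (w : Eis) :
    ∑ m ∈ SF M, ‖∑ n ∈ SF N, c n * Xc χ n (w * m ^ 2)‖ ^ 2 ≤ B * ∑ n ∈ SF N, ‖c n‖ ^ 2 := by
  have h1 := H fun n => (starRingEnd ℂ) (c n * Xc χ n w)
  simp only [RCLike.norm_conj] at h1
  refine le_trans (le_of_eq ?_) (h1.trans (mul_le_mul_of_nonneg_left (twist_norm hχ c w) hB))
  refine Finset.sum_congr rfl fun m hm => ?_
  rw [← RCLike.norm_conj, map_sum]
  congr 2
  refine Finset.sum_congr rfl fun n hn => ?_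
  have hn' := (mem_SF.1 hn).2.1
  rw [Xc_mul_top hχ hn', pow_two, Xc_mul_top hχ hn', ← pow_two, Xc_sq_bot hχ hn']
  simp only [map_mul, Complex.conj_conj]
  ring

/-- exponents -/
def pE (ξ : ℝ) : Fin 3 → ℝ := ![1 / 3, ξ, 2 / 3]
/-- exponents -/
def qE : Fin 3 → ℝ := ![1, 0, 2 / 3]

lemma H3_of_LS {ξ : ℝ} (hξ : 1 ≤ ξ) (h : LS ξ) : H3 (pE ξ) qE := by
  classical
  intro ε hε
  obtain ⟨δ, hδ⟩ : ∃ δ, δ = min (ε / 2) (1 / 9) := ⟨_, rfl⟩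
  have hδ0 : 0 < δ := by rw [hδ]; positivity
  have hδ1 : δ ≤ ε / 2 := by rw [hδ]; exact min_le_left _ _
  have hδ2 : δ ≤ 1 / 9 := by rw [hδ]; exact min_le_right _ _
  obtain ⟨C, hC, H⟩ := h.dual hδ0
  obtain ⟨S, hS, HS⟩ := sum_Nm_neg (ε := 3 * δ) (by positivity)
  obtain ⟨V, hV⟩ : ∃ V : ℝ, V = (finite_ball 9).toFinset.card := ⟨_, rfl⟩
  have hV0 : 0 ≤ V := by rw [hV]; positivity
  refine ⟨2 * C * (V * (S * S)) + 1, by positivity, ?_⟩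
  intro χ hχ Y N hY hN c T hT
  have hN0 : 0 < N := by linarith only [hN]
  rcases T.eq_empty_or_nonempty with rfl | ⟨h0, hh0⟩
  · simp only [Finset.sum_empty]
    have : 0 ≤ ∑ n ∈ SF N, ‖c n‖ ^ 2 := Finset.sum_nonneg fun _ _ => sq_nonneg _
    positivity
  have hY1 : 1 ≤ Y := (one_le_Nm (hT h0 hh0).1).trans (hT h0 hh0).2
  obtain ⟨Z, hZ⟩ : ∃ Z, Z = ∑ n ∈ SF N, ‖c n‖ ^ 2 := ⟨_, rfl⟩
  have hZ0 : 0 ≤ Z := by rw [hZ]; exact Finset.sum_nonneg fun _ _ => sq_nonneg _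
  obtain ⟨G, hG⟩ : ∃ G, G = N ^ δ * (Y ^ (1 / 3 + 2 * δ) * N ^ (1:ℝ) + Y ^ (ξ + 2 * δ) * N ^ (0:ℝ) +
    Y ^ (2 / 3 + 2 * δ) * N ^ ((2:ℝ) / 3)) := ⟨_, rfl⟩
  have hG0 : 0 ≤ G := by rw [hG]; positivity
  have hdec : ∀ x : Eis, ∃ v a b e : Eis, x ∈ T → (v ≠ 0 ∧ Nm v ≤ 9 ∧ e ≠ 0 ∧ Pr a ∧ Squarefree a ∧ Pr b ∧
      Squarefree b ∧ x = v * a * b ^ 2 * e ^ 3) := by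
    intro x
    by_cases hx : x ∈ T
    · obtain ⟨v, a, b, e, h⟩ := cube_decomp (hT x hx).1
      exact ⟨v, a, b, e, fun _ => h⟩
    · exact ⟨0, 0, 0, 0, fun h => absurd h hx⟩
  choose v a b e hd using hdec
  have hNmY : ∀ x ∈ T, Nm (a x) * Nm (b x) ^ 2 * Nm (e x) ^ 3 ≤ Y := by
    intro x hx
    obtain ⟨h1, h2, h3, h4, h5, h6, h7, h8⟩ := hd x hx
    have h9 := (hT x hx).2
    have hx' := congrArg Nm h8
    simp only [Nm_mul, Nm_pow] at hx'
    rw [hx'] at h9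
    refine le_trans ?_ h9
    have i1 := one_le_Nm h1
    have : 0 ≤ Nm (a x) * Nm (b x) ^ 2 * Nm (e x) ^ 3 := by
      have := Nm_nonneg (a x); have := Nm_nonneg (b x); have := Nm_nonneg (e x); positivity
    nlinarith only [this, i1]
  obtain ⟨F, hF⟩ : ∃ F : Eis → ℝ, F = fun x => ‖∑ n ∈ SF N, c n * Xc χ n x‖ ^ 2 := ⟨_, rfl⟩
  have hF0 : ∀ x, 0 ≤ F x := fun x => by rw [hF]; exact sq_nonneg _
  -- bound for a fibre
  have hfib : ∀ x z : Eis, x ≠ 0 → z ≠ 0 → (Nm x * Nm z) ^ 3 ≤ Y → ∀ w : Eis,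
      ∑ m ∈ SF (Y / (Nm x * Nm z) ^ 2), F (w * m) ≤ (C * G * Z) * (Nm x ^ (-(1 + 3 * δ)) * Nm z ^ (-(1 + 3 * δ))) ∧
      ∑ m ∈ SF (Y / (Nm x * Nm z) ^ 2), F (w * m ^ 2) ≤ (C * G * Z) * (Nm x ^ (-(1 + 3 * δ)) * Nm z ^ (-(1 + 3 * δ))) := by
    intro x z hx hz hxz w
    have hx1 := one_le_Nm hx
    have hz1 := one_le_Nm hz
    have hu : 1 ≤ Nm x * Nm z := one_le_mul_of_one_le_of_one_le hx1 hz1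
    rw [← Real.mul_rpow (Nm_nonneg x) (Nm_nonneg z)]
    generalize Nm x * Nm z = u at hu hxz
    have hk := real_key hξ hδ0 rfl (by linarith only [hδ2]) hN hu hxz
    rw [← hG] at hk
    have hM1 : 1 ≤ Y / u ^ 2 := by
      rw [one_le_div (by positivity)]
      exact (pow_le_pow_right₀ hu (by norm_num)).trans hxz
    have hB := H χ hχ (Y / u ^ 2) N hM1 hN
    have hB0 : 0 ≤ C * (Y / u ^ 2 * N) ^ δ * (N + (Y / u ^ 2) ^ ξ + (Y / u ^ 2 * N) ^ ((2:ℝ) / 3)) := by positivity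
    have hfin : C * (Y / u ^ 2 * N) ^ δ * (N + (Y / u ^ 2) ^ ξ + (Y / u ^ 2 * N) ^ ((2:ℝ) / 3)) * Z ≤
        C * G * Z * u ^ (-(1 + 3 * δ)) := by
      have := mul_le_mul_of_nonneg_left hk (mul_nonneg hC.le hZ0)
      linarith only [this]
    rw [hF]
    rw [hZ] at hfin ⊢
    exact ⟨(twist_a hχ hB0 hB c w).trans hfin, (twist_b hχ hB0 hB c w).trans hfin⟩
  have hsplit : ∑ x ∈ T, F x = ∑ x ∈ T.filter (fun x => Nm (b x) ≤ Nm (a x)), F x +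
      ∑ x ∈ T.filter (fun x => ¬ Nm (b x) ≤ Nm (a x)), F x := (Finset.sum_filter_add_sum_filter_not _ _ _).symm
  have hD0 : 0 ≤ C * G * Z := by positivity
  have hT1 : ∑ x ∈ T.filter (fun x => Nm (b x) ≤ Nm (a x)), F x ≤ (C * G * Z) * (V * (S * S)) := by
    rw [hV]
    refine key_sum HS _ (fun x => (v x, e x, b x)) F hD0 ?_ ?_
    · intro x hx
      exact (hd x (Finset.mem_filter.1 hx).1).2.1
    · intro x hx
      rw [Finset.mem_filter] at hx
      obtain ⟨h1, h2, h3, h4, h5, h6, h7, h8⟩ := hd x hx.1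
      have hY' := hNmY x hx.1
      have hcond : (Nm (e x) * Nm (b x)) ^ 3 ≤ Y := by
        refine le_trans ?_ hY'
        have := mul_le_mul_of_nonneg_right hx.2 (show 0 ≤ Nm (b x) ^ 2 * Nm (e x) ^ 3 by
          have := Nm_nonneg (b x); have := Nm_nonneg (e x); positivity)
        linarith only [this]
      refine le_trans ?_ (hfib (e x) (b x) h3 h6.ne_zero hcond (v x * e x ^ 3 * b x ^ 2)).1
      refine sum_inj_le a F (fun m => F (v x * e x ^ 3 * b x ^ 2 * m)) ?_ ?_ ?_ (fun _ => hF0 _)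
      · intro y hy
        simp only [Finset.mem_filter, Prod.mk.injEq] at hy
        obtain ⟨⟨y1, y2⟩, y3, y4, y5⟩ := hy
        obtain ⟨k1, k2, k3, k4, k5, k6, k7, k8⟩ := hd y y1
        refine mem_SF.2 ⟨?_, k4, k5⟩
        have hY2 := hNmY y y1
        rw [y4, y5] at hY2
        have hb1 := one_le_Nm h6.ne_zero
        have he1 := one_le_Nm h3
        rw [le_div_iff₀ (by positivity)]
        refine le_trans ?_ hY2
        have := mul_le_mul_of_nonneg_left he1 (show 0 ≤ Nm (a y) * Nm (b x) ^ 2 * Nm (e x) ^ 2 by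
          have := Nm_nonneg (a y); positivity)
        linarith only [this]
      · intro y hy y' hy' hyy
        simp only [Finset.mem_filter, Prod.mk.injEq] at hy hy'
        rw [(hd y hy.1.1).2.2.2.2.2.2.2, (hd y' hy'.1.1).2.2.2.2.2.2.2, hy.2.1, hy.2.2.1, hy.2.2.2, hy'.2.1,
          hy'.2.2.1, hy'.2.2.2, hyy]
      · intro y hy
        simp only [Finset.mem_filter, Prod.mk.injEq] at hy
        have := (hd y hy.1.1).2.2.2.2.2.2.2
        rw [hy.2.1, hy.2.2.1, hy.2.2.2] at this
        conv_lhs => rw [this]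
        congr 1; ring
  have hT2 : ∑ x ∈ T.filter (fun x => ¬ Nm (b x) ≤ Nm (a x)), F x ≤ (C * G * Z) * (V * (S * S)) := by
    rw [hV]
    refine key_sum HS _ (fun x => (v x, e x, a x)) F hD0 ?_ ?_
    · intro x hx
      exact (hd x (Finset.mem_filter.1 hx).1).2.1
    · intro x hx
      rw [Finset.mem_filter] at hx
      obtain ⟨h1, h2, h3, h4, h5, h6, h7, h8⟩ := hd x hx.1
      have hY' := hNmY x hx.1
      have hab : Nm (a x) ≤ Nm (b x) := (not_le.1 hx.2).le
      have ha1 := one_le_Nm h4.ne_zero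
      have he1 := one_le_Nm h3
      have hcond : (Nm (e x) * Nm (a x)) ^ 3 ≤ Y := by
        refine le_trans ?_ hY'
        have i1 : Nm (a x) ^ 2 ≤ Nm (b x) ^ 2 := pow_le_pow_left₀ (Nm_nonneg _) hab 2
        have := mul_le_mul_of_nonneg_right i1 (show 0 ≤ Nm (a x) * Nm (e x) ^ 3 by positivity)
        linarith only [this]
      refine le_trans ?_ (hfib (e x) (a x) h3 h4.ne_zero hcond (v x * e x ^ 3 * a x)).2
      refine sum_inj_le b F (fun m => F (v x * e x ^ 3 * a x * m ^ 2)) ?_ ?_ ?_ (fun _ => hF0 _)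
      · intro y hy
        simp only [Finset.mem_filter, Prod.mk.injEq] at hy
        obtain ⟨⟨y1, y2⟩, y3, y4, y5⟩ := hy
        obtain ⟨k1, k2, k3, k4, k5, k6, k7, k8⟩ := hd y y1
        refine mem_SF.2 ⟨?_, k6, k7⟩
        have hY2 := hNmY y y1
        have y2' : Nm (a y) ≤ Nm (b y) := (not_le.1 y2).le
        rw [y4, y5] at hY2
        rw [y5] at y2'
        rw [le_div_iff₀ (by positivity)]
        refine le_trans ?_ hY2
        -- b (e a)^2 ≤ a b^2 e^3
        have i1 : Nm (a x) * Nm (b y) ≤ Nm (b y) * Nm (b y) := mul_le_mul_of_nonneg_right y2' (Nm_nonneg _)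
        have i2 := mul_le_mul_of_nonneg_right i1 (show 0 ≤ Nm (a x) * Nm (e x) ^ 2 by positivity)
        have i3 := mul_le_mul_of_nonneg_left he1 (show 0 ≤ Nm (a x) * Nm (b y) ^ 2 * Nm (e x) ^ 2 by
          have := Nm_nonneg (b y); positivity)
        linarith only [i2, i3]
      · intro y hy y' hy' hyy
        simp only [Finset.mem_filter, Prod.mk.injEq] at hy hy'
        rw [(hd y hy.1.1).2.2.2.2.2.2.2, (hd y' hy'.1.1).2.2.2.2.2.2.2, hy.2.1, hy.2.2.1, hy.2.2.2, hy'.2.1,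
          hy'.2.2.1, hy'.2.2.2, hyy]
      · intro y hy
        simp only [Finset.mem_filter, Prod.mk.injEq] at hy
        have := (hd y hy.1.1).2.2.2.2.2.2.2
        rw [hy.2.1, hy.2.2.1, hy.2.2.2] at this
        conv_lhs => rw [this]
        congr 1; ring
  have hGle : G ≤ N ^ ε * (∑ i, Y ^ (pE ξ i + ε) * N ^ (qE i)) := by
    rw [hG, Fin.sum_univ_three]
    simp only [pE, qE, Matrix.cons_val_zero, Matrix.cons_val_one, Matrix.cons_val]
    have hp : ∀ x : ℝ, Y ^ (x + 2 * δ) ≤ Y ^ (x + ε) := fun x =>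
      Real.rpow_le_rpow_of_exponent_le hY1 (by linarith only [hδ1])
    refine mul_le_mul (Real.rpow_le_rpow_of_exponent_le hN (by linarith only [hδ1, hδ0])) ?_ (by positivity) (by positivity)
    exact add_le_add (add_le_add (mul_le_mul_of_nonneg_right (hp _) (by positivity)) (mul_le_mul_of_nonneg_right (hp _) (by positivity)))
      (mul_le_mul_of_nonneg_right (hp _) (by positivity))
  obtain ⟨G', hG'⟩ : ∃ G', G' = N ^ ε * (∑ i, Y ^ (pE ξ i + ε) * N ^ (qE i)) := ⟨_, rfl⟩
  rw [← hG'] at hGle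
  have hFe : ∑ x ∈ T, ‖∑ n ∈ SF N, c n * Xc χ n x‖ ^ 2 = ∑ x ∈ T, F x := by rw [hF]
  rw [hFe, hsplit, ← hZ, mul_assoc (_ + 1) (N ^ ε), ← hG']
  have hVS : 0 ≤ V * (S * S) := by positivity
  calc _ ≤ (2 * C * (V * (S * S))) * (G * Z) := by linarith only [hT1, hT2]
    _ ≤ (2 * C * (V * (S * S)) + 1) * (G' * Z) := by
        refine mul_le_mul (by linarith only) (mul_le_mul_of_nonneg_right hGle hZ0) (mul_nonneg hG0 hZ0) (by positivity)
    _ = _ := by ring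

end

/-! ### Part 21: iteration -/
section
variable {χ : Eis → Eis → Eis}

lemma LS.mono {ξ ξ' : ℝ} (h : LS ξ) (hξ : ξ ≤ ξ') : LS ξ' := by
  intro ε hε
  obtain ⟨C, hC, H⟩ := h ε hε
  refine ⟨C, hC, fun χ hχ M N hM hN c => (H χ hχ M N hM hN c).trans ?_⟩
  have hM0 : 0 < M := by linarith
  have hN0 : 0 < N := by linarith
  refine mul_le_mul_of_nonneg_right (mul_le_mul_of_nonneg_left ?_ (by positivity)) (Finset.sum_nonneg fun _ _ => sq_nonneg _)
  have := Real.rpow_le_rpow_of_exponent_le hN hξ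
  linarith

lemma LS_iter {ξ : ℝ} (hξ1 : 4 / 3 ≤ ξ) (hξ2 : ξ ≤ 2) (h : LS ξ) : LS (2 - 2 / (3 * ξ - 1)) := by
  intro ε hε
  have hq : ∀ i, 0 ≤ pE ξ i := by
    intro i; fin_cases i <;> simp [pE] <;> linarith
  have hq1 : ∀ i, 1 ≤ 2 * pE ξ i + qE i := by
    intro i; fin_cases i <;> simp [pE, qE] <;> linarith
  have hq2 : ∀ i, 0 ≤ pE ξ i + qE i := by
    intro i; fin_cases i <;> simp [pE, qE] <;> linarith
  obtain ⟨C, hC, H⟩ := step hq hq1 hq2 (H3_of_LS (by linarith) h) hε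
  refine ⟨C * 4, by positivity, ?_⟩
  intro χ hχ M N hM hN c
  have hN0 : 0 < N := by linarith
  have hM0 : 0 < M := by linarith
  have hd : 0 < 3 * ξ - 1 := by linarith
  obtain ⟨y, hy⟩ : ∃ y, y = (6 * ξ - 5) / (3 * ξ - 1) := ⟨_, rfl⟩
  have hy1 : 1 ≤ y := by rw [hy, one_le_div hd]; linarith
  have hy2 : y ≤ 2 := by rw [hy, div_le_iff₀ hd]; linarith
  obtain ⟨ξ', hξ'⟩ : ∃ ξ', ξ' = 2 - 2 / (3 * ξ - 1) := ⟨_, rfl⟩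
  have hd' : 3 * ξ - 1 ≠ 0 := hd.ne'
  have h1 : y * (3 * ξ - 1) = 6 * ξ - 5 := by rw [hy]; exact div_mul_cancel₀ _ hd'
  have h2 : ξ' * (3 * ξ - 1) = 6 * ξ - 4 := by
    have : 2 / (3 * ξ - 1) * (3 * ξ - 1) = 2 := div_mul_cancel₀ _ hd'
    rw [hξ', sub_mul, this]; ring
  have e1 : ξ' = 2 * (y + 1) / 3 := by
    apply mul_right_cancel₀ hd'
    linear_combination h2 - 2 / 3 * h1
  have e2 : y * (1 - ξ) + (2 * ξ - 1) = ξ' := by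
    apply mul_right_cancel₀ hd'
    linear_combination (1 - ξ) * h1 - h2
  rw [← hξ']
  obtain ⟨M', hM'⟩ : ∃ M', M' = max M (N ^ y) := ⟨_, rfl⟩
  have hM'1 : M ≤ M' := by rw [hM']; exact le_max_left _ _
  have hM'2 : N ^ y ≤ M' := by rw [hM']; exact le_max_right _ _
  have hNy : N ≤ N ^ y := by
    calc N = N ^ (1:ℝ) := (Real.rpow_one N).symm
      _ ≤ _ := Real.rpow_le_rpow_of_exponent_le hN hy1
  have hNM' : N ≤ M' := hNy.trans hM'2
  have hM'0 : 0 < M' := by linarith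
  have hh := H χ hχ N M' hN hNM' c (SF M) (fun m hm => (mem_SF.1 hm).1.trans hM'1)
  refine hh.trans (mul_le_mul_of_nonneg_right ?_ (Finset.sum_nonneg fun _ _ => sq_nonneg _))
  have e3 : N ^ ε ≤ (M * N) ^ ε := Real.rpow_le_rpow hN0.le (by nlinarith) hε.le
  have hA : M' ^ ((2:ℝ) / 3) * N ^ ((2:ℝ) / 3) ≤ N ^ ξ' + (M * N) ^ ((2:ℝ) / 3) := by
    rcases max_cases M (N ^ y) with ⟨h1, h2⟩ | ⟨h1, h2⟩
    · rw [hM', h1, ← Real.mul_rpow hM0.le hN0.le]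
      have : 0 ≤ N ^ ξ' := by positivity
      linarith
    · rw [hM', h1, ← Real.rpow_mul hN0.le, ← Real.rpow_add hN0]
      have : y * (2 / 3) + 2 / 3 = ξ' := by rw [e1]; ring
      rw [this]
      have : 0 ≤ (M * N) ^ ((2:ℝ) / 3) := by positivity
      linarith
  have hB : M' ^ ((1:ℝ) - 1 / 3) * N ^ (2 * (1 / 3) + 1 - 1 : ℝ) ≤ N ^ ξ' + (M * N) ^ ((2:ℝ) / 3) := by
    have e4 : (1:ℝ) - 1 / 3 = 2 / 3 := by norm_num
    have e5 : (2 * (1 / 3) + 1 - 1 : ℝ) = 2 / 3 := by norm_num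
    rw [e4, e5]; exact hA
  have hCc : M' ^ (1 - ξ) * N ^ (2 * ξ + 0 - 1) ≤ N ^ ξ' := by
    have i1 : M' ^ (1 - ξ) ≤ (N ^ y) ^ (1 - ξ) := Real.rpow_le_rpow_of_nonpos (by positivity) hM'2 (by linarith)
    calc _ ≤ (N ^ y) ^ (1 - ξ) * N ^ (2 * ξ + 0 - 1) := mul_le_mul_of_nonneg_right i1 (by positivity)
      _ = N ^ ξ' := by
        rw [← Real.rpow_mul hN0.le, ← Real.rpow_add hN0, ← e2]; congr 1; ring
  have hDd : M' ^ ((1:ℝ) - 2 / 3) * N ^ (2 * (2 / 3) + 2 / 3 - 1 : ℝ) ≤ N ^ ξ' + (M * N) ^ ((2:ℝ) / 3) := by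
    refine le_trans ?_ hA
    have e4 : (1:ℝ) - 2 / 3 = 1 / 3 := by norm_num
    have e5 : (2 * (2 / 3) + 2 / 3 - 1 : ℝ) = 1 / 3 + 2 / 3 := by norm_num
    have e6 : (2 : ℝ) / 3 = 1 / 3 + 1 / 3 := by norm_num
    rw [e4, e5, Real.rpow_add hN0]
    conv_rhs => rw [e6, Real.rpow_add hM'0, ← e6]
    have i1 : N ^ ((1:ℝ) / 3) ≤ M' ^ ((1:ℝ) / 3) := Real.rpow_le_rpow hN0.le hNM' (by norm_num)
    have := mul_le_mul_of_nonneg_left i1 (show 0 ≤ M' ^ ((1:ℝ) / 3) * N ^ ((2:ℝ) / 3) by positivity)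
    linarith
  have hM's : M' ≤ M + N ^ ξ' := by
    have i1 : N ^ y ≤ N ^ ξ' := Real.rpow_le_rpow_of_exponent_le hN (by rw [e1]; linarith)
    have i2 : 0 ≤ N ^ ξ' := by positivity
    rw [hM']
    exact max_le (by linarith) (by linarith)
  have e2' : M' + ∑ i, M' ^ (1 - pE ξ i) * N ^ (2 * pE ξ i + qE i - 1) ≤
      4 * (M + N ^ ξ' + (M * N) ^ ((2:ℝ) / 3)) := by
    rw [Fin.sum_univ_three]
    simp only [pE, qE, Matrix.cons_val_zero, Matrix.cons_val_one, Matrix.cons_val]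
    have : 0 ≤ (M * N) ^ ((2:ℝ) / 3) := by positivity
    linarith only [hB, hCc, hDd, hM's, this, hM0]
  calc _ ≤ C * (M * N) ^ ε * (4 * (M + N ^ ξ' + (M * N) ^ ((2:ℝ) / 3))) := by
        refine mul_le_mul (mul_le_mul_of_nonneg_left e3 hC.le) e2' ?_ (by positivity)
        positivity
    _ = _ := by ring

lemma LS_seq (k : ℕ) : LS (4 / 3 + (2 / 3) ^ (k + 1)) := by
  induction k with
  | zero => convert LS_two using 1; norm_num
  | succ k ih =>
    have h0 : (0:ℝ) < (2 / 3) ^ (k + 1) := by positivity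
    have h1 : ((2:ℝ) / 3) ^ (k + 1) ≤ 2 / 3 := by
      rw [pow_succ]; exact mul_le_of_le_one_left (by norm_num) (pow_le_one₀ (by norm_num) (by norm_num))
    refine (LS_iter (by linarith) (by linarith) ih).mono ?_
    rw [pow_succ (2 / 3 : ℝ) (k + 1)]
    generalize ((2:ℝ) / 3) ^ (k + 1) = t at h0 h1
    rw [sub_le_iff_le_add, ← sub_le_iff_le_add', le_div_iff₀ (by linarith)]
    nlinarith

lemma LS_lim : LS (4 / 3) := by
  intro ε hε
  obtain ⟨k, hk⟩ := exists_pow_lt_of_lt_one (show 0 < ε / 2 by positivity) (show (2 / 3 : ℝ) < 1 by norm_num)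
  have hk' : ((2:ℝ) / 3) ^ (k + 1) ≤ ε / 2 := by
    rw [pow_succ]
    have : (0:ℝ) < (2 / 3) ^ k := by positivity
    linarith
  obtain ⟨C, hC, H⟩ := (LS_seq k).mono (ξ' := 4 / 3 + ε / 2) (by linarith) (ε / 2) (by positivity)
  refine ⟨C, hC, fun χ hχ M N hM hN c => (H χ hχ M N hM hN c).trans ?_⟩
  have hM0 : 0 < M := by linarith
  have hN0 : 0 < N := by linarith
  refine mul_le_mul_of_nonneg_right ?_ (Finset.sum_nonneg fun _ _ => sq_nonneg _)
  have hMN : 1 ≤ M * N := by nlinarith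
  have e1 : (M * N) ^ ε = (M * N) ^ (ε / 2) * (M * N) ^ (ε / 2) := by
    rw [← Real.rpow_add (by positivity)]; congr 1; ring
  rw [e1, ← mul_assoc C, mul_assoc (C * _)]
  refine mul_le_mul_of_nonneg_left ?_ (by positivity)
  have i1 : 1 ≤ (M * N) ^ (ε / 2) := Real.one_le_rpow hMN (by positivity)
  have i2 : N ^ (ε / 2) ≤ (M * N) ^ (ε / 2) := Real.rpow_le_rpow hN0.le (by nlinarith) (by positivity)
  rw [Real.rpow_add hN0, mul_add, mul_add]
  have i3 : 0 ≤ (M * N) ^ ((2:ℝ) / 3) := by positivity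
  have i4 : 0 ≤ N ^ ((4:ℝ) / 3) := by positivity
  refine add_le_add (add_le_add ?_ ?_) ?_
  · nlinarith
  · rw [mul_comm]; exact mul_le_mul_of_nonneg_right i2 i4
  · nlinarith

/-- Heath-Brown's cubic large sieve -/
lemma heath_brown {ε : ℝ} (hε : 0 < ε) : ∃ C : ℝ, 0 < C ∧ ∀ χ, IsCubicSymbol χ → ∀ M N : ℝ, 1 ≤ M → 1 ≤ N →
    ∀ c : Eis → ℂ, ∑ m ∈ SF M, ‖∑ n ∈ SF N, c n * Xc χ n m‖ ^ 2 ≤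
    C * (M * N) ^ ε * (M + N + (M * N) ^ ((2:ℝ) / 3)) * ∑ n ∈ SF N, ‖c n‖ ^ 2 := by
  obtain ⟨C₁, hC₁, H1⟩ := LS_lim ε hε
  obtain ⟨C₂, hC₂, H2⟩ := LS_lim.dual hε
  refine ⟨2 * (C₁ + C₂), by positivity, ?_⟩
  intro χ hχ M N hM hN c
  have hM0 : 0 < M := by linarith
  have hN0 : 0 < N := by linarith
  have key : ∀ x z : ℝ, 0 < x → x ≤ z → x ^ ((4:ℝ) / 3) ≤ (z * x) ^ ((2:ℝ) / 3) := by
    intro x z hx hxz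
    have : x ^ ((4:ℝ) / 3) = (x * x) ^ ((2:ℝ) / 3) := by
      rw [Real.mul_rpow hx.le hx.le, ← Real.rpow_add hx]; norm_num
    rw [this]
    exact Real.rpow_le_rpow (by positivity) (mul_le_mul_of_nonneg_right hxz hx.le) (by norm_num)
  have hS : 0 ≤ ∑ n ∈ SF N, ‖c n‖ ^ 2 := Finset.sum_nonneg fun _ _ => sq_nonneg _
  have hP : 0 ≤ (M * N) ^ ε := by positivity
  have hP2 : 0 ≤ (M * N) ^ ((2:ℝ) / 3) := by positivity
  rcases le_total N M with h | h
  · refine (H1 χ hχ M N hM hN c).trans (mul_le_mul_of_nonneg_right ?_ hS)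
    have := key N M hN0 h
    calc _ ≤ C₁ * (M * N) ^ ε * (2 * (M + N + (M * N) ^ ((2:ℝ) / 3))) :=
          mul_le_mul_of_nonneg_left (by linarith) (by positivity)
      _ ≤ _ := by
          have : 0 ≤ C₂ * (M * N) ^ ε * (2 * (M + N + (M * N) ^ ((2:ℝ) / 3))) := by positivity
          linarith only [this]
  · refine (H2 χ hχ M N hM hN c).trans (mul_le_mul_of_nonneg_right ?_ hS)
    have := key M N hM0 h
    rw [mul_comm N M] at this
    calc _ ≤ C₂ * (M * N) ^ ε * (2 * (M + N + (M * N) ^ ((2:ℝ) / 3))) :=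
          mul_le_mul_of_nonneg_left (by linarith) (by positivity)
      _ ≤ _ := by
          have : 0 ≤ C₁ * (M * N) ^ ε * (2 * (M + N + (M * N) ^ ((2:ℝ) / 3))) := by positivity
          linarith only [this]

end

/-! ### Part 22: reduction of the Dirichlet polynomial to squarefree coefficients -/
section
variable {χ : Eis → Eis → Eis}

lemma sq_decomp_Pr {x : Eis} (hx : Pr x) : ∃ s t : Eis, Pr s ∧ Squarefree s ∧ Pr t ∧ x = t ^ 2 * s := by
  induction hx using Pr.induction with
  | h1 => exact ⟨1, 1, Pr_one, squarefree_one, Pr_one, by simp⟩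
  | hmul p x hp hpr hx ih =>
    obtain ⟨s, t, hs, hs', ht, rfl⟩ := ih
    by_cases h1 : p ∣ s
    · obtain ⟨s1, rfl⟩ := h1
      exact ⟨s1, p * t, hpr.cofactor hs, sf_right hs', hpr.mul ht, by ring⟩
    · exact ⟨p * s, t, hpr.mul hs, sf_prime_mul hp hs' h1, ht, by ring⟩

lemma Rep_decomp {b : Eis} (hb : Rep b) : ∃ (i : Fin 2) (u s : Eis), u ≠ 0 ∧ Pr s ∧ Squarefree s ∧
    b = lam ^ (i : ℕ) * u ^ 2 * s := by
  obtain ⟨k, c, hc, rfl⟩ := hb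
  obtain ⟨s, t, hs, hs', ht, rfl⟩ := sq_decomp_Pr hc
  refine ⟨⟨k % 2, Nat.mod_lt _ (by norm_num)⟩, lam ^ (k / 2) * t, s,
    mul_ne_zero (pow_ne_zero _ lam_ne_zero) ht.ne_zero, hs, hs', ?_⟩
  have : lam ^ k = lam ^ (k % 2) * (lam ^ (k / 2)) ^ 2 := by
    rw [← pow_mul, ← pow_add]; congr 1; omega
  rw [this]; ring

lemma Rep.ne_zero {b : Eis} (hb : Rep b) : b ≠ 0 := by
  obtain ⟨k, c, hc, rfl⟩ := hb
  exact mul_ne_zero (pow_ne_zero _ lam_ne_zero) (Pr.ne_zero hc)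

/-- finite set of Rep elements -/
def RB (R : ℝ) : Finset Eis :=
  (Set.Finite.subset (finite_ball R) (t := {b : Eis | Rep b ∧ Nm b ≤ R}) (fun _ h => h.2)).toFinset

lemma mem_RB {R : ℝ} {b : Eis} : b ∈ RB R ↔ Rep b ∧ Nm b ≤ R := by
  simp [RB]

/-- nonzero ball -/
def NB (R : ℝ) : Finset Eis :=
  (Set.Finite.subset (finite_ball R) (t := {b : Eis | b ≠ 0 ∧ Nm b ≤ R}) (fun _ h => h.2)).toFinset

lemma mem_NB {R : ℝ} {b : Eis} : b ∈ NB R ↔ b ≠ 0 ∧ Nm b ≤ R := by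
  simp [NB]

lemma Rpoly_eq (χ : Eis → Eis → Eis) (a : Eis → ℂ) (R : ℝ) (q : Eis) :
    Rpoly χ a R q = ∑ b ∈ RB R, a b * Xc χ q b * ((Real.sqrt (Nm b) : ℂ))⁻¹ := by
  rw [Rpoly]
  exact finsum_mem_eq_sum_of_inter_support_eq _ (by
    ext b; simp [mem_RB])

lemma Rpoly_reduce {ε : ℝ} (hε : 0 < ε) : ∃ C : ℝ, 0 < C ∧ ∀ χ, IsCubicSymbol χ → ∀ (a : Eis → ℂ) (R A B : ℝ)
    (T : Finset Eis), 1 ≤ R → 0 ≤ A → 0 ≤ B → (∀ b, Rep b → Nm b ≤ R → ‖a b‖ ≤ A) → (∀ q ∈ T, Pr q) →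
    (∀ c : Eis → ℂ, ∑ q ∈ T, ‖∑ s ∈ SF R, c s * Xc χ q s‖ ^ 2 ≤ B * ∑ s ∈ SF R, ‖c s‖ ^ 2) →
    ∑ q ∈ T, ‖Rpoly χ a R q‖ ^ 2 ≤ C * R ^ (3 * ε) * A ^ 2 * B := by
  classical
  obtain ⟨C, hC, H⟩ := sum_Nm_pow hε
  refine ⟨4 * C ^ 3, by positivity, ?_⟩
  intro χ hχ a R A B T hR hA hB ha hT hB'
  have hR0 : 0 ≤ R := by linarith
  have hinv : ∀ U : Finset Eis, (∀ x ∈ U, x ≠ 0 ∧ Nm x ≤ R) → ∑ x ∈ U, (Nm x)⁻¹ ≤ C * R ^ ε := by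
    intro U hU
    have h := H 1 R U (by linarith) hU hR0
    simp only [Real.rpow_neg_one, add_sub_cancel_left] at h
    exact h
  have hdec : ∀ b, ∃ x : Fin 2 × Eis × Eis, Rep b → x.2.1 ≠ 0 ∧ Pr x.2.2 ∧ Squarefree x.2.2 ∧
      b = lam ^ (x.1 : ℕ) * x.2.1 ^ 2 * x.2.2 := by
    intro b
    by_cases hb : Rep b
    · obtain ⟨i, u, s, h⟩ := Rep_decomp hb
      exact ⟨(i, u, s), fun _ => h⟩
    · exact ⟨(0, 0, 0), fun h => absurd h hb⟩
  choose D hD using hdec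
  obtain ⟨pr, hpr⟩ : ∃ pr : Eis → Fin 2 × Eis, pr = fun b => ((D b).1, (D b).2.1) := ⟨_, rfl⟩
  obtain ⟨sO, hsO⟩ : ∃ sO : Eis → Eis, sO = fun b => (D b).2.2 := ⟨_, rfl⟩
  obtain ⟨w, hw⟩ : ∃ w : Fin 2 × Eis → Eis, w = fun p => lam ^ (p.1 : ℕ) * p.2 ^ 2 := ⟨_, rfl⟩
  have hb1 : ∀ b, Rep b → (pr b).2 ≠ 0 ∧ Pr (sO b) ∧ Squarefree (sO b) ∧ b = w (pr b) * sO b := by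
    intro b hb
    have := hD b hb
    subst hpr hsO hw
    exact this
  have hwN : ∀ p : Fin 2 × Eis, Nm p.2 ^ 2 ≤ Nm (w p) := by
    intro p
    rw [hw]
    simp only [Nm_mul, Nm_pow, Nm_lam]
    have : (1:ℝ) ≤ 3 ^ (p.1 : ℕ) := one_le_pow₀ (by norm_num)
    nlinarith [sq_nonneg (Nm p.2)]
  have hw0 : ∀ p : Fin 2 × Eis, p.2 ≠ 0 → w p ≠ 0 := by
    intro p hp
    rw [hw]
    exact mul_ne_zero (pow_ne_zero _ lam_ne_zero) (pow_ne_zero _ hp)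
  obtain ⟨P, hP⟩ : ∃ P : Finset (Fin 2 × Eis), P = Finset.univ ×ˢ NB R := ⟨_, rfl⟩
  have hmaps : ∀ b ∈ RB R, pr b ∈ P := by
    intro b hb
    obtain ⟨hb, hbR⟩ := mem_RB.1 hb
    obtain ⟨h1, h2, h3, h4⟩ := hb1 b hb
    rw [hP, Finset.mem_product]
    refine ⟨Finset.mem_univ _, mem_NB.2 ⟨h1, ?_⟩⟩
    have e : Nm b = Nm (w (pr b)) * Nm (sO b) := by rw [← Nm_mul, ← h4]
    have h5 := one_le_Nm h2.ne_zero
    have h6 := one_le_Nm h1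
    have h7 := hwN (pr b)
    nlinarith
  obtain ⟨K, hK⟩ : ∃ K : Fin 2 × Eis → Eis → ℂ, K = fun p s =>
    if w p * s ∈ RB R ∧ pr (w p * s) = p ∧ sO (w p * s) = s then a (w p * s) * ((Real.sqrt (Nm s) : ℂ))⁻¹ else 0 :=
    ⟨_, rfl⟩
  have hfib : ∀ q ∈ T, ∀ p ∈ P, ∑ b ∈ RB R with pr b = p, a b * Xc χ q b * ((Real.sqrt (Nm b) : ℂ))⁻¹
      = (Xc χ q (w p) * ((Real.sqrt (Nm (w p)) : ℂ))⁻¹) * ∑ s ∈ SF R, K p s * Xc χ q s := by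
    intro q hq p hp
    have e1 : ∑ s ∈ SF R, K p s * Xc χ q s = ∑ s ∈ SF R with (w p * s ∈ RB R ∧ pr (w p * s) = p ∧ sO (w p * s) = s),
        a (w p * s) * ((Real.sqrt (Nm s) : ℂ))⁻¹ * Xc χ q s := by
      rw [Finset.sum_filter]
      refine Finset.sum_congr rfl fun s _ => ?_
      rw [hK]
      simp only
      split_ifs <;> simp
    rw [e1, Finset.mul_sum]
    symm
    refine Finset.sum_bij' (fun s _ => w p * s) (fun b _ => sO b) ?_ ?_ ?_ ?_ ?_
    · intro s hs
      obtain ⟨_, h1, h2, h3⟩ := Finset.mem_filter.1 hs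
      exact Finset.mem_filter.2 ⟨h1, h2⟩
    · intro b hb
      obtain ⟨h1, h2⟩ := Finset.mem_filter.1 hb
      obtain ⟨g1, g2, g3, g4⟩ := hb1 b (mem_RB.1 h1).1
      rw [h2] at g4
      refine Finset.mem_filter.2 ⟨mem_SF.2 ⟨?_, g2, g3⟩, ?_⟩
      · have hp0 : p.2 ≠ 0 := h2 ▸ g1
        have := one_le_Nm (hw0 p hp0)
        have h5 := (mem_RB.1 h1).2
        rw [g4, Nm_mul] at h5
        nlinarith [Nm_nonneg (sO b)]
      · rw [← g4]; exact ⟨h1, h2, rfl⟩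
    · intro s hs
      exact (Finset.mem_filter.1 hs).2.2.2
    · intro b hb
      obtain ⟨h1, h2⟩ := Finset.mem_filter.1 hb
      obtain ⟨g1, g2, g3, g4⟩ := hb1 b (mem_RB.1 h1).1
      rw [h2] at g4
      exact g4.symm
    · intro s hs
      rw [Xc_mul_top hχ (hT q hq), Nm_mul, Real.sqrt_mul (Nm_nonneg _)]
      push_cast
      rw [mul_inv]
      ring
  have hKb : ∀ p, ∀ s ∈ SF R, ‖K p s‖ ^ 2 ≤ A ^ 2 * (Nm s)⁻¹ := by
    intro p s hs
    rw [hK]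
    simp only
    split_ifs with h
    · rw [norm_mul, mul_pow, norm_inv, Complex.norm_real, Real.norm_of_nonneg (Real.sqrt_nonneg _), inv_pow,
        Real.sq_sqrt (Nm_nonneg _)]
      refine mul_le_mul_of_nonneg_right ?_ (inv_nonneg.2 (Nm_nonneg _))
      have h2 := mem_RB.1 h.1
      exact pow_le_pow_left₀ (norm_nonneg _) (ha _ h2.1 h2.2) 2
    · rw [norm_zero]
      have h1 := mul_nonneg (sq_nonneg A) (inv_nonneg.2 (Nm_nonneg s))
      simpa using h1
  have hKs : ∀ p, ∑ s ∈ SF R, ‖K p s‖ ^ 2 ≤ A ^ 2 * (C * R ^ ε) := by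
    intro p
    refine (Finset.sum_le_sum (hKb p)).trans ?_
    rw [← Finset.mul_sum]
    exact mul_le_mul_of_nonneg_left (hinv _ fun x hx => ⟨(mem_SF.1 hx).2.1.ne_zero, (mem_SF.1 hx).1⟩) (sq_nonneg A)
  have hF : ∑ p ∈ P, (Nm p.2)⁻¹ ≤ 2 * (C * R ^ ε) := by
    rw [hP, Finset.sum_product]
    simp only [Finset.sum_const, Finset.card_univ, Fintype.card_fin, nsmul_eq_mul, Nat.cast_ofNat]
    exact mul_le_mul_of_nonneg_left (hinv _ fun x hx => mem_NB.1 hx) (by norm_num)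
  have hpt : ∀ q ∈ T, ‖Rpoly χ a R q‖ ^ 2 ≤ (2 * (C * R ^ ε)) *
      ∑ p ∈ P, (Nm p.2)⁻¹ * ‖∑ s ∈ SF R, K p s * Xc χ q s‖ ^ 2 := by
    intro q hq
    rw [Rpoly_eq, ← Finset.sum_fiberwise_of_maps_to hmaps]
    have h1 : ‖∑ p ∈ P, ∑ b ∈ RB R with pr b = p, a b * Xc χ q b * ((Real.sqrt (Nm b) : ℂ))⁻¹‖ ≤
        ∑ p ∈ P, (Nm p.2)⁻¹ * ‖∑ s ∈ SF R, K p s * Xc χ q s‖ := by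
      refine (norm_sum_le _ _).trans (Finset.sum_le_sum fun p hp => ?_)
      rw [hfib q hq p hp, norm_mul]
      refine mul_le_mul_of_nonneg_right ?_ (norm_nonneg _)
      rw [norm_mul, norm_inv, Complex.norm_real, Real.norm_of_nonneg (Real.sqrt_nonneg _)]
      have hp0 : p.2 ≠ 0 := by
        rw [hP, Finset.mem_product] at hp
        exact (mem_NB.1 hp.2).1
      have h2 : Nm p.2 ≤ Real.sqrt (Nm (w p)) := Real.le_sqrt_of_sq_le (hwN p)
      calc _ ≤ 1 * (Real.sqrt (Nm (w p)))⁻¹ :=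
            mul_le_mul_of_nonneg_right (Xc_norm_le hχ (hT q hq) _) (inv_nonneg.2 (Real.sqrt_nonneg _))
        _ ≤ (Nm p.2)⁻¹ := by rw [one_mul]; exact inv_anti₀ (Nm_pos hp0) h2
    refine (pow_le_pow_left₀ (norm_nonneg _) h1 2).trans ?_
    refine (Finset.sum_sq_le_sum_mul_sum_of_sq_le_mul P (f := fun p => (Nm p.2)⁻¹)
      (g := fun p => (Nm p.2)⁻¹ * ‖∑ s ∈ SF R, K p s * Xc χ q s‖ ^ 2) ?_ ?_ ?_).trans ?_
    · exact fun p _ => inv_nonneg.2 (Nm_nonneg _)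
    · exact fun p _ => mul_nonneg (inv_nonneg.2 (Nm_nonneg _)) (sq_nonneg _)
    · intro p _; exact le_of_eq (by ring)
    · exact mul_le_mul_of_nonneg_right hF
        (Finset.sum_nonneg fun p _ => mul_nonneg (inv_nonneg.2 (Nm_nonneg _)) (sq_nonneg _))
  have hCR : 0 ≤ C * R ^ ε := by positivity
  calc ∑ q ∈ T, ‖Rpoly χ a R q‖ ^ 2 ≤ ∑ q ∈ T, (2 * (C * R ^ ε)) *
      ∑ p ∈ P, (Nm p.2)⁻¹ * ‖∑ s ∈ SF R, K p s * Xc χ q s‖ ^ 2 := Finset.sum_le_sum hpt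
    _ = (2 * (C * R ^ ε)) * ∑ p ∈ P, (Nm p.2)⁻¹ * ∑ q ∈ T, ‖∑ s ∈ SF R, K p s * Xc χ q s‖ ^ 2 := by
        rw [← Finset.mul_sum, Finset.sum_comm]
        simp only [Finset.mul_sum]
    _ ≤ (2 * (C * R ^ ε)) * ∑ p ∈ P, (Nm p.2)⁻¹ * (B * (A ^ 2 * (C * R ^ ε))) := by
        refine mul_le_mul_of_nonneg_left (Finset.sum_le_sum fun p _ => ?_) (by linarith only [hCR])
        refine mul_le_mul_of_nonneg_left ?_ (inv_nonneg.2 (Nm_nonneg _))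
        exact (hB' (K p)).trans (mul_le_mul_of_nonneg_left (hKs p) hB)
    _ = (2 * (C * R ^ ε)) * ((∑ p ∈ P, (Nm p.2)⁻¹) * (B * (A ^ 2 * (C * R ^ ε)))) := by
        rw [Finset.sum_mul]
    _ ≤ (2 * (C * R ^ ε)) * ((2 * (C * R ^ ε)) * (B * (A ^ 2 * (C * R ^ ε)))) := by
        refine mul_le_mul_of_nonneg_left (mul_le_mul_of_nonneg_right hF ?_) (by linarith only [hCR])
        exact mul_nonneg hB (mul_nonneg (sq_nonneg A) hCR)
    _ = 4 * C ^ 3 * R ^ (3 * ε) * A ^ 2 * B := by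
        have : R ^ (3 * ε) = (R ^ ε) ^ 3 := by
          rw [← Real.rpow_natCast, ← Real.rpow_mul hR0]; congr 1; push_cast; ring
        rw [this]; ring

end

/-! ### Part 23: the bilinear bound over conductors and the final theorem -/
section
variable {χ : Eis → Eis → Eis}

lemma pair_bound {ε κ : ℝ} (hε : 0 < ε) (hκ : 2 ≤ κ) : ∃ C : ℝ, 0 < C ∧ ∀ χ, IsCubicSymbol χ → ∀ (P S R : ℝ)
    (T : Finset Eis) (x y : Eis → Eis) (φ : Eis → Eis → Eis) (c : Eis → ℂ) (k : Eis → Eis → ℂ),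
    1 / 2 ≤ P → 1 / 2 ≤ S → 1 ≤ R → (∀ q ∈ T, x q ∈ SF (κ * S)) → (∀ q ∈ T, y q ∈ SF (κ * P)) →
    (∀ q ∈ T, q = φ (x q) (y q)) → (∀ q ∈ T, ∀ s, ‖k (y q) s‖ ≤ ‖c s‖) →
    (∀ q ∈ T, ‖∑ s ∈ SF R, c s * Xc χ q s‖ = ‖∑ s ∈ SF R, k (y q) s * Xc χ (x q) s‖) →
    ∑ q ∈ T, ‖∑ s ∈ SF R, c s * Xc χ q s‖ ^ 2 ≤
      C * (R * S * P) ^ ε * (P * S + P * R + P ^ ((1:ℝ) / 3) * (P * S * R) ^ ((2:ℝ) / 3)) *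
        ∑ s ∈ SF R, ‖c s‖ ^ 2 := by
  classical
  obtain ⟨C₁, hC₁, H1⟩ := heath_brown hε
  obtain ⟨C₂, hC₂, H2⟩ := card_le hε
  have hκ0 : 0 < κ := by linarith
  refine ⟨C₂ * C₁ * (κ ^ 2 * (κ ^ 2) ^ ε), by positivity, ?_⟩
  intro χ hχ P S R T x y φ c k hP hS hR hx hy hφ hk hT
  have hP0 : 0 < P := by linarith
  have hS0 : 0 < S := by linarith
  have hR0 : 0 < R := by linarith
  obtain ⟨M, hM⟩ : ∃ M, M = κ * S := ⟨_, rfl⟩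
  obtain ⟨L, hL⟩ : ∃ L, L = κ * P := ⟨_, rfl⟩
  have hM1 : 1 ≤ M := by rw [hM]; nlinarith
  have hL1 : 1 ≤ L := by rw [hL]; nlinarith
  have hM0 : 0 < M := by linarith
  have hL0 : 0 < L := by linarith
  rw [← hM] at hx
  rw [← hL] at hy
  obtain ⟨N, hN⟩ : ∃ N, N = ∑ s ∈ SF R, ‖c s‖ ^ 2 := ⟨_, rfl⟩
  have hN0 : 0 ≤ N := by rw [hN]; exact Finset.sum_nonneg fun _ _ => sq_nonneg _
  obtain ⟨Y, hY⟩ : ∃ Y, Y = T.image y := ⟨_, rfl⟩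
  have hYc : (Y.card : ℝ) ≤ C₂ * L ^ (1 + ε) := by
    refine H2 L Y ?_ hL0.le
    intro z hz
    rw [hY] at hz
    obtain ⟨q, hq, rfl⟩ := Finset.mem_image.1 hz
    have := mem_SF.1 (hy q hq)
    exact ⟨this.2.1.ne_zero, this.1⟩
  have hin : ∀ z ∈ Y, ∑ m ∈ SF M, ‖∑ s ∈ SF R, k z s * Xc χ m s‖ ^ 2 ≤
      C₁ * (M * R) ^ ε * (M + R + (M * R) ^ ((2:ℝ) / 3)) * N := by
    intro z hz
    have h1 := H1 χ hχ M R hM1 hR (k z)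
    have e : ∑ m ∈ SF M, ‖∑ s ∈ SF R, k z s * Xc χ m s‖ ^ 2 = ∑ m ∈ SF M, ‖∑ s ∈ SF R, k z s * Xc χ s m‖ ^ 2 := by
      refine Finset.sum_congr rfl fun m hm => ?_
      congr 2
      refine Finset.sum_congr rfl fun s hs => ?_
      rw [Xc_recip hχ (mem_SF.1 hm).2.1 (mem_SF.1 hs).2.1]
    rw [e]
    refine h1.trans (mul_le_mul_of_nonneg_left ?_ (by positivity))
    rw [hN]
    refine Finset.sum_le_sum fun s _ => pow_le_pow_left₀ (norm_nonneg _) ?_ 2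
    rw [hY] at hz
    obtain ⟨q, hq, rfl⟩ := Finset.mem_image.1 hz
    exact hk q hq s
  have hsum : ∑ q ∈ T, ‖∑ s ∈ SF R, c s * Xc χ q s‖ ^ 2 ≤
      ∑ z ∈ Y, ∑ m ∈ SF M, ‖∑ s ∈ SF R, k z s * Xc χ m s‖ ^ 2 := by
    rw [← Finset.sum_product']
    have e : ∑ q ∈ T, ‖∑ s ∈ SF R, c s * Xc χ q s‖ ^ 2 =
        ∑ q ∈ T, (fun p : Eis × Eis => ‖∑ s ∈ SF R, k p.1 s * Xc χ p.2 s‖ ^ 2) (y q, x q) :=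
      Finset.sum_congr rfl fun q hq => by rw [hT q hq]
    rw [e, ← Finset.sum_image (f := fun p : Eis × Eis => ‖∑ s ∈ SF R, k p.1 s * Xc χ p.2 s‖ ^ 2)
      (g := fun q => (y q, x q))]
    · refine Finset.sum_le_sum_of_subset_of_nonneg ?_ fun _ _ _ => sq_nonneg _
      intro p hp
      obtain ⟨q, hq, rfl⟩ := Finset.mem_image.1 hp
      refine Finset.mem_product.2 ⟨?_, hx q hq⟩
      rw [hY]
      exact Finset.mem_image_of_mem y hq
    · intro q hq q' hq' h
      have h' := Prod.ext_iff.1 h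
      simp only at h'
      rw [hφ q hq, hφ q' hq', h'.1, h'.2]
  refine hsum.trans ((Finset.sum_le_sum hin).trans ?_)
  rw [Finset.sum_const, nsmul_eq_mul, ← hN, ← mul_assoc]
  refine mul_le_mul_of_nonneg_right ?_ hN0
  have hG : M + R + (M * R) ^ ((2:ℝ) / 3) ≤ κ * (S + R + (S * R) ^ ((2:ℝ) / 3)) := by
    have h1 : (M * R) ^ ((2:ℝ) / 3) ≤ κ * (S * R) ^ ((2:ℝ) / 3) := by
      rw [hM, mul_assoc, Real.mul_rpow hκ0.le (by positivity)]
      refine mul_le_mul_of_nonneg_right ?_ (by positivity)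
      calc κ ^ ((2:ℝ) / 3) ≤ κ ^ (1:ℝ) := Real.rpow_le_rpow_of_exponent_le (by linarith) (by norm_num)
        _ = κ := Real.rpow_one κ
    have h2 : R ≤ κ * R := by nlinarith
    rw [hM] at h1 ⊢
    linarith
  have hE : P * (S + R + (S * R) ^ ((2:ℝ) / 3)) = P * S + P * R + P ^ ((1:ℝ) / 3) * (P * S * R) ^ ((2:ℝ) / 3) := by
    have : P ^ ((1:ℝ) / 3) * (P * S * R) ^ ((2:ℝ) / 3) = P * (S * R) ^ ((2:ℝ) / 3) := by
      rw [mul_assoc P S R, Real.mul_rpow hP0.le (by positivity), ← mul_assoc, ← Real.rpow_add hP0]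
      norm_num
    rw [this]; ring
  have hLε : L ^ (1 + ε) * (M * R) ^ ε = κ * P * ((κ ^ 2) ^ ε * (R * S * P) ^ ε) := by
    rw [Real.rpow_add hL0, Real.rpow_one, mul_assoc, ← Real.mul_rpow hL0.le (by positivity),
      ← Real.mul_rpow (by positivity) (by positivity), hL, hM]
    congr 2
    ring
  calc (Y.card : ℝ) * (C₁ * (M * R) ^ ε * (M + R + (M * R) ^ ((2:ℝ) / 3)))
      ≤ (C₂ * L ^ (1 + ε)) * (C₁ * (M * R) ^ ε * (κ * (S + R + (S * R) ^ ((2:ℝ) / 3)))) := by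
        refine mul_le_mul hYc (mul_le_mul_of_nonneg_left hG (by positivity)) (by positivity) (by positivity)
    _ = C₂ * C₁ * κ * (L ^ (1 + ε) * (M * R) ^ ε) * (S + R + (S * R) ^ ((2:ℝ) / 3)) := by ring
    _ = C₂ * C₁ * (κ ^ 2 * (κ ^ 2) ^ ε) * (R * S * P) ^ ε * (P * (S + R + (S * R) ^ ((2:ℝ) / 3))) := by
        rw [hLε]; ring
    _ ≤ _ := by rw [hE]

lemma family_bound {ε κ : ℝ} (hε : 0 < ε) (hκ : 2 ≤ κ) : ∃ C : ℝ, 0 < C ∧ ∀ χ, IsCubicSymbol χ → ∀ (Q₁ Q₂ R : ℝ)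
    (T : Finset Eis), 1 / 2 ≤ Q₁ → 1 / 2 ≤ Q₂ → 1 ≤ R →
    (∀ q ∈ T, ∃ q₁ ∈ SF (κ * Q₁), ∃ q₂ ∈ SF (κ * Q₂), q = q₁ * q₂ ^ 2) → ∀ c : Eis → ℂ,
    ∑ q ∈ T, ‖∑ s ∈ SF R, c s * Xc χ q s‖ ^ 2 ≤
      C * (R * Q₁ * Q₂) ^ ε *
        (Q₁ * Q₂ + min Q₁ Q₂ * R + (min Q₁ Q₂) ^ ((1:ℝ) / 3) * (Q₁ * Q₂ * R) ^ ((2:ℝ) / 3)) *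
        ∑ s ∈ SF R, ‖c s‖ ^ 2 := by
  obtain ⟨C, hC, H⟩ := pair_bound hε hκ
  refine ⟨C, hC, ?_⟩
  intro χ hχ Q₁ Q₂ R T hQ₁ hQ₂ hR hT c
  have hch : ∀ q, ∃ p : Eis × Eis, q ∈ T → p.1 ∈ SF (κ * Q₁) ∧ p.2 ∈ SF (κ * Q₂) ∧ q = p.1 * p.2 ^ 2 := by
    intro q
    by_cases hq : q ∈ T
    · obtain ⟨q₁, h1, q₂, h2, h3⟩ := hT q hq
      exact ⟨(q₁, q₂), fun _ => ⟨h1, h2, h3⟩⟩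
    · exact ⟨(0, 0), fun h => absurd h hq⟩
  choose p hp using hch
  have hX : ∀ q ∈ T, ∀ s, Xc χ q s = Xc χ (p q).1 s * (starRingEnd ℂ) (Xc χ (p q).2 s) := by
    intro q hq s
    obtain ⟨h1, h2, h3⟩ := hp q hq
    have g1 := (mem_SF.1 h1).2.1
    have g2 := (mem_SF.1 h2).2.1
    rw [← Xc_sq_bot hχ g2]
    conv_lhs => rw [h3]
    rw [pow_two, Xc_mul_bot hχ g1 (g2.mul g2), Xc_mul_bot hχ g2 g2, pow_two]
  rcases le_total Q₂ Q₁ with hQ | hQ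
  · rw [min_eq_right hQ]
    have h := H χ hχ Q₂ Q₁ R T (fun q => (p q).1) (fun q => (p q).2) (fun x y => x * y ^ 2) c
      (fun y s => c s * (starRingEnd ℂ) (Xc χ y s)) hQ₂ hQ₁ hR (fun q hq => (hp q hq).1) (fun q hq => (hp q hq).2.1)
      (fun q hq => (hp q hq).2.2) ?_ ?_
    · rw [mul_comm Q₂ Q₁] at h; exact h
    · intro q hq s
      rw [norm_mul, RCLike.norm_conj]
      exact mul_le_of_le_one_right (norm_nonneg _) (Xc_norm_le hχ (mem_SF.1 (hp q hq).2.1).2.1 s)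
    · intro q hq
      congr 1
      refine Finset.sum_congr rfl fun s _ => ?_
      rw [hX q hq s]; ring
  · rw [min_eq_left hQ]
    have h := H χ hχ Q₁ Q₂ R T (fun q => (p q).2) (fun q => (p q).1) (fun x y => y * x ^ 2) c
      (fun y s => (starRingEnd ℂ) (c s * Xc χ y s)) hQ₁ hQ₂ hR (fun q hq => (hp q hq).2.1) (fun q hq => (hp q hq).1)
      (fun q hq => (hp q hq).2.2) ?_ ?_
    · rw [mul_right_comm R Q₂ Q₁] at h; exact h
    · intro q hq s
      rw [RCLike.norm_conj, norm_mul]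
      exact mul_le_of_le_one_right (norm_nonneg _) (Xc_norm_le hχ (mem_SF.1 (hp q hq).1).2.1 s)
    · intro q hq
      rw [← RCLike.norm_conj, map_sum]
      congr 1
      refine Finset.sum_congr rfl fun s _ => ?_
      rw [hX q hq s]; simp; ring

end

/-- Proposition 4.1, cubic large sieve with decaying coefficients:
`∑_{q ∈ F₃(Q₁,Q₂)} |ℛ(q)|² ≪_ε (RQ₁Q₂)^ε (Q₁Q₂ + Q*R + (Q*)^{1/3}(Q₁Q₂R)^{2/3})`. -/
theorem cubic_large_sieve_decaying
    (c₁ c₂ : ℝ) (hc₁ : 0 < c₁) (hc₁₂ : c₁ ≤ c₂)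
    (Ca : ℝ → ℝ) (ε : ℝ) (hε : 0 < ε) :
    ∃ C : ℝ, ∀ (χ : Eis → Eis → Eis), IsCubicSymbol χ →
      ∀ a : Eis → ℂ,
        (∀ ε' : ℝ, 0 < ε' → ∀ b : Eis, ‖a b‖ ≤ Ca ε' * Nm b ^ ε') →
      ∀ Q₁ Q₂ R : ℝ, 1/2 ≤ Q₁ → 1/2 ≤ Q₂ → 1/2 ≤ R →
        (∑ᶠ q ∈ {q : Eis | memF₃Q c₁ c₂ Q₁ Q₂ q}, ‖Rpoly χ a R q‖ ^ 2)
          ≤ C * (R * Q₁ * Q₂) ^ ε *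
              (Q₁ * Q₂ + min Q₁ Q₂ * R + (min Q₁ Q₂) ^ ((1:ℝ)/3) * (Q₁ * Q₂ * R) ^ ((2:ℝ)/3)) := by
  obtain ⟨δ, hδ⟩ : ∃ δ, δ = ε / 6 := ⟨_, rfl⟩
  have hδ0 : 0 < δ := by rw [hδ]; positivity
  obtain ⟨κ, hκ⟩ : ∃ κ, κ = 2 * (1 + c₂) := ⟨_, rfl⟩
  have hc₂ : 0 < c₂ := by linarith
  have hκ2 : 2 ≤ κ := by rw [hκ]; linarith
  obtain ⟨C₁, hC₁, H1⟩ := Rpoly_reduce hδ0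
  obtain ⟨C₂, hC₂, H2⟩ := family_bound hδ0 hκ2
  refine ⟨C₁ * C₂ * |Ca δ| ^ 2 * 4 ^ (5 * δ), ?_⟩
  intro χ hχ a ha Q₁ Q₂ R hQ₁ hQ₂ hR
  have hQ₁0 : 0 < Q₁ := by linarith
  have hQ₂0 : 0 < Q₂ := by linarith
  have hR0 : 0 < R := by linarith
  have hm0 : 0 < min Q₁ Q₂ := lt_min hQ₁0 hQ₂0
  obtain ⟨G, hG⟩ : ∃ G, G = Q₁ * Q₂ + min Q₁ Q₂ * R + (min Q₁ Q₂) ^ ((1:ℝ)/3) * (Q₁ * Q₂ * R) ^ ((2:ℝ)/3) :=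
    ⟨_, rfl⟩
  have hG0 : 0 ≤ G := by rw [hG]; positivity
  rw [← hG]
  have hX0 : 0 < R * Q₁ * Q₂ := by positivity
  have hRHS : 0 ≤ C₁ * C₂ * |Ca δ| ^ 2 * 4 ^ (5 * δ) * (R * Q₁ * Q₂) ^ ε * G := by positivity
  have hmem : ∀ q, memF₃Q c₁ c₂ Q₁ Q₂ q → ∃ q₁ ∈ SF (κ * Q₁), ∃ q₂ ∈ SF (κ * Q₂), q = q₁ * q₂ ^ 2 := by
    rintro q ⟨q₁, q₂, h1, h2, h3, _, h5, _, _, _, h6, _, h7⟩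
    refine ⟨q₁, mem_SF.2 ⟨h6.trans ?_, h1, sf_left h3⟩, q₂, mem_SF.2 ⟨h7.trans ?_, h2, sf_right h3⟩, h5⟩
    · rw [hκ]; nlinarith
    · rw [hκ]; nlinarith
  have hfin : {q : Eis | memF₃Q c₁ c₂ Q₁ Q₂ q}.Finite := by
    refine (finite_ball (κ * Q₁ * (κ * Q₂) ^ 2)).subset ?_
    intro q hq
    obtain ⟨q₁, h1, q₂, h2, rfl⟩ := hmem q hq
    have g1 := (mem_SF.1 h1).1
    have g2 := (mem_SF.1 h2).1
    change Nm (q₁ * q₂ ^ 2) ≤ _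
    rw [Nm_mul, Nm_pow]
    exact mul_le_mul g1 (pow_le_pow_left₀ (Nm_nonneg _) g2 2) (sq_nonneg _) (by positivity)
  rw [finsum_mem_eq_finite_toFinset_sum _ hfin]
  by_cases hR1 : 1 ≤ R
  · have hb := H2 χ hχ Q₁ Q₂ R hfin.toFinset hQ₁ hQ₂ hR1 (fun q hq => hmem q (hfin.mem_toFinset.1 hq))
    rw [← hG] at hb
    have hA : ∀ b, Rep b → Nm b ≤ R → ‖a b‖ ≤ |Ca δ| * R ^ δ := by
      intro b _ hbR
      refine (ha δ hδ0 b).trans ?_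
      exact mul_le_mul (le_abs_self _) (Real.rpow_le_rpow (Nm_nonneg _) hbR hδ0.le)
        (Real.rpow_nonneg (Nm_nonneg _) _) (abs_nonneg _)
    have hpr : ∀ q ∈ hfin.toFinset, Pr q := by
      intro q hq
      obtain ⟨q₁, h1, q₂, h2, rfl⟩ := hmem q (hfin.mem_toFinset.1 hq)
      exact (mem_SF.1 h1).2.1.mul ((mem_SF.1 h2).2.1.pow 2)
    have h := H1 χ hχ a R (|Ca δ| * R ^ δ) (C₂ * (R * Q₁ * Q₂) ^ δ * G) hfin.toFinset hR1 (by positivity)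
      (by positivity) hA hpr hb
    refine h.trans ?_
    have e1 : R ^ (3 * δ) * (R ^ δ) ^ 2 = R ^ (5 * δ) := by
      rw [← Real.rpow_natCast, ← Real.rpow_mul hR0.le, ← Real.rpow_add hR0]; congr 1; push_cast; ring
    have e2 : R ^ (5 * δ) ≤ 4 ^ (5 * δ) * (R * Q₁ * Q₂) ^ (5 * δ) := by
      rw [← Real.mul_rpow (by norm_num) hX0.le]
      refine Real.rpow_le_rpow hR0.le ?_ (by positivity)
      have : 1 ≤ 4 * (Q₁ * Q₂) := by nlinarith
      nlinarith
    have e3 : (R * Q₁ * Q₂) ^ (5 * δ) * (R * Q₁ * Q₂) ^ δ = (R * Q₁ * Q₂) ^ ε := by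
      rw [← Real.rpow_add hX0, hδ]; congr 1; ring
    calc C₁ * R ^ (3 * δ) * (|Ca δ| * R ^ δ) ^ 2 * (C₂ * (R * Q₁ * Q₂) ^ δ * G)
        = C₁ * C₂ * |Ca δ| ^ 2 * (R ^ (3 * δ) * (R ^ δ) ^ 2) * (R * Q₁ * Q₂) ^ δ * G := by ring
      _ = C₁ * C₂ * |Ca δ| ^ 2 * R ^ (5 * δ) * (R * Q₁ * Q₂) ^ δ * G := by rw [e1]
      _ ≤ C₁ * C₂ * |Ca δ| ^ 2 * (4 ^ (5 * δ) * (R * Q₁ * Q₂) ^ (5 * δ)) * (R * Q₁ * Q₂) ^ δ * G := by gcongr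
      _ = C₁ * C₂ * |Ca δ| ^ 2 * 4 ^ (5 * δ) * ((R * Q₁ * Q₂) ^ (5 * δ) * (R * Q₁ * Q₂) ^ δ) * G := by ring
      _ = _ := by rw [e3]
  · refine (le_of_eq ?_).trans hRHS
    refine Finset.sum_eq_zero fun q _ => ?_
    rw [Rpoly_eq]
    have : RB R = ∅ := by
      refine Finset.eq_empty_of_forall_notMem fun b hb => ?_
      obtain ⟨h1, h2⟩ := mem_RB.1 hb
      exact hR1 ((one_le_Nm h1.ne_zero).trans h2)
    rw [this]; simp

end CubicPaper
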